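/- Let u₀ : ℝ → ℝ be a smooth 2π-periodic function with u₀ > 0 and ∫_0^{2π} u₀(θ)^{−2} dθ = 2π. Then there exists a unique smooth function u : ℝ × [0,∞) → ℝ, 2π-periodic in θ and positive, with u(·,0) = u₀, satisfying the normalized Yamabe flow ∂_t u = (1/4)(R − R̄)·u for all t ∈ [0,∞), where R(θ,t) = u³·(4·∂²_θ u + u) and R̄(t) = (∫_0^{2π} R u^{−2} dθ)/(∫_0^{2π} u^{−2} dθ). Moreover there exist a smooth positive 2π-periodic function u_∞ : ℝ → ℝ and constants C > 0, a > 0 such that sup_θ |u(θ,t) − u_∞(θ)| ≤ C·e^{−at} for all t ≥ 0, and the 4-scalar curvature of u_∞ is constant: u_∞³·(4u_∞'' + u_∞) ≡ const. -/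

import Mathlib

open Real MeasureTheory

/-- The α-scalar curvature `R^α = u³(α u_θθ + u)` of the metric `u⁻⁴ dθ⊗dθ`. -/
noncomputable def scalCurv (α : ℝ) (u : ℝ → ℝ → ℝ) (θ t : ℝ) : ℝ :=
  (u θ t) ^ 3 * (α * deriv (deriv (fun x => u x t)) θ + u θ t)

/-- The average of the α-scalar curvature with respect to arc length `dσ = u⁻²dθ`. -/
noncomputable def scalCurvAvg (α : ℝ) (u : ℝ → ℝ → ℝ) (t : ℝ) : ℝ :=
  (∫ θ in (0:ℝ)..(2 * π), scalCurv α u θ t * ((u θ t) ^ 2)⁻¹) /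
    ∫ θ in (0:ℝ)..(2 * π), ((u θ t) ^ 2)⁻¹

/-- `u` solves the normalized α-scalar-curvature flow `∂ₜu = ¼(R − R̄)u`
on `S¹ × [0,∞)` with initial data `u₀`. -/
def IsNormalizedFlow (α : ℝ) (u₀ : ℝ → ℝ) (u : ℝ → ℝ → ℝ) : Prop :=
  ContDiff ℝ (⊤ : ℕ∞) (fun p : ℝ × ℝ => u p.1 p.2)
  ∧ (∀ θ t, u (θ + 2 * π) t = u θ t)
  ∧ (∀ θ t, 0 < u θ t)
  ∧ (∀ θ, u θ 0 = u₀ θ)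
  ∧ ∀ θ t, 0 ≤ t →
      deriv (fun s => u θ s) t
        = (1 / 4) * (scalCurv α u θ t - scalCurvAvg α u t) * u θ t

namespace YamabeFlow

open Set Filter Topology
open scoped ContDiff BoundedContinuousFunction

section TwoVariables

variable {E : Type*} [NormedAddCommGroup E] [NormedSpace ℝ E]

/-- Joint smoothness of a function of two real variables. -/
def Smooth2 (f : ℝ → ℝ → E) : Prop := ContDiff ℝ ∞ (fun p : ℝ × ℝ => f p.1 p.2)

/-- Partial derivative in the first variable. -/
noncomputable def dx (f : ℝ → ℝ → E) : ℝ → ℝ → E := fun x t => deriv (fun y => f y t) x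

/-- Partial derivative in the second variable. -/
noncomputable def dt (f : ℝ → ℝ → E) : ℝ → ℝ → E := fun x t => deriv (fun s => f x s) t

variable {f g : ℝ → ℝ → E}

theorem Smooth2.continuous (hf : Smooth2 f) : Continuous (fun p : ℝ × ℝ => f p.1 p.2) :=
  ContDiff.continuous hf

theorem Smooth2.comp₂ (hf : Smooth2 f) {G : Type*} [NormedAddCommGroup G] [NormedSpace ℝ G]
    {a b : G → ℝ} (ha : ContDiff ℝ ∞ a) (hb : ContDiff ℝ ∞ b) :
    ContDiff ℝ ∞ (fun z => f (a z) (b z)) :=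
  ContDiff.comp (g := fun p : ℝ × ℝ => f p.1 p.2) hf (ha.prodMk hb)

theorem Smooth2.slice_x (hf : Smooth2 f) (t : ℝ) : ContDiff ℝ ∞ (fun x => f x t) :=
  hf.comp₂ contDiff_id contDiff_const

theorem Smooth2.slice_t (hf : Smooth2 f) (x : ℝ) : ContDiff ℝ ∞ (fun t => f x t) :=
  hf.comp₂ contDiff_const contDiff_id

theorem Smooth2.cont_x (hf : Smooth2 f) (t : ℝ) : Continuous (fun x => f x t) :=
  (hf.slice_x t).continuous

theorem Smooth2.hasDerivAt_x (hf : Smooth2 f) (x t : ℝ) :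
    HasDerivAt (fun y => f y t) (dx f x t) x :=
  ((hf.slice_x t).differentiable (by simp) x).hasDerivAt

theorem Smooth2.hasDerivAt_t (hf : Smooth2 f) (x t : ℝ) :
    HasDerivAt (fun s => f x s) (dt f x t) t :=
  ((hf.slice_t x).differentiable (by simp) t).hasDerivAt

theorem Smooth2.hasFDerivAt (hf : Smooth2 f) (p : ℝ × ℝ) :
    HasFDerivAt (fun p : ℝ × ℝ => f p.1 p.2) (fderiv ℝ (fun p : ℝ × ℝ => f p.1 p.2) p) p :=
  (ContDiff.differentiable hf (by simp) p).hasFDerivAt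

theorem Smooth2.dx_eq (hf : Smooth2 f) (x t : ℝ) :
    dx f x t = fderiv ℝ (fun p : ℝ × ℝ => f p.1 p.2) (x, t) (1, 0) := by
  have h1 : HasDerivAt (fun y : ℝ => (y, t)) ((1 : ℝ), (0 : ℝ)) x :=
    (hasDerivAt_id x).prodMk (hasDerivAt_const x t)
  exact ((hf.hasFDerivAt (x, t)).comp_hasDerivAt x h1).deriv

theorem Smooth2.dt_eq (hf : Smooth2 f) (x t : ℝ) :
    dt f x t = fderiv ℝ (fun p : ℝ × ℝ => f p.1 p.2) (x, t) (0, 1) := by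
  have h1 : HasDerivAt (fun s : ℝ => (x, s)) ((0 : ℝ), (1 : ℝ)) t :=
    (hasDerivAt_const t x).prodMk (hasDerivAt_id t)
  exact ((hf.hasFDerivAt (x, t)).comp_hasDerivAt t h1).deriv

theorem Smooth2.dx (hf : Smooth2 f) : Smooth2 (dx f) := by
  have h := (contDiff_infty_iff_fderiv.1 hf).2
  have h2 : ContDiff ℝ ∞ (fun p : ℝ × ℝ =>
      fderiv ℝ (fun p : ℝ × ℝ => f p.1 p.2) p ((1 : ℝ), (0 : ℝ))) := h.clm_apply contDiff_const
  rw [Smooth2, show (fun p : ℝ × ℝ => YamabeFlow.dx f p.1 p.2) = _ from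
    funext fun p : ℝ × ℝ => hf.dx_eq p.1 p.2]
  exact h2

theorem Smooth2.dt (hf : Smooth2 f) : Smooth2 (dt f) := by
  have h := (contDiff_infty_iff_fderiv.1 hf).2
  have h2 : ContDiff ℝ ∞ (fun p : ℝ × ℝ =>
      fderiv ℝ (fun p : ℝ × ℝ => f p.1 p.2) p ((0 : ℝ), (1 : ℝ))) := h.clm_apply contDiff_const
  rw [Smooth2, show (fun p : ℝ × ℝ => YamabeFlow.dt f p.1 p.2) = _ from
    funext fun p : ℝ × ℝ => hf.dt_eq p.1 p.2]
  exact h2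

theorem Smooth2.dt_dx (hf : Smooth2 f) (x t : ℝ) :
    YamabeFlow.dt (YamabeFlow.dx f) x t = YamabeFlow.dx (YamabeFlow.dt f) x t := by
  have h := (contDiff_infty_iff_fderiv.1 hf).2
  have hd : HasFDerivAt (fderiv ℝ (fun p : ℝ × ℝ => f p.1 p.2))
      (fderiv ℝ (fderiv ℝ (fun p : ℝ × ℝ => f p.1 p.2)) (x, t)) (x, t) :=
    (h.differentiable (by simp) (x, t)).hasFDerivAt
  have sym : IsSymmSndFDerivAt ℝ (fun p : ℝ × ℝ => f p.1 p.2) (x, t) :=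
    (ContDiff.contDiffAt (n := ∞) hf).isSymmSndFDerivAt
      (by rw [minSmoothness_of_isRCLikeNormedField]; exact ENat.LEInfty.out)
  rw [hf.dx.dt_eq, hf.dt.dx_eq]
  have e1 : (fun p : ℝ × ℝ => YamabeFlow.dx f p.1 p.2) = fun p =>
      fderiv ℝ (fun p : ℝ × ℝ => f p.1 p.2) p ((1 : ℝ), (0 : ℝ)) := by
    funext p; exact hf.dx_eq p.1 p.2
  have e2 : (fun p : ℝ × ℝ => YamabeFlow.dt f p.1 p.2) = fun p =>
      fderiv ℝ (fun p : ℝ × ℝ => f p.1 p.2) p ((0 : ℝ), (1 : ℝ)) := by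
    funext p; exact hf.dt_eq p.1 p.2
  rw [e1, e2]
  rw [(hd.clm_apply (hasFDerivAt_const ((1 : ℝ), (0 : ℝ)) (x, t))).fderiv,
    (hd.clm_apply (hasFDerivAt_const ((0 : ℝ), (1 : ℝ)) (x, t))).fderiv]
  simpa using sym (0, 1) (1, 0)

theorem dx_periodic {T : ℝ} (h : ∀ x t, f (x + T) t = f x t) (x t : ℝ) :
    dx f (x + T) t = dx f x t := by
  unfold dx
  rw [← deriv_comp_add_const]
  simp only [h]

theorem Smooth2.hasDerivAt_integral [CompleteSpace E] (hf : Smooth2 f) (a b t : ℝ) :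
    HasDerivAt (fun s => ∫ x in a..b, f x s) (∫ x in a..b, YamabeFlow.dt f x t) t := by
  obtain ⟨C, hC⟩ := ((isCompact_uIcc (a := a) (b := b)).prod
    (isCompact_Icc (a := t - 1) (b := t + 1))).exists_bound_of_continuousOn
    hf.dt.continuous.continuousOn
  refine (intervalIntegral.hasDerivAt_integral_of_dominated_loc_of_deriv_le
    (F := fun s x => f x s) (F' := fun s x => YamabeFlow.dt f x s) (bound := fun _ => C)
    (s := Icc (t - 1) (t + 1)) (Icc_mem_nhds (by linarith) (by linarith))
    (Eventually.of_forall fun s => (hf.cont_x s).aestronglyMeasurable)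
    ((hf.cont_x t).intervalIntegrable _ _) (hf.dt.cont_x t).aestronglyMeasurable
    (Eventually.of_forall fun x hx s hs => ?_) (by simp)
    (Eventually.of_forall fun x _ s _ => hf.hasDerivAt_t x s)).2
  exact hC (x, s) ⟨uIoc_subset_uIcc hx, hs⟩

end TwoVariables

theorem integral_deriv_eq_zero_of_periodic {E : Type*} [NormedAddCommGroup E] [NormedSpace ℝ E]
    [CompleteSpace E] {f f' : ℝ → E} (hf : ∀ x, HasDerivAt f (f' x) x) (hc : Continuous f')
    {T : ℝ} (hp : f T = f 0) : ∫ x in (0:ℝ)..T, f' x = 0 := by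
  rw [intervalIntegral.integral_eq_sub_of_hasDerivAt (fun x _ => hf x)
    (hc.intervalIntegrable _ _), hp, sub_self]

theorem le_of_hasDerivAt_nonpos {F F' : ℝ → ℝ} {a b : ℝ} (hab : a ≤ b)
    (h : ∀ t ∈ Icc a b, HasDerivAt F (F' t) t) (hn : ∀ t ∈ Icc a b, F' t ≤ 0) : F b ≤ F a := by
  refine antitoneOn_of_deriv_nonpos (convex_Icc a b)
    (fun t ht => (h t ht).continuousAt.continuousWithinAt)
    (fun t ht => (h t (interior_subset ht)).differentiableAt.differentiableWithinAt)
    (fun t ht => ?_) (left_mem_Icc.2 hab) (right_mem_Icc.2 hab) hab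
  rw [(h t (interior_subset ht)).deriv]
  exact hn t (interior_subset ht)

theorem le_exp_mul_of_hasDerivAt_le {F F' : ℝ → ℝ} {a b C : ℝ} (hab : a ≤ b)
    (h : ∀ t ∈ Icc a b, HasDerivAt F (F' t) t) (hn : ∀ t ∈ Icc a b, F' t ≤ C * F t) :
    F b ≤ F a * exp (C * (b - a)) := by
  have key := le_of_hasDerivAt_nonpos (F := fun t => F t * exp (-C * t))
    (F' := fun t => F' t * exp (-C * t) + F t * (exp (-C * t) * (-C))) hab
    (fun t ht => by
      have := ((hasDerivAt_id t).const_mul (-C)).exp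
      simp only [id, mul_one] at this
      exact (h t ht).mul this)
    (fun t ht => by
      have := hn t ht
      have h2 : F' t * exp (-C * t) + F t * (exp (-C * t) * (-C))
        = (F' t - C * F t) * exp (-C * t) := by ring
      rw [h2]
      exact mul_nonpos_of_nonpos_of_nonneg (by linarith) (exp_pos _).le)
  have h3 : exp (C * (b - a)) = exp (-C * a) * exp (C * b) := by rw [← exp_add]; ring_nf
  have h4 : exp (-C * b) * exp (C * b) = 1 := by rw [← exp_add]; simp
  calc F b = F b * exp (-C * b) * exp (C * b) := by rw [mul_assoc, h4, mul_one]
    _ ≤ F a * exp (-C * a) * exp (C * b) := by gcongr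
    _ = _ := by rw [h3]; ring

theorem sq_integral_mul_le {f g : ℝ → ℝ} (hf : Continuous f) (hg : Continuous g) {a b : ℝ}
    (hab : a ≤ b) :
    (∫ x in a..b, f x * g x) ^ 2 ≤ (∫ x in a..b, f x ^ 2) * ∫ x in a..b, g x ^ 2 := by
  have key : ∀ c : ℝ, 0 ≤ (∫ x in a..b, g x ^ 2) * (c * c) + (2 * ∫ x in a..b, f x * g x) * c
      + ∫ x in a..b, f x ^ 2 := by
    intro c
    have h0 : 0 ≤ ∫ x in a..b, (c * g x + f x) ^ 2 :=
      intervalIntegral.integral_nonneg hab fun x _ => sq_nonneg _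
    have h1 : ∫ x in a..b, (c * g x + f x) ^ 2 = ∫ x in a..b,
        (((c * c) * g x ^ 2 + (2 * c) * (f x * g x)) + f x ^ 2) := by
      congr 1; ext x; ring
    rw [h1, intervalIntegral.integral_add, intervalIntegral.integral_add,
      intervalIntegral.integral_const_mul, intervalIntegral.integral_const_mul] at h0
    · linarith
    all_goals exact Continuous.intervalIntegrable (by fun_prop) _ _
  have := discrim_le_zero key
  rw [discrim] at this
  nlinarith

theorem sq_integral_abs_le {f : ℝ → ℝ} (hf : Continuous f) :
    (∫ x in (0:ℝ)..(2 * π), |f x|) ^ 2 ≤ 2 * π * ∫ x in (0:ℝ)..(2 * π), f x ^ 2 := by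
  have := sq_integral_mul_le hf.abs (continuous_const (y := (1:ℝ))) two_pi_pos.le
  simp only [mul_one, sq_abs, one_pow, intervalIntegral.integral_const, sub_zero, smul_eq_mul]
    at this
  linarith

theorem integral_mul_deriv_periodic {f g f' g' : ℝ → ℝ} (hf : ∀ x, HasDerivAt f (f' x) x)
    (hg : ∀ x, HasDerivAt g (g' x) x) (hf' : Continuous f') (hg' : Continuous g') {T : ℝ}
    (hfp : f T = f 0) (hgp : g T = g 0) :
    ∫ x in (0:ℝ)..T, f x * g' x = - ∫ x in (0:ℝ)..T, f' x * g x := by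
  rw [intervalIntegral.integral_mul_deriv_eq_deriv_mul (fun x _ => hf x) (fun x _ => hg x)
    (hf'.intervalIntegrable _ _) (hg'.intervalIntegrable _ _), hfp, hgp]
  ring

/-- A smooth positive periodic solution of the normalized flow for times in `[0, T)`. -/
structure FlowOn (T : ℝ) (u : ℝ → ℝ → ℝ) : Prop where
  smooth : Smooth2 u
  per : ∀ θ t, u (θ + 2 * π) t = u θ t
  pos : ∀ θ t, 0 < u θ t
  norm : ∫ θ in (0:ℝ)..(2 * π), ((u θ 0) ^ 2)⁻¹ = 2 * π
  flow : ∀ θ t, 0 ≤ t → t < T →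
    dt u θ t = (1 / 4) * (scalCurv 4 u θ t - scalCurvAvg 4 u t) * u θ t

theorem scalCurv_eq (u : ℝ → ℝ → ℝ) (θ t : ℝ) :
    scalCurv 4 u θ t = u θ t ^ 3 * (4 * dx (dx u) θ t + u θ t) := rfl

theorem Smooth2.of_contDiff {f : ℝ → ℝ → ℝ} (h : ContDiff ℝ ∞ (fun p : ℝ × ℝ => f p.1 p.2)) :
    Smooth2 f := h

theorem Smooth2.contDiff {f : ℝ → ℝ → ℝ} (h : Smooth2 f) :
    ContDiff ℝ ∞ (fun p : ℝ × ℝ => f p.1 p.2) := h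

theorem Smooth2.scalCurv {u : ℝ → ℝ → ℝ} (hu : Smooth2 u) : Smooth2 (scalCurv 4 u) := by
  have h1 := hu.contDiff
  have h2 := hu.dx.dx.contDiff
  exact Smooth2.of_contDiff ((h1.pow 3).mul ((contDiff_const.mul h2).add h1))

theorem Smooth2.inv_pow {u : ℝ → ℝ → ℝ} (hu : Smooth2 u) (hpos : ∀ θ t, 0 < u θ t) (n : ℕ) :
    Smooth2 (fun θ t => (u θ t ^ n)⁻¹) :=
  (hu.contDiff.pow n).inv fun p => (pow_pos (hpos p.1 p.2) n).ne'

namespace FlowOn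

variable {T : ℝ} {u : ℝ → ℝ → ℝ}

theorem ne (h : FlowOn T u) (θ t : ℝ) : u θ t ≠ 0 := (h.pos θ t).ne'

theorem per_zero (h : FlowOn T u) (t : ℝ) : u (2 * π) t = u 0 t := by
  simpa using h.per 0 t

theorem smooth_inv (h : FlowOn T u) (n : ℕ) : Smooth2 (fun θ t => (u θ t ^ n)⁻¹) :=
  h.smooth.inv_pow h.pos n

theorem smooth_curv_inv (h : FlowOn T u) :
    Smooth2 (fun θ t => scalCurv 4 u θ t * (u θ t ^ 2)⁻¹) :=
  Smooth2.of_contDiff (h.smooth.scalCurv.contDiff.mul (h.smooth_inv 2).contDiff)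

theorem length_pos (h : FlowOn T u) (t : ℝ) : 0 < ∫ θ in (0:ℝ)..(2 * π), ((u θ t) ^ 2)⁻¹ :=
  intervalIntegral.intervalIntegral_pos_of_pos
    (((h.smooth_inv 2).cont_x t).intervalIntegrable _ _)
    (fun x => inv_pos.2 (pow_pos (h.pos x t) 2)) two_pi_pos

theorem hasDerivAt_inv_sq (h : FlowOn T u) {t : ℝ} (h0 : 0 ≤ t) (hT : t < T) (θ : ℝ) :
    HasDerivAt (fun s => ((u θ s) ^ 2)⁻¹)
      (-(1 / 2) * (scalCurv 4 u θ t - scalCurvAvg 4 u t) * ((u θ t) ^ 2)⁻¹) t := by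
  have h1 := ((h.smooth.hasDerivAt_t θ t).pow 2).inv (pow_ne_zero 2 (h.ne θ t))
  refine HasDerivAt.congr_deriv h1 ?_
  rw [h.flow θ t h0 hT]
  have := h.ne θ t
  simp only [Pi.pow_apply]
  field_simp
  norm_num
  ring

theorem length_eq (h : FlowOn T u) {t : ℝ} (h0 : 0 ≤ t) (hT : t < T) :
    ∫ θ in (0:ℝ)..(2 * π), ((u θ t) ^ 2)⁻¹ = 2 * π := by
  have hd : ∀ s ∈ Icc 0 t, HasDerivAt (fun s => ∫ θ in (0:ℝ)..(2 * π), ((u θ s) ^ 2)⁻¹) 0 s := by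
    intro s hs
    have h1 := (h.smooth_inv 2).hasDerivAt_integral 0 (2 * π) s
    refine h1.congr_deriv ?_
    have h2 : ∀ θ, dt (fun θ t => (u θ t ^ 2)⁻¹) θ s = -(1 / 2) * (scalCurv 4 u θ s * (u θ s ^ 2)⁻¹
        - scalCurvAvg 4 u s * (u θ s ^ 2)⁻¹) := by
      intro θ
      rw [dt, (h.hasDerivAt_inv_sq hs.1 (hs.2.trans_lt hT) θ).deriv]
      ring
    simp only [h2]
    rw [intervalIntegral.integral_const_mul, intervalIntegral.integral_sub
      ((h.smooth_curv_inv.cont_x s).intervalIntegrable _ _)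
      ((((h.smooth_inv 2).cont_x s).const_mul _).intervalIntegrable _ _),
      intervalIntegral.integral_const_mul]
    have h3 := (h.length_pos s).ne'
    rw [scalCurvAvg, div_mul_cancel₀ _ h3, sub_self, mul_zero]
  have e1 := le_of_hasDerivAt_nonpos h0 hd (fun _ _ => le_rfl)
  have e2 := le_of_hasDerivAt_nonpos h0 (fun s hs => (hd s hs).neg) (fun _ _ => by simp)
  simp only [Pi.neg_apply, neg_le_neg_iff] at e2
  exact (le_antisymm e1 e2).trans h.norm

theorem avg_eq (h : FlowOn T u) {t : ℝ} (h0 : 0 ≤ t) (hT : t < T) :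
    scalCurvAvg 4 u t = (2 * π)⁻¹ * ∫ θ in (0:ℝ)..(2 * π),
      (4 * (u θ t * dx (dx u) θ t) + u θ t ^ 2) := by
  rw [scalCurvAvg, h.length_eq h0 hT, div_eq_inv_mul]
  congr 2
  ext θ
  rw [scalCurv_eq]
  have := h.ne θ t
  field_simp

theorem mono (h : FlowOn T u) {T' : ℝ} (hT : T' ≤ T) : FlowOn T' u :=
  ⟨h.smooth, h.per, h.pos, h.norm, fun θ t h0 h1 => h.flow θ t h0 (h1.trans_le hT)⟩

theorem avg_sub_avg {v : ℝ → ℝ → ℝ} (hu : FlowOn T u) (hv : FlowOn T v) {t : ℝ} (h0 : 0 ≤ t)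
    (hT : t < T) : scalCurvAvg 4 u t - scalCurvAvg 4 v t = (2 * π)⁻¹ * ∫ θ in (0:ℝ)..(2 * π),
      (u θ t - v θ t) * (4 * dx (dx u) θ t + 4 * dx (dx v) θ t + u θ t + v θ t) := by
  rw [hu.avg_eq h0 hT, hv.avg_eq h0 hT, ← mul_sub]
  congr 1
  have c1 := hu.smooth.cont_x t
  have c2 := hv.smooth.cont_x t
  have c3 := hu.smooth.dx.dx.cont_x t
  have c4 := hv.smooth.dx.dx.cont_x t
  have c5 := hu.smooth.dx.cont_x t
  have c6 := hv.smooth.dx.cont_x t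
  rw [← intervalIntegral.integral_sub (Continuous.intervalIntegrable (by fun_prop) _ _)
    (Continuous.intervalIntegrable (by fun_prop) _ _), ← sub_eq_zero,
    ← intervalIntegral.integral_sub (Continuous.intervalIntegrable (by fun_prop) _ _)
    (Continuous.intervalIntegrable (by fun_prop) _ _)]
  have := integral_deriv_eq_zero_of_periodic (T := 2 * π)
    (f := fun x => 4 * (v x t * dx u x t - u x t * dx v x t))
    (f' := fun x => 4 * ((dx v x t * dx u x t + v x t * dx (dx u) x t)
      - (dx u x t * dx v x t + u x t * dx (dx v) x t)))
    (fun x => (((hv.smooth.hasDerivAt_x x t).mul (hu.smooth.dx.hasDerivAt_x x t)).sub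
      ((hu.smooth.hasDerivAt_x x t).mul (hv.smooth.dx.hasDerivAt_x x t))).const_mul 4)
    (by fun_prop) (by
      have p1 := dx_periodic hu.per 0 t
      have p2 := dx_periodic hv.per 0 t
      simp only [zero_add] at p1 p2
      simp only [p1, p2, hu.per_zero, hv.per_zero])
  rw [← this]
  congr 1
  ext θ
  ring

theorem continuous_avg (h : FlowOn T u) : Continuous (scalCurvAvg 4 u) := by
  have c1 : Continuous fun s => ∫ θ in (0:ℝ)..(2 * π), scalCurv 4 u θ s * ((u θ s) ^ 2)⁻¹ :=
    continuous_iff_continuousAt.2 fun s => (h.smooth_curv_inv.hasDerivAt_integral _ _ s).continuousAt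
  have c2 : Continuous fun s => ∫ θ in (0:ℝ)..(2 * π), ((u θ s) ^ 2)⁻¹ :=
    continuous_iff_continuousAt.2 fun s => ((h.smooth_inv 2).hasDerivAt_integral _ _ s).continuousAt
  exact c1.div c2 fun s => (h.length_pos s).ne'

end FlowOn

theorem eq_zero_of_integral_nonpos {f : ℝ → ℝ} (hf : Continuous f) (h0 : ∀ x, 0 ≤ f x)
    (hp : ∀ x, f (x + 2 * π) = f x) (hi : ∫ x in (0:ℝ)..(2 * π), f x ≤ 0) (x : ℝ) : f x = 0 := by
  obtain ⟨y, hy, hxy⟩ := Function.Periodic.exists_mem_Ico₀ (f := f) hp two_pi_pos x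
  rw [hxy]
  by_contra hne
  have := intervalIntegral.integral_pos two_pi_pos hf.continuousOn (fun x _ => h0 x)
    ⟨y, ⟨hy.1, hy.2.le⟩, lt_of_le_of_ne (h0 y) (Ne.symm hne)⟩
  linarith

theorem exists_bound_of_continuous₂ {f : ℝ → ℝ → ℝ} (hf : Continuous fun p : ℝ × ℝ => f p.1 p.2)
    (a b c d : ℝ) : ∃ C, 0 ≤ C ∧ ∀ x ∈ Icc a b, ∀ t ∈ Icc c d, |f x t| ≤ C := by
  obtain ⟨C, hC⟩ := ((isCompact_Icc (a := a) (b := b)).prod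
    (isCompact_Icc (a := c) (b := d))).exists_bound_of_continuousOn hf.continuousOn
  exact ⟨max C 0, le_max_right _ _, fun x hx t ht => (hC (x, t) ⟨hx, ht⟩).trans (le_max_left _ _)⟩

namespace FlowOn

variable {T : ℝ} {u v : ℝ → ℝ → ℝ}

theorem eq_of_initial_eq (hu : FlowOn T u) (hv : FlowOn T v) (h0 : ∀ θ, u θ 0 = v θ 0)
    (θ : ℝ) {t : ℝ} (ht : 0 ≤ t) (hT : t < T) : u θ t = v θ t := by
  have cu := hu.smooth.continuous
  have cv := hv.smooth.continuous
  have cu2 := hu.smooth.dx.dx.continuous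
  have cv2 := hv.smooth.dx.dx.continuous
  have cut := hu.smooth.dt.continuous
  have cR : Continuous fun p : ℝ × ℝ => scalCurvAvg 4 u p.2 := hu.continuous_avg.comp continuous_snd
  have ci4 := (hu.smooth_inv 4).continuous
  have ci5 := (hu.smooth_inv 5).continuous
  set a : ℝ → ℝ → ℝ := fun x s => 2 * (u x s ^ 4)⁻¹ *
    ((u x s + v x s) * (u x s ^ 2 + v x s ^ 2) * dx (dx v) x s
      + (1 / 4) * (u x s ^ 4 + u x s ^ 3 * v x s + u x s ^ 2 * v x s ^ 2 + u x s * v x s ^ 3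
        + v x s ^ 4) - (1 / 4) * scalCurvAvg 4 u s)
    - 4 * (u x s ^ 5)⁻¹ * dt u x s with ha
  set b : ℝ → ℝ → ℝ := fun x s => v x s * (u x s ^ 4)⁻¹ with hb
  set c : ℝ → ℝ → ℝ := fun x s => 4 * dx (dx u) x s + 4 * dx (dx v) x s + u x s + v x s with hc
  set w : ℝ → ℝ → ℝ := fun x s => u x s - v x s with hw
  have sw : Smooth2 w := Smooth2.of_contDiff (hu.smooth.contDiff.sub hv.smooth.contDiff)
  have ca : Continuous fun p : ℝ × ℝ => a p.1 p.2 := by fun_prop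
  have cb : Continuous fun p : ℝ × ℝ => b p.1 p.2 := by fun_prop
  have cc : Continuous fun p : ℝ × ℝ => c p.1 p.2 := by fun_prop
  obtain ⟨A, hA0, hA⟩ := exists_bound_of_continuous₂ ca 0 (2 * π) 0 t
  obtain ⟨B, hB0, hB⟩ := exists_bound_of_continuous₂ cb 0 (2 * π) 0 t
  obtain ⟨C, hC0, hC⟩ := exists_bound_of_continuous₂ cc 0 (2 * π) 0 t
  obtain ⟨K, hK0, hK⟩ := exists_bound_of_continuous₂ (f := fun x s => u x s ^ 4) (by fun_prop)
    0 (2 * π) 0 t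
  have sE : Smooth2 fun x s => w x s ^ 2 * (u x s ^ 4)⁻¹ :=
    Smooth2.of_contDiff ((sw.contDiff.pow 2).mul (hu.smooth_inv 4).contDiff)
  have hwp : ∀ x s, w (x + 2 * π) s = w x s := fun x s => by simp only [hw, hu.per, hv.per]
  have hwxx : ∀ x s, dx (dx w) x s = dx (dx u) x s - dx (dx v) x s := by
    intro x s
    have e : dx w = fun x s => dx u x s - dx v x s := by
      funext x s
      exact ((hu.smooth.hasDerivAt_x x s).sub (hv.smooth.hasDerivAt_x x s)).deriv
    rw [e]
    exact ((hu.smooth.dx.hasDerivAt_x x s).sub (hv.smooth.dx.hasDerivAt_x x s)).deriv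
  have hdt : ∀ s ∈ Icc 0 t, ∀ x, dt (fun x s => w x s ^ 2 * (u x s ^ 4)⁻¹) x s =
      2 * (w x s * dx (dx w) x s) + a x s * w x s ^ 2
        - (1 / 2) * (scalCurvAvg 4 u s - scalCurvAvg 4 v s) * (b x s * w x s) := by
    intro s hs x
    have h1 := (((hu.smooth.hasDerivAt_t x s).sub (hv.smooth.hasDerivAt_t x s)).pow 2).mul
      (((hu.smooth.hasDerivAt_t x s).pow 4).inv (pow_ne_zero 4 (hu.ne x s)))
    refine h1.deriv.trans ?_
    rw [hwxx]
    simp only [ha, hb, hw, Pi.pow_apply, Pi.sub_apply, Pi.inv_apply]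
    rw [hu.flow x s hs.1 (hs.2.trans_lt hT), hv.flow x s hs.1 (hs.2.trans_lt hT), scalCurv_eq,
      scalCurv_eq]
    have := hu.ne x s
    field_simp
    ring
  have hE : ∀ s ∈ Icc 0 t, (∫ x in (0:ℝ)..(2 * π), dt (fun x s => w x s ^ 2 * (u x s ^ 4)⁻¹) x s)
      ≤ ((A + (1 / 2) * B * C) * K) * ∫ x in (0:ℝ)..(2 * π), w x s ^ 2 * (u x s ^ 4)⁻¹ := by
    intro s hs
    have c0 := sw.cont_x s
    have c1 := sw.dx.cont_x s
    have c2 := sw.dx.dx.cont_x s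
    have c3 : Continuous fun x => a x s := ca.comp (Continuous.prodMk_left s)
    have c4 : Continuous fun x => b x s := cb.comp (Continuous.prodMk_left s)
    have c5 : Continuous fun x => c x s := cc.comp (Continuous.prodMk_left s)
    have c6 := (hu.smooth_inv 4).cont_x s
    simp only [hdt s hs]
    have iw : ∫ x in (0:ℝ)..(2 * π), w x s * dx (dx w) x s
        = - ∫ x in (0:ℝ)..(2 * π), dx w x s * dx w x s := by
      have q1 := hwp 0 s
      have q2 := dx_periodic hwp 0 s
      rw [zero_add] at q1 q2
      exact integral_mul_deriv_periodic (fun x => sw.hasDerivAt_x x s)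
        (fun x => sw.dx.hasDerivAt_x x s) c1 c2 q1 q2
    have iw0 : 0 ≤ ∫ x in (0:ℝ)..(2 * π), dx w x s * dx w x s :=
      intervalIntegral.integral_nonneg two_pi_pos.le fun x _ => mul_self_nonneg _
    set W := ∫ x in (0:ℝ)..(2 * π), |w x s| with hW
    have hW0 : 0 ≤ W := intervalIntegral.integral_nonneg two_pi_pos.le fun x _ => abs_nonneg _
    have hW2 : W ^ 2 ≤ 2 * π * ∫ x in (0:ℝ)..(2 * π), w x s ^ 2 := sq_integral_abs_le c0
    have ia : ∫ x in (0:ℝ)..(2 * π), a x s * w x s ^ 2 ≤ A * ∫ x in (0:ℝ)..(2 * π), w x s ^ 2 := by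
      rw [← intervalIntegral.integral_const_mul]
      refine intervalIntegral.integral_mono_on two_pi_pos.le
        (Continuous.intervalIntegrable (by fun_prop) _ _)
        (Continuous.intervalIntegrable (by fun_prop) _ _) fun x hx => ?_
      exact mul_le_mul_of_nonneg_right ((le_abs_self _).trans (hA x hx s hs)) (sq_nonneg _)
    have absb : ∀ {g : ℝ → ℝ} {G : ℝ}, Continuous g → (∀ x ∈ Icc 0 (2 * π), |g x| ≤ G) →
        |∫ x in (0:ℝ)..(2 * π), g x * w x s| ≤ G * W := by
      intro g G hg hG
      refine (intervalIntegral.abs_integral_le_integral_abs two_pi_pos.le).trans ?_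
      rw [hW, ← intervalIntegral.integral_const_mul]
      refine intervalIntegral.integral_mono_on two_pi_pos.le
        (Continuous.intervalIntegrable (by fun_prop) _ _)
        (Continuous.intervalIntegrable (by fun_prop) _ _) fun x hx => ?_
      rw [abs_mul]
      exact mul_le_mul_of_nonneg_right (hG x hx) (abs_nonneg _)
    have ib := absb c4 (fun x hx => hB x hx s hs)
    have ic := absb c5 (fun x hx => hC x hx s hs)
    have hδ : |scalCurvAvg 4 u s - scalCurvAvg 4 v s| ≤ (2 * π)⁻¹ * (C * W) := by
      rw [hu.avg_sub_avg hv hs.1 (hs.2.trans_lt hT), abs_mul, abs_of_pos (inv_pos.2 two_pi_pos)]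
      refine mul_le_mul_of_nonneg_left ?_ (inv_pos.2 two_pi_pos).le
      simpa only [hw, hc, mul_comm] using ic
    have iK : ∫ x in (0:ℝ)..(2 * π), w x s ^ 2
        ≤ K * ∫ x in (0:ℝ)..(2 * π), w x s ^ 2 * (u x s ^ 4)⁻¹ := by
      rw [← intervalIntegral.integral_const_mul]
      refine intervalIntegral.integral_mono_on two_pi_pos.le
        (Continuous.intervalIntegrable (by fun_prop) _ _)
        (Continuous.intervalIntegrable (by fun_prop) _ _) fun x hx => ?_
      have h1 := (le_abs_self _).trans (hK x hx s hs)
      have h2 : 0 ≤ w x s ^ 2 * (u x s ^ 4)⁻¹ := by have := hu.pos x s; positivity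
      calc w x s ^ 2 = u x s ^ 4 * (w x s ^ 2 * (u x s ^ 4)⁻¹) := by
            have := hu.ne x s
            field_simp
        _ ≤ _ := mul_le_mul_of_nonneg_right h1 h2
    have ip : -(1 / 2) * (scalCurvAvg 4 u s - scalCurvAvg 4 v s) *
        (∫ x in (0:ℝ)..(2 * π), b x s * w x s)
        ≤ (1 / 2) * B * C * ∫ x in (0:ℝ)..(2 * π), w x s ^ 2 := by
      have h1 : |(scalCurvAvg 4 u s - scalCurvAvg 4 v s) *
          (∫ x in (0:ℝ)..(2 * π), b x s * w x s)| ≤ ((2 * π)⁻¹ * (C * W)) * (B * W) := by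
        rw [abs_mul]
        exact mul_le_mul hδ ib (abs_nonneg _) (by positivity)
      have h2 : ((2 * π)⁻¹ * (C * W)) * (B * W) ≤ B * C * ∫ x in (0:ℝ)..(2 * π), w x s ^ 2 := by
        calc ((2 * π)⁻¹ * (C * W)) * (B * W) = (B * C * (2 * π)⁻¹) * W ^ 2 := by ring
          _ ≤ (B * C * (2 * π)⁻¹) * (2 * π * ∫ x in (0:ℝ)..(2 * π), w x s ^ 2) := by gcongr
          _ = _ := by field_simp
      have := (neg_abs_le _).trans' (neg_le_neg h1)
      linarith
    rw [intervalIntegral.integral_sub (Continuous.intervalIntegrable (by fun_prop) _ _)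
      (Continuous.intervalIntegrable (by fun_prop) _ _), intervalIntegral.integral_add
      (Continuous.intervalIntegrable (by fun_prop) _ _)
      (Continuous.intervalIntegrable (by fun_prop) _ _), intervalIntegral.integral_const_mul,
      intervalIntegral.integral_const_mul, iw]
    have := mul_le_mul_of_nonneg_left iK (show 0 ≤ A + 1 / 2 * B * C by positivity)
    linarith
  have key := le_exp_mul_of_hasDerivAt_le ht
    (fun s _ => sE.hasDerivAt_integral 0 (2 * π) s) hE
  have hz : ∫ x in (0:ℝ)..(2 * π), w x 0 ^ 2 * (u x 0 ^ 4)⁻¹ = 0 := by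
    simp [hw, h0]
  rw [hz, zero_mul] at key
  have h5 := eq_zero_of_integral_nonpos (sE.cont_x t)
    (fun x => by have := hu.pos x t; positivity) (fun x => by simp only [hwp, hu.per]) key θ
  have h6 : w θ t ^ 2 = 0 := by
    rcases mul_eq_zero.1 h5 with h | h
    · exact h
    · exact absurd (inv_eq_zero.1 h) (pow_ne_zero 4 (hu.ne θ t))
  exact sub_eq_zero.1 (pow_eq_zero_iff (two_ne_zero)|>.1 h6)

end FlowOn

/-- The character `x ↦ exp(i n x)`. -/
noncomputable def expI (n : ℤ) (x : ℝ) : ℂ := Complex.exp (((n * x : ℝ) : ℂ) * Complex.I)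

theorem norm_expI (n : ℤ) (x : ℝ) : ‖expI n x‖ = 1 := Complex.norm_exp_ofReal_mul_I _

theorem expI_zero (x : ℝ) : expI 0 x = 1 := by simp [expI]

theorem expI_at_zero (n : ℤ) : expI n 0 = 1 := by simp [expI]

theorem expI_add (m n : ℤ) (x : ℝ) : expI (m + n) x = expI m x * expI n x := by
  rw [expI, expI, expI, ← Complex.exp_add]
  push_cast
  ring_nf

theorem star_expI (n : ℤ) (x : ℝ) : (starRingEnd ℂ) (expI n x) = expI (-n) x := by
  rw [expI, expI, ← Complex.exp_conj]
  congr 1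
  simp

theorem expI_eq_fourier (n : ℤ) (x : ℝ) : expI n x = fourier n (x : AddCircle (2 * π - 0)) := by
  rw [fourier_coe_apply, expI]
  congr 1
  have : (π : ℂ) ≠ 0 := Complex.ofReal_ne_zero.2 pi_ne_zero
  push_cast
  field_simp
  ring

theorem expI_periodic (n : ℤ) (x : ℝ) : expI n (x + 2 * π) = expI n x := by
  rw [expI, expI, ← Complex.exp_periodic.int_mul n (((n * x : ℝ) : ℂ) * Complex.I)]
  congr 1
  push_cast
  ring

theorem hasDerivAt_expI (n : ℤ) (x : ℝ) : HasDerivAt (expI n) (Complex.I * n * expI n x) x := by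
  have h1 : HasDerivAt (fun x : ℝ => (((n * x : ℝ) : ℂ) * Complex.I)) (n * Complex.I) x := by
    have := (((hasDerivAt_id x).const_mul (n : ℝ)).ofReal_comp).mul_const Complex.I
    simpa using this
  exact h1.cexp.congr_deriv (by rw [expI]; ring)

theorem contDiff_expI (n : ℤ) : ContDiff ℝ ∞ (expI n) := by
  unfold expI
  exact ((Complex.ofRealCLM.contDiff.comp (contDiff_const.mul contDiff_id)).mul
    contDiff_const).cexp

theorem continuous_expI (n : ℤ) : Continuous (expI n) := (contDiff_expI n).continuous

/-- Fourier coefficients of a `2π`-periodic function. -/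
noncomputable def fc (h : ℝ → ℂ) (n : ℤ) : ℂ :=
  (2 * π : ℂ)⁻¹ * ∫ x in (0:ℝ)..(2 * π), expI (-n) x * h x

theorem fc_eq_fourierCoeffOn (h : ℝ → ℂ) (n : ℤ) : fc h n = fourierCoeffOn two_pi_pos h n := by
  rw [fourierCoeffOn_eq_integral, fc]
  simp only [smul_eq_mul, expI_eq_fourier, Complex.real_smul]
  congr 1
  push_cast
  ring

variable {h g : ℝ → ℂ}

theorem fc_add (hh : Continuous h) (hg : Continuous g) (n : ℤ) :
    fc (fun x => h x + g x) n = fc h n + fc g n := by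
  have := continuous_expI (-n)
  simp only [fc, mul_add]
  rw [intervalIntegral.integral_add (Continuous.intervalIntegrable (by fun_prop) _ _)
    (Continuous.intervalIntegrable (by fun_prop) _ _), mul_add]

theorem fc_const_mul (c : ℂ) (h : ℝ → ℂ) (n : ℤ) : fc (fun x => c * h x) n = c * fc h n := by
  simp only [fc]
  simp only [mul_left_comm _ c, intervalIntegral.integral_const_mul]

theorem fc_sub (hh : Continuous h) (hg : Continuous g) (n : ℤ) :
    fc (fun x => h x - g x) n = fc h n - fc g n := by
  have e := fc_add hh (g := fun x => (-1) * g x) (by fun_prop) n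
  rw [fc_const_mul] at e
  rw [sub_eq_add_neg, ← neg_one_mul, ← e]
  congr 1
  ext x
  ring

theorem fc_conj (h : ℝ → ℂ) (n : ℤ) :
    fc (fun x => (starRingEnd ℂ) (h x)) n = (starRingEnd ℂ) (fc h (-n)) := by
  simp only [fc, map_mul, neg_neg]
  rw [← intervalIntegral.intervalIntegral_conj, map_inv₀, map_mul, map_ofNat, Complex.conj_ofReal]
  simp [star_expI]

theorem fc_deriv {h' : ℝ → ℂ} (hd : ∀ x, HasDerivAt h (h' x) x) (hc : Continuous h')
    (hp : h (2 * π) = h 0) (n : ℤ) : fc h' n = Complex.I * n * fc h n := by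
  have ch : Continuous h := continuous_iff_continuousAt.2 fun x => (hd x).continuousAt
  have ce := continuous_expI (-n)
  have := integral_deriv_eq_zero_of_periodic (T := 2 * π)
    (fun x => (hasDerivAt_expI (-n) x).mul (hd x)) (by fun_prop) (by
      simp only [Pi.mul_apply]
      rw [hp, ← zero_add (2 * π), expI_periodic])
  rw [intervalIntegral.integral_add (Continuous.intervalIntegrable (by fun_prop) _ _)
    (Continuous.intervalIntegrable (by fun_prop) _ _)] at this
  have h2 : ∫ x in (0:ℝ)..(2 * π), expI (-n) x * h' x
      = Complex.I * n * ∫ x in (0:ℝ)..(2 * π), expI (-n) x * h x := by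
    rw [eq_neg_of_add_eq_zero_right this, ← intervalIntegral.integral_const_mul,
      ← intervalIntegral.integral_neg]
    congr 1
    ext x
    push_cast
    ring
  rw [fc, h2, fc]
  ring

theorem parseval (hh : Continuous h) :
    HasSum (fun n => ‖fc h n‖ ^ 2) ((2 * π)⁻¹ * ∫ x in (0:ℝ)..(2 * π), ‖h x‖ ^ 2) := by
  have hL : MemLp h 2 (volume.restrict (Ioc 0 (2 * π))) := by
    have h1 : MemLp h 2 (volume.restrict (Icc 0 (2 * π))) := by
      obtain ⟨C, hC⟩ := (isCompact_Icc (a := (0:ℝ)) (b := 2 * π)).exists_bound_of_continuousOn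
        hh.continuousOn
      exact MemLp.of_bound hh.aestronglyMeasurable C
        ((ae_restrict_iff' measurableSet_Icc).2 (Eventually.of_forall hC))
    exact h1.mono_measure (Measure.restrict_mono Ioc_subset_Icc_self le_rfl)
  have := hasSum_sq_fourierCoeffOn two_pi_pos hL
  simpa only [← fc_eq_fourierCoeffOn, sub_zero, smul_eq_mul] using this

theorem norm_fc_mul_le (hh : Continuous h) (hg : Continuous g) (n : ℤ) :
    ‖fc (fun x => h x * g x) n‖ ^ 2 ≤ ((2 * π)⁻¹ * ∫ x in (0:ℝ)..(2 * π), ‖h x‖ ^ 2) *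
      ((2 * π)⁻¹ * ∫ x in (0:ℝ)..(2 * π), ‖g x‖ ^ 2) := by
  have h2 : ‖(2 * π : ℂ)‖ = 2 * π := by
    rw [← Complex.ofReal_ofNat, ← Complex.ofReal_mul, Complex.norm_real, Real.norm_eq_abs,
      abs_of_pos two_pi_pos]
  have h1 : ‖∫ x in (0:ℝ)..(2 * π), expI (-n) x * (h x * g x)‖
      ≤ ∫ x in (0:ℝ)..(2 * π), ‖h x‖ * ‖g x‖ := by
    refine (intervalIntegral.norm_integral_le_integral_norm two_pi_pos.le).trans_eq ?_
    simp only [norm_mul, norm_expI, one_mul]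
  have h3 := sq_integral_mul_le hh.norm hg.norm two_pi_pos.le
  rw [fc, norm_mul, norm_inv, h2, mul_pow]
  calc _ ≤ (2 * π)⁻¹ ^ 2 * (∫ x in (0:ℝ)..(2 * π), ‖h x‖ * ‖g x‖) ^ 2 := by gcongr
    _ ≤ (2 * π)⁻¹ ^ 2 * ((∫ x in (0:ℝ)..(2 * π), ‖h x‖ ^ 2) *
      ∫ x in (0:ℝ)..(2 * π), ‖g x‖ ^ 2) := by gcongr
    _ = _ := by ring

theorem summable_inv_sq_int : Summable fun n : ℤ => (((n : ℝ)) ^ 2)⁻¹ := by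
  simpa using Real.summable_one_div_int_pow.2 (by norm_num : 1 < 2)

theorem hasSum_fc {h' h'' : ℝ → ℂ} (hd : ∀ x, HasDerivAt h (h' x) x)
    (hd' : ∀ x, HasDerivAt h' (h'' x) x) (hc : Continuous h'')
    (hp : ∀ x, h (x + 2 * π) = h x) (hp' : h' (2 * π) = h' 0) :
    Summable (fun n => ‖fc h n‖) ∧ ∀ x, HasSum (fun n => fc h n * expI n x) (h x) := by
  have ch : Continuous h := continuous_iff_continuousAt.2 fun x => (hd x).continuousAt
  have ch' : Continuous h' := continuous_iff_continuousAt.2 fun x => (hd' x).continuousAt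
  have hp0 : h (2 * π) = h 0 := by simpa using hp 0
  have hs : Summable (fun n => ‖fc h n‖) := by
    have hb : Summable fun n : ℤ => ‖fc h'' n‖ ^ 2 := (parseval hc).summable
    obtain ⟨C, hC⟩ := (hb.tendsto_cofinite_zero.bddAbove_range_of_cofinite)
    have hsum := summable_inv_sq_int.mul_left (1 + C)
    have h0 : Summable (fun n : ℤ => (1 + C) * ((n : ℝ) ^ 2)⁻¹ + if n = 0 then ‖fc h 0‖ else 0) :=
      hsum.add (summable_of_ne_finset_zero (s := {0}) (by intro b hb; simp at hb; simp [hb]))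
    refine Summable.of_nonneg_of_le (fun n => norm_nonneg _) (fun n => ?_) h0
    by_cases hn : n = 0
    · simp [hn]
    rw [if_neg hn, add_zero]
    have e : fc h'' n = Complex.I * n * (Complex.I * n * fc h n) := by
      rw [fc_deriv hd' hc hp', fc_deriv hd ch' hp0]
    have e2 : ‖fc h'' n‖ = (n : ℝ) ^ 2 * ‖fc h n‖ := by
      rw [e]
      simp only [norm_mul, Complex.norm_I, one_mul, Complex.norm_intCast]
      rw [← mul_assoc, abs_mul_abs_self, sq]
    have hnn : (0:ℝ) < (n : ℝ) ^ 2 := by positivity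
    have e3 : ‖fc h'' n‖ ≤ 1 + C := by
      have := hC ⟨n, rfl⟩
      simp only at this
      nlinarith [sq_nonneg (‖fc h'' n‖ - 1), norm_nonneg (fc h'' n)]
    rw [e2] at e3
    rw [← div_eq_mul_inv, le_div_iff₀ hnn]
    linarith
  refine ⟨hs, fun x => ?_⟩
  have hT : Fact (0 < 2 * π - 0) := ⟨by rw [sub_zero]; exact two_pi_pos⟩
  have hper : Function.Periodic h (2 * π - 0) := by intro y; rw [sub_zero]; exact hp y
  have hcl : Continuous hper.lift := ch.quotient_lift _
  let F : C(AddCircle (2 * π - 0), ℂ) := ⟨hper.lift, hcl⟩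
  have hF : ∀ n, fourierCoeff F n = fc h n := by
    intro n
    rw [fourierCoeff_eq_intervalIntegral _ _ 0, fc]
    simp only [zero_add, sub_zero, Complex.real_smul, smul_eq_mul]
    congr 1
    · push_cast; simp
    · congr 1
      ext y
      rw [expI_eq_fourier, ← Function.Periodic.lift_coe hper y]
      rfl
  have := has_pointwise_sum_fourier_series_of_summable (f := F)
    (by simp only [funext hF]; exact hs.of_norm) (x : AddCircle (2 * π - 0))
  simp only [hF, smul_eq_mul, ← expI_eq_fourier] at this
  rwa [show F (x : AddCircle (2 * π - 0)) = h x from Function.Periodic.lift_coe hper x] at this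

/-- A smooth positive periodic function `v` whose metric `v⁻⁴ dθ²` has length `2π`. -/
structure Profile (v : ℝ → ℝ) : Prop where
  smooth : ContDiff ℝ ∞ v
  per : ∀ θ, v (θ + 2 * π) = v θ
  pos : ∀ θ, 0 < v θ
  norm : ∫ θ in (0:ℝ)..(2 * π), ((v θ) ^ 2)⁻¹ = 2 * π

/-- The arc length measured from `θ = 0`. -/
noncomputable def arcLen (v : ℝ → ℝ) (θ : ℝ) : ℝ := ∫ τ in (0:ℝ)..θ, ((v τ) ^ 2)⁻¹

theorem contDiff_of_hasDerivAt_eq {Θ : ℝ → ℝ} {F : ℝ → ℝ} (hF : ContDiff ℝ ∞ F)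
    (h : ∀ s, HasDerivAt Θ (F (Θ s)) s) : ContDiff ℝ ∞ Θ := by
  rw [contDiff_infty]
  intro n
  induction n with
  | zero => exact contDiff_zero.2 (continuous_iff_continuousAt.2 fun s => (h s).continuousAt)
  | succ n ih =>
    have : deriv Θ = fun s => F (Θ s) := funext fun s => (h s).deriv
    push_cast
    rw [contDiff_succ_iff_deriv]
    refine ⟨fun s => (h s).differentiableAt, by simp, ?_⟩
    rw [this]
    exact (hF.of_le (by exact_mod_cast le_top)).comp ih

namespace Profile

variable {v : ℝ → ℝ}

theorem ne (hv : Profile v) (θ : ℝ) : v θ ≠ 0 := (hv.pos θ).ne'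

theorem continuous_inv_sq (hv : Profile v) : Continuous fun θ => ((v θ) ^ 2)⁻¹ :=
  (hv.smooth.continuous.pow 2).inv₀ fun θ => pow_ne_zero 2 (hv.ne θ)

theorem hasDerivAt_arcLen (hv : Profile v) (θ : ℝ) :
    HasDerivAt (arcLen v) (((v θ) ^ 2)⁻¹) θ :=
  intervalIntegral.integral_hasDerivAt_right (hv.continuous_inv_sq.intervalIntegrable _ _)
    (hv.continuous_inv_sq.stronglyMeasurableAtFilter _ _) hv.continuous_inv_sq.continuousAt

theorem arcLen_two_pi (hv : Profile v) : arcLen v (2 * π) = 2 * π := hv.norm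

theorem arcLen_zero (v : ℝ → ℝ) : arcLen v 0 = 0 := by simp [arcLen]

theorem arcLen_add (hv : Profile v) (θ : ℝ) : arcLen v (θ + 2 * π) = arcLen v θ + 2 * π := by
  have hp : Function.Periodic (fun θ => ((v θ) ^ 2)⁻¹) (2 * π) := fun θ => by simp only [hv.per]
  have h1 := hp.intervalIntegral_add_eq θ 0
  rw [zero_add, hv.norm] at h1
  rw [arcLen, arcLen, ← intervalIntegral.integral_add_adjacent_intervals (b := θ)
    (hv.continuous_inv_sq.intervalIntegrable _ _) (hv.continuous_inv_sq.intervalIntegrable _ _), h1]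

theorem strictMono_arcLen (hv : Profile v) : StrictMono (arcLen v) :=
  strictMono_of_deriv_pos fun θ => by
    rw [(hv.hasDerivAt_arcLen θ).deriv]
    exact inv_pos.2 (pow_pos (hv.pos θ) 2)

theorem continuous_arcLen (hv : Profile v) : Continuous (arcLen v) :=
  continuous_iff_continuousAt.2 fun θ => (hv.hasDerivAt_arcLen θ).continuousAt

theorem arcLen_int_mul (hv : Profile v) (n : ℕ) :
    arcLen v (n * (2 * π)) = n * (2 * π) ∧ arcLen v (-(n * (2 * π))) = -(n * (2 * π)) := by
  induction n with
  | zero => simp [arcLen_zero]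
  | succ n ih =>
    constructor
    · rw [show ((n + 1 : ℕ) : ℝ) * (2 * π) = n * (2 * π) + 2 * π by push_cast; ring,
        hv.arcLen_add, ih.1]
    · have := hv.arcLen_add (-((n + 1 : ℕ) * (2 * π)))
      rw [show -(((n + 1 : ℕ) : ℝ) * (2 * π)) + 2 * π = -(n * (2 * π)) by push_cast; ring,
        ih.2] at this
      push_cast at this ⊢
      linarith

theorem surjective_arcLen (hv : Profile v) : Function.Surjective (arcLen v) := by
  refine hv.continuous_arcLen.surjective ?_ ?_
  · refine hv.strictMono_arcLen.monotone.tendsto_atTop_atTop fun b => ?_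
    obtain ⟨n, hn⟩ := exists_nat_ge (b / (2 * π))
    refine ⟨n * (2 * π), ?_⟩
    rw [(hv.arcLen_int_mul n).1]
    exact (div_le_iff₀ two_pi_pos).1 hn
  · refine hv.strictMono_arcLen.monotone.tendsto_atBot_atBot fun b => ?_
    obtain ⟨n, hn⟩ := exists_nat_ge (-b / (2 * π))
    refine ⟨-(n * (2 * π)), ?_⟩
    rw [(hv.arcLen_int_mul n).2]
    have := (div_le_iff₀ two_pi_pos).1 hn
    linarith

theorem exists_param (hv : Profile v) : ∃ Θ : ℝ → ℝ, ContDiff ℝ ∞ Θ ∧ (∀ θ, Θ (arcLen v θ) = θ) ∧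
    (∀ s, arcLen v (Θ s) = s) ∧ (∀ s, HasDerivAt Θ (v (Θ s) ^ 2) s) ∧
    (∀ s, Θ (s + 2 * π) = Θ s + 2 * π) := by
  let e := hv.strictMono_arcLen.orderIsoOfSurjective _ hv.surjective_arcLen
  have hl : ∀ θ, e.symm (arcLen v θ) = θ := fun θ => e.symm_apply_apply θ
  have hr : ∀ s, arcLen v (e.symm s) = s := fun s => e.apply_symm_apply s
  have hd : ∀ s, HasDerivAt e.symm (v (e.symm s) ^ 2) s := by
    intro s
    have := HasDerivAt.of_local_left_inverse (f := arcLen v) (g := e.symm) (a := s)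
      e.symm.continuous.continuousAt (hv.hasDerivAt_arcLen _)
      (inv_ne_zero (pow_ne_zero 2 (hv.ne _))) (Eventually.of_forall hr)
    rwa [inv_inv] at this
  refine ⟨e.symm, contDiff_of_hasDerivAt_eq (F := fun x => v x ^ 2) (hv.smooth.pow 2) hd,
    hl, hr, hd, fun s => ?_⟩
  refine hv.strictMono_arcLen.injective ?_
  rw [hr, hv.arcLen_add, hr]

theorem integral_comp_param (hv : Profile v) {Θ : ℝ → ℝ} (hc : Continuous Θ)
    (hl : ∀ θ, Θ (arcLen v θ) = θ) {h : ℝ → ℝ} (hh : Continuous h) :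
    ∫ s in (0:ℝ)..(2 * π), h (Θ s) = ∫ θ in (0:ℝ)..(2 * π), h θ * ((v θ) ^ 2)⁻¹ := by
  have := intervalIntegral.integral_comp_mul_deriv (a := 0) (b := 2 * π) (f := arcLen v)
    (g := fun s => h (Θ s)) (fun θ _ => hv.hasDerivAt_arcLen θ)
    hv.continuous_inv_sq.continuousOn (hh.comp hc)
  rw [arcLen_zero, hv.arcLen_two_pi] at this
  rw [← this]
  simp only [Function.comp, hl]

/-- The total curvature of a metric of length `2π` is at most that of the round one. -/
theorem integral_sq_sub_le (hv : Profile v) :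
    ∫ θ in (0:ℝ)..(2 * π), (v θ ^ 2 - 4 * deriv v θ ^ 2) ≤ 2 * π := by
  have dv : ∀ θ, HasDerivAt v (deriv v θ) θ := fun θ =>
    (hv.smooth.differentiable (by simp) θ).hasDerivAt
  have cv' : Continuous (deriv v) := hv.smooth.continuous_deriv (by simp)
  have cv := hv.smooth.continuous
  have cs := hv.continuous_arcLen
  have ci := hv.continuous_inv_sq
  set E : ℝ → ℂ := fun θ => Complex.exp ((((arcLen v θ - θ) / 2 : ℝ) : ℂ) * Complex.I) with hE
  have cE : Continuous E := by fun_prop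
  have nE : ∀ θ, ‖E θ‖ = 1 := fun θ => Complex.norm_exp_ofReal_mul_I _
  have dE : ∀ θ, HasDerivAt E (E θ * (((((v θ) ^ 2)⁻¹ - 1) / 2 : ℝ) * Complex.I)) θ := fun θ =>
    (((((hv.hasDerivAt_arcLen θ).sub (hasDerivAt_id θ)).div_const 2).ofReal_comp).mul_const _).cexp
  set χ : ℝ → ℂ := fun θ => (v θ : ℂ) * E θ with hχ
  set χ' : ℝ → ℂ := fun θ => ((deriv v θ : ℝ) : ℂ) * E θ +
    (v θ : ℂ) * (E θ * (((((v θ) ^ 2)⁻¹ - 1) / 2 : ℝ) * Complex.I)) with hχ'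
  have dχ : ∀ θ, HasDerivAt χ (χ' θ) θ := fun θ => (dv θ).ofReal_comp.mul (dE θ)
  have cχ' : Continuous χ' := by fun_prop
  have cχ : Continuous χ := by fun_prop
  have pχ : χ (2 * π) = χ 0 := by
    have := hv.per 0
    rw [zero_add] at this
    simp [hχ, hE, this, hv.arcLen_two_pi, arcLen_zero]
  set ψ : ℝ → ℂ := fun θ => χ' θ + (Complex.I / 2) * χ θ with hψ
  have cψ : Continuous ψ := by fun_prop
  have hcoef : ∀ n, fc ψ n = (Complex.I * (n + 1 / 2)) * fc χ n := by
    intro n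
    rw [hψ, fc_add cχ' (by fun_prop), fc_const_mul, fc_deriv dχ cχ' pχ]
    ring
  have nψ : ∀ θ, ‖ψ θ‖ ^ 2 = deriv v θ ^ 2 + (1 / 4) * ((v θ) ^ 2)⁻¹ := by
    intro θ
    have : ψ θ = E θ * (((deriv v θ : ℝ) : ℂ) + (((v θ)⁻¹ / 2 : ℝ) : ℂ) * Complex.I) := by
      have hne : (v θ : ℂ) ≠ 0 := Complex.ofReal_ne_zero.2 (hv.ne θ)
      simp only [hψ, hχ', hχ]
      push_cast
      field_simp
      ring
    rw [this, norm_mul, nE, one_mul, Complex.sq_norm, Complex.normSq_add_mul_I]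
    ring
  have nχ : ∀ θ, ‖χ θ‖ ^ 2 = v θ ^ 2 := by
    intro θ
    rw [hχ, norm_mul, nE, mul_one, Complex.norm_real, Real.norm_eq_abs, sq_abs]
  have hle : ∀ n : ℤ, (1 / 4) * ‖fc χ n‖ ^ 2 ≤ ‖fc ψ n‖ ^ 2 := by
    intro n
    rw [hcoef, norm_mul, norm_mul, Complex.norm_I, one_mul, mul_pow]
    refine mul_le_mul_of_nonneg_right ?_ (sq_nonneg _)
    have : ‖(n : ℂ) + 1 / 2‖ = |(n : ℝ) + 1 / 2| := by
      rw [← Real.norm_eq_abs, ← Complex.norm_real]; push_cast; rfl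
    rw [this, sq_abs]
    have h1 : (0 : ℝ) ≤ (n : ℝ) * (n + 1) := by
      have : (0 : ℤ) ≤ n * (n + 1) := by
        rcases le_or_gt 0 n with h | h
        · positivity
        · exact mul_nonneg_of_nonpos_of_nonpos h.le (by omega)
      exact_mod_cast this
    nlinarith
  have key := hasSum_le hle ((parseval cχ).mul_left (1 / 4)) (parseval cψ)
  simp only [nψ, nχ] at key
  rw [intervalIntegral.integral_add (Continuous.intervalIntegrable (by fun_prop) _ _)
    (Continuous.intervalIntegrable (by fun_prop) _ _), intervalIntegral.integral_const_mul,
    hv.norm] at key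
  rw [intervalIntegral.integral_sub (Continuous.intervalIntegrable (by fun_prop) _ _)
    (Continuous.intervalIntegrable (by fun_prop) _ _), intervalIntegral.integral_const_mul]
  have hpi := two_pi_pos
  rw [mul_left_comm, mul_le_mul_iff_right₀ (inv_pos.2 hpi)] at key
  linarith

end Profile

/-- The sum `∑_{n ≠ 0} n⁻²` over the integers. -/
noncomputable def invSqSum : ℝ := ∑' n : ℤ, (((n : ℝ)) ^ 2)⁻¹

theorem invSqSum_nonneg : 0 ≤ invSqSum := tsum_nonneg fun n => by positivity

/-- The mean square of a function over a period. -/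
noncomputable def msq (h : ℝ → ℂ) : ℝ := (2 * π)⁻¹ * ∫ x in (0:ℝ)..(2 * π), ‖h x‖ ^ 2

theorem msq_nonneg (h : ℝ → ℂ) : 0 ≤ msq h :=
  mul_nonneg (inv_pos.2 two_pi_pos).le
    (intervalIntegral.integral_nonneg two_pi_pos.le fun _ _ => sq_nonneg _)

theorem msq_le_of_fc_zero {h h' : ℝ → ℂ} (hd : ∀ x, HasDerivAt h (h' x) x) (hc : Continuous h')
    (hp : h (2 * π) = h 0) (h0 : fc h 0 = 0) : msq h ≤ msq h' := by
  have ch : Continuous h := continuous_iff_continuousAt.2 fun x => (hd x).continuousAt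
  refine hasSum_le (fun n => ?_) (parseval ch) (parseval hc)
  rw [fc_deriv hd hc hp, norm_mul, norm_mul, Complex.norm_I, one_mul, mul_pow,
    Complex.norm_intCast, sq_abs]
  by_cases hn : n = 0
  · simp [hn, h0]
  · have : (1:ℝ) ≤ (n:ℝ) ^ 2 := by
      have h1 : (0:ℤ) < n ^ 2 := by positivity
      exact_mod_cast h1
    nlinarith [sq_nonneg ‖fc h n‖]

/-- Quantitative Kazdan–Warner: a potential `κ + m` all of whose solutions are periodic has an
almost vanishing first mode, hence a spectral gap larger than the first eigenvalue. -/
theorem three_mul_msq_le {m m' : ℝ → ℝ} (hm : ∀ x, HasDerivAt m (m' x) x) (hm' : Continuous m')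
    (hmp : m (2 * π) = m 0) (hm0 : fc (fun x => (m x : ℂ)) 0 = 0) {κ : ℝ} (hκ : κ ≤ 1)
    {f f₁ f₂ f₃ : ℝ → ℂ} (h1 : ∀ x, HasDerivAt f (f₁ x) x) (h2 : ∀ x, HasDerivAt f₁ (f₂ x) x)
    (h3 : ∀ x, HasDerivAt f₂ (f₃ x) x) (hc3 : Continuous f₃)
    (hp : f (2 * π) = f 0) (hp1 : f₁ (2 * π) = f₁ 0) (hp2 : f₂ (2 * π) = f₂ 0)
    (hode : ∀ x, f₃ x + κ * f₁ x + m x * f₁ x + (1 / 2) * (m' x * f x) = 0)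
    (hf0 : fc f 0 = 0) (hf1 : fc f (-1) = 0) (hne : ∃ x ∈ Icc 0 (2 * π), f x ≠ 0)
    (hsmall : 48 * (1 + invSqSum) * msq (fun x => (m x : ℂ)) ≤ 1) :
    3 * msq (fun x => (m x : ℂ)) ≤ msq (fun x => (m' x : ℂ)) := by
  set K := invSqSum with hK
  have hK0 : 0 ≤ K := invSqSum_nonneg
  set μ : ℝ → ℂ := fun x => (m x : ℂ) with hμ
  set μ' : ℝ → ℂ := fun x => (m' x : ℂ) with hμ'
  have dμ : ∀ x, HasDerivAt μ (μ' x) x := fun x => (hm x).ofReal_comp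
  have cμ' : Continuous μ' := by fun_prop
  have cμ : Continuous μ := continuous_iff_continuousAt.2 fun x => (dμ x).continuousAt
  have cf : Continuous f := continuous_iff_continuousAt.2 fun x => (h1 x).continuousAt
  have cf1 : Continuous f₁ := continuous_iff_continuousAt.2 fun x => (h2 x).continuousAt
  have cf2 : Continuous f₂ := continuous_iff_continuousAt.2 fun x => (h3 x).continuousAt
  have pμ : μ (2 * π) = μ 0 := by simp only [hμ, hmp]
  -- Fourier form of the equation
  have hcoef : ∀ n : ℤ, Complex.I * n * ((κ : ℂ) - n ^ 2) * fc f n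
      + (1 / 2) * fc (fun x => μ x * f₁ x) n
      + (1 / 2) * (Complex.I * n * fc (fun x => μ x * f x) n) = 0 := by
    intro n
    have e1 : fc f₁ n = Complex.I * n * fc f n := fc_deriv h1 cf1 hp n
    have e2 : fc f₂ n = Complex.I * n * fc f₁ n := fc_deriv h2 cf2 hp1 n
    have e3 : fc f₃ n = Complex.I * n * fc f₂ n := fc_deriv h3 hc3 hp2 n
    have e4 := fc_deriv (fun x => (dμ x).mul (h1 x)) (by fun_prop) (by
      simp only [Pi.mul_apply, hp, pμ]) n
    rw [fc_add (by fun_prop) (by fun_prop)] at e4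
    have e5 : fc (fun x => f₃ x + κ * f₁ x + μ x * f₁ x + (1 / 2) * (μ' x * f x)) n = 0 := by
      have : (fun x => f₃ x + κ * f₁ x + μ x * f₁ x + (1 / 2) * (μ' x * f x)) = fun _ => 0 :=
        funext hode
      rw [this, fc]
      simp
    rw [fc_add (by fun_prop) (by fun_prop), fc_add (by fun_prop) (by fun_prop),
      fc_add (by fun_prop) (by fun_prop), fc_const_mul, fc_const_mul, e3, e2, e1] at e5
    have e6 : fc (μ * f) n = fc (fun x => μ x * f x) n := rfl
    rw [e6] at e4
    have hI : Complex.I ^ 2 = -1 := Complex.I_sq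
    linear_combination e5 - (1 / 2) * e4 - (n ^ 3 * Complex.I * fc f n) * hI
  have hmm := msq_nonneg μ
  have hff := msq_nonneg f₁
  have hff0 : msq f ≤ msq f₁ := msq_le_of_fc_zero h1 cf1 hp hf0
  have b1 : ∀ n, ‖fc (fun x => μ x * f₁ x) n‖ ≤ √(msq μ * msq f₁) := fun n =>
    Real.le_sqrt_of_sq_le (norm_fc_mul_le cμ cf1 n)
  have b2 : ∀ n, ‖fc (fun x => μ x * f x) n‖ ≤ √(msq μ * msq f₁) := fun n =>
    Real.le_sqrt_of_sq_le ((norm_fc_mul_le cμ cf n).trans (mul_le_mul_of_nonneg_left hff0 hmm))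
  set B := √(msq μ * msq f₁) with hB
  have hB2 : B ^ 2 = msq μ * msq f₁ := Real.sq_sqrt (mul_nonneg hmm hff)
  have hB0 : 0 ≤ B := Real.sqrt_nonneg _
  -- decay of the higher modes
  have hdec : ∀ n : ℤ, n ≠ 1 → ‖fc f₁ n‖ ^ 2 ≤ (16 / 9 * B ^ 2) * ((n : ℝ) ^ 2)⁻¹ := by
    intro n hn1
    rw [fc_deriv h1 cf1 hp]
    by_cases hn0 : n = 0
    · simp [hn0]
    by_cases hnm : n = -1
    · rw [hnm, hf1]; simp; positivity
    have hn2 : (4:ℝ) ≤ (n:ℝ) ^ 2 := by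
      have : (4:ℤ) ≤ n ^ 2 := by
        rcases lt_or_gt_of_ne hn0 with h | h
        · have : n ≤ -2 := by omega
          nlinarith
        · have : 2 ≤ n := by omega
          nlinarith
      exact_mod_cast this
    have hn2' : (2:ℝ) ≤ |(n:ℝ)| := by
      rw [← abs_of_pos (two_pos : (0:ℝ) < 2)]
      exact sq_le_sq.1 (by linarith)
    have hc := hcoef n
    have e : Complex.I * n * ((κ : ℂ) - n ^ 2) * fc f n
      = -((1 / 2) * fc (fun x => μ x * f₁ x) n
      + (1 / 2) * (Complex.I * n * fc (fun x => μ x * f x) n)) := by linear_combination hc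
    have e2 : ‖Complex.I * n * ((κ : ℂ) - n ^ 2) * fc f n‖ ≤ (1 / 2) * B + (1 / 2) * (|(n:ℝ)| * B) := by
      rw [e, norm_neg]
      refine (norm_add_le _ _).trans ?_
      simp only [norm_mul, Complex.norm_I, one_mul, Complex.norm_intCast]
      have := b1 n
      have := b2 n
      norm_num
      gcongr
    have e3 : ‖(κ : ℂ) - n ^ 2‖ = (n:ℝ) ^ 2 - κ := by
      have : (κ : ℂ) - n ^ 2 = ((κ - (n:ℝ) ^ 2 : ℝ) : ℂ) := by push_cast; rfl
      rw [this, Complex.norm_real, Real.norm_eq_abs, abs_of_nonpos (by linarith)]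
      ring
    simp only [norm_mul, Complex.norm_I, one_mul, Complex.norm_intCast, e3] at e2 ⊢
    have hF := norm_nonneg (fc f n)
    set F := ‖fc f n‖
    set N := |(n:ℝ)|
    have hNN : (n:ℝ) ^ 2 = N ^ 2 := (sq_abs _).symm
    rw [hNN] at e2 hn2 ⊢
    have e4 : N * F * (3 / 4 * N ^ 2) ≤ N * B := by
      calc N * F * (3 / 4 * N ^ 2) ≤ N * F * (N ^ 2 - κ) := by
            refine mul_le_mul_of_nonneg_left ?_ (by positivity)
            linarith
        _ ≤ 1 / 2 * B + 1 / 2 * (N * B) := by linarith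
        _ ≤ N * B := by nlinarith
    have hN0 : 0 < N := by linarith
    have e5 : N * F ≤ 4 / 3 * B * N⁻¹ := by
      rw [← div_eq_mul_inv, le_div_iff₀ hN0]
      have : N * (3 / 4 * N * F * N) ≤ N * B := by linarith
      have := le_of_mul_le_mul_left this hN0
      linarith
    calc (N * F) ^ 2 ≤ (4 / 3 * B * N⁻¹) ^ 2 := by gcongr
      _ = _ := by rw [mul_pow, inv_pow]; ring
  -- splitting off the first mode
  set r : ℝ → ℂ := fun x => f₁ x - fc f₁ 1 * expI 1 x with hr
  have cexp := continuous_expI 1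
  have cr : Continuous r := by fun_prop
  have hfe : ∀ n, fc (expI 1) n = if n = 1 then 1 else 0 := by
    intro n
    rw [fc]
    have : ∀ x, expI (-n) x * expI 1 x = expI (1 - n) x := fun x => by
      rw [← expI_add]; ring_nf
    simp only [this]
    split_ifs with hn
    · have hpi : (π : ℂ) ≠ 0 := Complex.ofReal_ne_zero.2 pi_ne_zero
      rw [hn]
      simp [expI_zero]
      field_simp
    · have h4 : ((1 - n : ℤ) : ℂ) ≠ 0 := by
        exact_mod_cast sub_ne_zero.2 (Ne.symm hn)
      have h5 := integral_deriv_eq_zero_of_periodic (T := 2 * π)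
        (fun x => hasDerivAt_expI (1 - n) x) (by have := continuous_expI (1 - n); fun_prop)
        (by rw [← zero_add (2 * π), expI_periodic])
      rw [intervalIntegral.integral_const_mul] at h5
      have h6 := (mul_eq_zero.1 h5).resolve_left (mul_ne_zero Complex.I_ne_zero h4)
      rw [h6, mul_zero]
  have hrn : ∀ n, fc r n = if n = 1 then 0 else fc f₁ n := by
    intro n
    rw [hr, fc_sub cf1 (by fun_prop), fc_const_mul, hfe]
    split_ifs with hn
    · rw [hn]; ring
    · ring
  have hrB : msq r ≤ 16 / 9 * B ^ 2 * K := by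
    refine hasSum_le (fun n => ?_) (parseval cr) (summable_inv_sq_int.hasSum.mul_left _)
    rw [hrn]
    split_ifs with hn
    · simp; positivity
    · exact hdec n hn
  have hsplit : msq f₁ = msq r + ‖fc f₁ 1‖ ^ 2 := by
    have hs1 : HasSum (fun n : ℤ => if n = 1 then ‖fc f₁ 1‖ ^ 2 else 0) (‖fc f₁ 1‖ ^ 2) :=
      hasSum_ite_eq 1 _
    have he : (fun n => ‖fc f₁ n‖ ^ 2)
        = fun n => ‖fc r n‖ ^ 2 + if n = 1 then ‖fc f₁ 1‖ ^ 2 else 0 := by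
      funext n
      rw [hrn]
      split_ifs with hn
      · rw [hn]; simp
      · simp
    have h9 := parseval cf1
    rw [he] at h9
    exact h9.unique ((parseval cr).add hs1)
  have hpos : 0 < msq f₁ := by
    refine lt_of_lt_of_le ?_ hff0
    obtain ⟨x, hx, hfx⟩ := hne
    refine mul_pos (inv_pos.2 two_pi_pos) ?_
    exact intervalIntegral.integral_pos two_pi_pos (Continuous.continuousOn (by fun_prop))
      (fun x _ => sq_nonneg _)
      ⟨x, hx, by positivity⟩
  -- the first mode of `m`
  have hz : fc (fun x => μ x * f₁ x) 0 = 0 := by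
    have := hcoef 0
    simpa using this
  have hmode : fc f₁ 1 * fc μ (-1) = - fc (fun x => μ x * r x) 0 := by
    have e1 : fc (fun x => μ x * r x) 0 =
        fc (fun x => μ x * f₁ x) 0 - fc (fun x => fc f₁ 1 * (μ x * expI 1 x)) 0 := by
      rw [← fc_sub (by fun_prop) (by fun_prop)]
      congr 1
      funext x
      simp only [hr]
      ring
    have e2 : fc (fun x => μ x * expI 1 x) 0 = fc μ (-1) := by
      rw [fc, fc]
      simp only [neg_zero, expI_zero, one_mul, neg_neg, mul_comm]
    rw [e1, hz, fc_const_mul, e2]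
    ring
  set M := msq μ with hM
  have hKM : 0 ≤ K * M := mul_nonneg hK0 hmm
  have hr2 : msq r ≤ 16 / 9 * (K * M) * msq f₁ := by
    rw [hB2] at hrB
    calc _ ≤ _ := hrB
      _ = _ := by ring
  have hKM1 : 48 * M + 48 * (K * M) ≤ 1 := by linarith
  have hf1lo : (1 / 2) * msq f₁ ≤ ‖fc f₁ 1‖ ^ 2 := by nlinarith
  have hmodeB : ‖fc f₁ 1‖ ^ 2 * ‖fc μ (-1)‖ ^ 2 ≤ M * msq r := by
    rw [← mul_pow, ← norm_mul, hmode, norm_neg]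
    exact norm_fc_mul_le cμ cr 0
  have hμ1 : ‖fc μ (-1)‖ ^ 2 ≤ 4 * (K * M) * M := by
    have h5 : (1 / 2) * msq f₁ * ‖fc μ (-1)‖ ^ 2 ≤ M * (16 / 9 * (K * M) * msq f₁) :=
      ((mul_le_mul_of_nonneg_right hf1lo (sq_nonneg _)).trans hmodeB).trans
        (mul_le_mul_of_nonneg_left hr2 hmm)
    have h6 : msq f₁ * (‖fc μ (-1)‖ ^ 2) ≤ msq f₁ * (4 * (K * M) * M) := by
      have : 0 ≤ msq f₁ * ((K * M) * M) := by positivity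
      nlinarith
    exact le_of_mul_le_mul_left h6 hpos
  have hμsym : ‖fc μ 1‖ = ‖fc μ (-1)‖ := by
    have h7 := fc_conj μ (-1)
    have h8 : (fun x => (starRingEnd ℂ) (μ x)) = μ := by
      funext x; exact Complex.conj_ofReal _
    rw [h8, neg_neg] at h7
    rw [h7, Complex.norm_conj]
  have hfin : HasSum (fun n : ℤ => if n ∈ ({1, -1} : Finset ℤ) then 3 * ‖fc μ n‖ ^ 2 else 0)
      (6 * ‖fc μ (-1)‖ ^ 2) := by
    have hs : ∑ n ∈ ({1, -1} : Finset ℤ),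
        (if n ∈ ({1, -1} : Finset ℤ) then 3 * ‖fc μ n‖ ^ 2 else 0) = 6 * ‖fc μ (-1)‖ ^ 2 := by
      rw [Finset.sum_pair (by norm_num), if_pos (by simp), if_pos (by simp), hμsym]
      ring
    rw [← hs]
    exact hasSum_sum_of_ne_finset_zero fun b hb => if_neg hb
  have hgap : 4 * M ≤ msq μ' + 6 * ‖fc μ (-1)‖ ^ 2 := by
    refine hasSum_le (fun n => ?_) ((parseval cμ).mul_left 4) ((parseval cμ').add hfin)
    rw [fc_deriv dμ cμ' pμ, norm_mul, norm_mul, Complex.norm_I, one_mul, mul_pow,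
      Complex.norm_intCast, sq_abs]
    by_cases h0 : n = 0
    · simp [h0, hm0]
    split_ifs with hn
    · have : (1:ℝ) ≤ (n:ℝ) ^ 2 := by
        have h1 : (0:ℤ) < n ^ 2 := by positivity
        exact_mod_cast h1
      nlinarith [sq_nonneg ‖fc μ n‖]
    · simp only [Finset.mem_insert, Finset.mem_singleton, not_or] at hn
      have hn2 : (4:ℝ) ≤ (n:ℝ) ^ 2 := by
        have : (4:ℤ) ≤ n ^ 2 := by
          rcases lt_or_gt_of_ne h0 with h | h
          · have : n ≤ -2 := by omega
            nlinarith
          · have : 2 ≤ n := by omega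
            nlinarith
        exact_mod_cast this
      nlinarith [sq_nonneg ‖fc μ n‖]
  nlinarith

/-- The 4-scalar curvature of a single metric. -/
noncomputable def curv (v : ℝ → ℝ) (θ : ℝ) : ℝ := v θ ^ 3 * (4 * deriv (deriv v) θ + v θ)

/-- The average 4-scalar curvature of a metric of length `2π`. -/
noncomputable def avgCurv (v : ℝ → ℝ) : ℝ :=
  (2 * π)⁻¹ * ∫ θ in (0:ℝ)..(2 * π), curv v θ * ((v θ) ^ 2)⁻¹

/-- The squared `L²` norm of the curvature oscillation. -/
noncomputable def oscCurv (v : ℝ → ℝ) : ℝ :=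
  ∫ θ in (0:ℝ)..(2 * π), (curv v θ - avgCurv v) ^ 2 * ((v θ) ^ 2)⁻¹

/-- The Dirichlet energy of the curvature. -/
noncomputable def dirCurv (v : ℝ → ℝ) : ℝ :=
  ∫ θ in (0:ℝ)..(2 * π), deriv (curv v) θ ^ 2 * (v θ) ^ 2

theorem periodic_deriv {v : ℝ → ℝ} {T : ℝ} (h : ∀ θ, v (θ + T) = v θ) (θ : ℝ) :
    deriv v (θ + T) = deriv v θ := by
  rw [← deriv_comp_add_const]
  simp only [h]

namespace Profile

variable {v : ℝ → ℝ}

theorem smooth_deriv (hv : Profile v) : ContDiff ℝ ∞ (deriv v) :=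
  (contDiff_infty_iff_deriv.1 hv.smooth).2

theorem smooth_deriv₂ (hv : Profile v) : ContDiff ℝ ∞ (deriv (deriv v)) :=
  (contDiff_infty_iff_deriv.1 hv.smooth_deriv).2

theorem smooth_curv (hv : Profile v) : ContDiff ℝ ∞ (curv v) :=
  (hv.smooth.pow 3).mul ((contDiff_const.mul hv.smooth_deriv₂).add hv.smooth)

theorem curv_per (hv : Profile v) (θ : ℝ) : curv v (θ + 2 * π) = curv v θ := by
  simp only [curv, hv.per, periodic_deriv (periodic_deriv hv.per)]

theorem hasDerivAt_curv (hv : Profile v) (θ : ℝ) : HasDerivAt (curv v) (deriv (curv v) θ) θ :=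
  (hv.smooth_curv.differentiable (by simp) θ).hasDerivAt

theorem continuous_deriv_curv (hv : Profile v) : Continuous (deriv (curv v)) :=
  hv.smooth_curv.continuous_deriv (by simp)

theorem integral_osc_eq_zero (hv : Profile v) :
    ∫ θ in (0:ℝ)..(2 * π), (curv v θ - avgCurv v) * ((v θ) ^ 2)⁻¹ = 0 := by
  have c1 := hv.smooth_curv.continuous
  have c2 := hv.continuous_inv_sq
  simp only [sub_mul]
  rw [intervalIntegral.integral_sub (Continuous.intervalIntegrable (by fun_prop) _ _)
    (Continuous.intervalIntegrable (by fun_prop) _ _), intervalIntegral.integral_const_mul,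
    hv.norm, avgCurv, mul_comm (2 * π)⁻¹, inv_mul_cancel_right₀ two_pi_pos.ne', sub_self]

theorem dirCurv_nonneg (v : ℝ → ℝ) : 0 ≤ dirCurv v :=
  intervalIntegral.integral_nonneg two_pi_pos.le fun _ _ => by positivity

theorem oscCurv_nonneg (v : ℝ → ℝ) : 0 ≤ oscCurv v :=
  intervalIntegral.integral_nonneg two_pi_pos.le fun _ _ => by positivity

theorem abs_curv_sub_avg_le (hv : Profile v) (θ : ℝ) :
    |curv v θ - avgCurv v| ≤ √(2 * π * dirCurv v) := by
  have c1 := hv.smooth_curv.continuous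
  have c2 := hv.continuous_inv_sq
  have c3 := hv.continuous_deriv_curv
  have c4 := hv.smooth.continuous
  have hper : Function.Periodic (fun θ => |curv v θ - avgCurv v|) (2 * π) := fun θ => by
    simp only [hv.curv_per]
  obtain ⟨x, hx, hxe⟩ := hper.exists_mem_Ico₀ two_pi_pos θ
  rw [hxe]
  have hg : Continuous fun θ => (curv v θ - avgCurv v) * ((v θ) ^ 2)⁻¹ := by fun_prop
  have hG : ∀ x, HasDerivAt (fun x => ∫ θ in (0:ℝ)..x, (curv v θ - avgCurv v) * ((v θ) ^ 2)⁻¹)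
      ((curv v x - avgCurv v) * ((v x) ^ 2)⁻¹) x := fun x =>
    intervalIntegral.integral_hasDerivAt_right (hg.intervalIntegrable _ _)
      (hg.stronglyMeasurableAtFilter _ _) hg.continuousAt
  obtain ⟨c, hc, hc0⟩ := exists_hasDerivAt_eq_zero two_pi_pos
    (continuous_iff_continuousAt.2 fun x => (hG x).continuousAt).continuousOn
    (by rw [hv.integral_osc_eq_zero]; simp) (fun x _ => hG x)
  have hcR : curv v c = avgCurv v := by
    have := (mul_eq_zero.1 hc0).resolve_right (inv_ne_zero (pow_ne_zero 2 (hv.ne c)))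
    linarith
  have h1 : curv v x - avgCurv v = ∫ τ in c..x, deriv (curv v) τ := by
    rw [intervalIntegral.integral_eq_sub_of_hasDerivAt (fun τ _ => hv.hasDerivAt_curv τ)
      (c3.intervalIntegrable _ _), hcR]
  have h2 : |curv v x - avgCurv v| ≤ ∫ τ in (0:ℝ)..(2 * π), |deriv (curv v) τ| := by
    rw [h1]
    refine (intervalIntegral.norm_integral_le_abs_integral_norm (f := deriv (curv v))).trans ?_
    simp only [Real.norm_eq_abs]
    have hsub : Set.uIoc c x ⊆ Set.uIoc 0 (2 * π) := by
      rw [Set.uIoc_of_le two_pi_pos.le]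
      rintro y ⟨hy1, hy2⟩
      exact ⟨lt_of_le_of_lt (le_min hc.1.le hx.1) hy1, hy2.trans (max_le hc.2.le hx.2.le)⟩
    have h3 := intervalIntegral.abs_integral_mono_interval (f := fun τ => |deriv (curv v) τ|)
      (μ := volume) hsub (Eventually.of_forall fun _ => abs_nonneg _)
      (c3.abs.intervalIntegrable _ _)
    refine h3.trans_eq (abs_of_nonneg ?_)
    exact intervalIntegral.integral_nonneg two_pi_pos.le fun _ _ => abs_nonneg _
  refine Real.le_sqrt_of_sq_le ?_
  have hvi : Continuous fun θ => (v θ)⁻¹ := c4.inv₀ hv.ne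
  have h4 := sq_integral_mul_le (f := fun τ => |deriv (curv v) τ| * v τ) (g := fun τ => (v τ)⁻¹)
    (by fun_prop) hvi two_pi_pos.le
  have h5 : ∀ τ, |deriv (curv v) τ| * v τ * (v τ)⁻¹ = |deriv (curv v) τ| := fun τ =>
    mul_inv_cancel_right₀ (hv.ne τ) _
  simp only [h5, mul_pow, sq_abs, inv_pow, hv.norm] at h4
  calc |curv v x - avgCurv v| ^ 2 ≤ (∫ τ in (0:ℝ)..(2 * π), |deriv (curv v) τ|) ^ 2 := by gcongr
    _ ≤ _ := h4
    _ = 2 * π * dirCurv v := by rw [dirCurv, mul_comm]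

theorem avgCurv_eq (hv : Profile v) :
    avgCurv v = (2 * π)⁻¹ * ∫ θ in (0:ℝ)..(2 * π), (v θ ^ 2 - 4 * deriv v θ ^ 2) := by
  have c1 := hv.smooth.continuous
  have c2 := hv.smooth_deriv.continuous
  have c3 := hv.smooth_deriv₂.continuous
  have d1 : ∀ θ, HasDerivAt v (deriv v θ) θ := fun θ =>
    (hv.smooth.differentiable (by simp) θ).hasDerivAt
  have d2 : ∀ θ, HasDerivAt (deriv v) (deriv (deriv v) θ) θ := fun θ =>
    (hv.smooth_deriv.differentiable (by simp) θ).hasDerivAt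
  have p1 := hv.per 0
  have p2 := periodic_deriv hv.per 0
  rw [zero_add] at p1 p2
  have h1 := integral_mul_deriv_periodic d1 d2 c2 c3 p1 p2
  have h2 : ∀ θ, curv v θ * ((v θ) ^ 2)⁻¹ = 4 * (v θ * deriv (deriv v) θ) + v θ ^ 2 := by
    intro θ
    have := hv.ne θ
    rw [curv]
    field_simp
  rw [avgCurv]
  simp only [h2]
  rw [intervalIntegral.integral_add (Continuous.intervalIntegrable (by fun_prop) _ _)
    (Continuous.intervalIntegrable (by fun_prop) _ _), intervalIntegral.integral_const_mul, h1,
    intervalIntegral.integral_sub (Continuous.intervalIntegrable (by fun_prop) _ _)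
    (Continuous.intervalIntegrable (by fun_prop) _ _), intervalIntegral.integral_const_mul]
  simp only [sq]
  ring

theorem avgCurv_le_one (hv : Profile v) : avgCurv v ≤ 1 := by
  rw [hv.avgCurv_eq]
  calc _ ≤ (2 * π)⁻¹ * (2 * π) :=
        mul_le_mul_of_nonneg_left hv.integral_sq_sub_le (inv_pos.2 two_pi_pos).le
    _ = 1 := inv_mul_cancel₀ two_pi_pos.ne'

/-- Near a metric of constant curvature the curvature oscillation has a spectral gap strictly
larger than the first eigenvalue. -/
theorem three_mul_oscCurv_le (hv : Profile v)
    (hs : 48 * (1 + invSqSum) * ((2 * π)⁻¹ * oscCurv v) ≤ 1) : 3 * oscCurv v ≤ dirCurv v := by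
  obtain ⟨Θ, sΘ, hl, hr, dΘ, pΘ⟩ := hv.exists_param
  have cΘ := sΘ.continuous
  have c0 := hv.smooth.continuous
  have c1 := hv.smooth_deriv.continuous
  have c2 := hv.smooth_deriv₂.continuous
  have c3 : Continuous (deriv (deriv (deriv v))) := hv.smooth_deriv₂.continuous_deriv (by simp)
  have cR := hv.smooth_curv.continuous
  have cR' := hv.continuous_deriv_curv
  have d0 : ∀ θ, HasDerivAt (fun x => (v x : ℂ)) ((deriv v θ : ℝ) : ℂ) θ := fun θ =>
    ((hv.smooth.differentiable (by simp) θ).hasDerivAt).ofReal_comp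
  have d1 : ∀ θ, HasDerivAt (fun x => ((deriv v x : ℝ) : ℂ)) ((deriv (deriv v) θ : ℝ) : ℂ) θ :=
    fun θ => ((hv.smooth_deriv.differentiable (by simp) θ).hasDerivAt).ofReal_comp
  have d2 : ∀ θ, HasDerivAt (fun x => ((deriv (deriv v) x : ℝ) : ℂ))
      ((deriv (deriv (deriv v)) θ : ℝ) : ℂ) θ :=
    fun θ => ((hv.smooth_deriv₂.differentiable (by simp) θ).hasDerivAt).ofReal_comp
  have dR : ∀ θ, deriv (curv v) θ = 3 * v θ ^ 2 * deriv v θ * (4 * deriv (deriv v) θ + v θ)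
      + v θ ^ 3 * (4 * deriv (deriv (deriv v)) θ + deriv v θ) := by
    intro θ
    have e0 := (hv.smooth.differentiable (by simp) θ).hasDerivAt
    have e2 := (hv.smooth_deriv₂.differentiable (by simp) θ).hasDerivAt
    have := (e0.pow 3).mul ((e2.const_mul 4).add e0)
    refine this.deriv.trans ?_
    simp
  have hne : ∀ θ, (v θ : ℂ) ≠ 0 := fun θ => Complex.ofReal_ne_zero.2 (hv.ne θ)
  -- coefficients killing the modes `0` and `-1`
  have cX : ∀ n : ℤ, Continuous fun s => expI n (Θ s) * (((v (Θ s) : ℝ) : ℂ) ^ 2)⁻¹ := fun n =>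
    ((continuous_expI n).comp cΘ).mul
      (Continuous.inv₀ (by fun_prop) fun s => pow_ne_zero 2 (hne _))
  obtain ⟨w, hwne, hw0, hw1⟩ : ∃ w : Fin 3 → ℂ, w ≠ 0 ∧
      fc (fun s => (w 0 * expI 0 (Θ s) + w 1 * expI 1 (Θ s) + w 2 * expI (-1) (Θ s)) *
        (((v (Θ s) : ℝ) : ℂ) ^ 2)⁻¹) 0 = 0 ∧
      fc (fun s => (w 0 * expI 0 (Θ s) + w 1 * expI 1 (Θ s) + w 2 * expI (-1) (Θ s)) *
        (((v (Θ s) : ℝ) : ℂ) ^ 2)⁻¹) (-1) = 0 := by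
    set X : ℤ → ℤ → ℂ := fun j n => fc (fun s => expI j (Θ s) * (((v (Θ s) : ℝ) : ℂ) ^ 2)⁻¹) n
      with hX
    have hexp : ∀ (w : Fin 3 → ℂ) (n : ℤ),
        fc (fun s => (w 0 * expI 0 (Θ s) + w 1 * expI 1 (Θ s) + w 2 * expI (-1) (Θ s)) *
        (((v (Θ s) : ℝ) : ℂ) ^ 2)⁻¹) n = w 0 * X 0 n + w 1 * X 1 n + w 2 * X (-1) n := by
      intro w n
      rw [hX]
      simp only
      have b0 := (cX 0).const_mul (w 0)
      have b1 := (cX 1).const_mul (w 1)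
      have e2 := fc_add b0 b1 n
      have e3 := fc_add (b0.add b1) ((cX (-1)).const_mul (w 2)) n
      rw [← fc_const_mul, ← fc_const_mul, ← fc_const_mul]
      rw [← e2]
      refine Eq.trans ?_ e3
      congr 1
      funext s
      simp only [Pi.add_apply]
      ring
    let L : (Fin 3 → ℂ) →ₗ[ℂ] (Fin 2 → ℂ) :=
      Matrix.mulVecLin !![X 0 0, X 1 0, X (-1) 0; X 0 (-1), X 1 (-1), X (-1) (-1)]
    have hker : LinearMap.ker L ≠ ⊥ := LinearMap.ker_ne_bot_of_finrank_lt (by simp)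
    obtain ⟨w, hw, hwn⟩ := (Submodule.ne_bot_iff _).1 hker
    have hLw : L w = 0 := hw
    have h0 := congrFun hLw 0
    have h1 := congrFun hLw 1
    simp [L, Matrix.mulVec, dotProduct, Fin.sum_univ_three] at h0 h1
    refine ⟨w, hwn, ?_, ?_⟩
    · rw [hexp]; linear_combination h0
    · rw [hexp]; linear_combination h1
  set Z : ℝ → ℂ := fun θ => w 0 * expI 0 θ + w 1 * expI 1 θ + w 2 * expI (-1) θ with hZ
  set Z₁ : ℝ → ℂ := fun θ => Complex.I * (w 1 * expI 1 θ - w 2 * expI (-1) θ) with hZ1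
  set Z₂ : ℝ → ℂ := fun θ => -(w 1 * expI 1 θ + w 2 * expI (-1) θ) with hZ2
  have ce0 := continuous_expI 0
  have ce1 := continuous_expI 1
  have ce2 := continuous_expI (-1)
  have cZ : Continuous Z := by fun_prop
  have cZ1 : Continuous Z₁ := by fun_prop
  have cZ2 : Continuous Z₂ := by fun_prop
  have dZ : ∀ θ, HasDerivAt Z (Z₁ θ) θ := by
    intro θ
    refine ((((hasDerivAt_expI 0 θ).const_mul (w 0)).add ((hasDerivAt_expI 1 θ).const_mul
      (w 1))).add ((hasDerivAt_expI (-1) θ).const_mul (w 2))).congr_deriv ?_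
    simp only [hZ1]
    push_cast
    ring
  have dZ1 : ∀ θ, HasDerivAt Z₁ (Z₂ θ) θ := by
    intro θ
    refine ((((hasDerivAt_expI 1 θ).const_mul (w 1)).sub ((hasDerivAt_expI (-1) θ).const_mul
      (w 2))).const_mul Complex.I).congr_deriv ?_
    simp only [hZ2]
    push_cast
    linear_combination (w 1 * expI 1 θ + w 2 * expI (-1) θ) * Complex.I_sq
  have dZ2 : ∀ θ, HasDerivAt Z₂ (-Z₁ θ) θ := by
    intro θ
    refine ((((hasDerivAt_expI 1 θ).const_mul (w 1)).add ((hasDerivAt_expI (-1) θ).const_mul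
      (w 2))).neg).congr_deriv ?_
    simp only [hZ1]
    push_cast
    ring
  have pZ : ∀ θ, Z (θ + 2 * π) = Z θ := fun θ => by simp only [hZ, expI_periodic]
  have pZ1 : ∀ θ, Z₁ (θ + 2 * π) = Z₁ θ := fun θ => by simp only [hZ1, expI_periodic]
  have pZ2 : ∀ θ, Z₂ (θ + 2 * π) = Z₂ θ := fun θ => by simp only [hZ2, expI_periodic]
  have dΘc : ∀ (F F' : ℝ → ℂ), (∀ θ, HasDerivAt F (F' θ) θ) → ∀ s,
      HasDerivAt (fun s => F (Θ s)) ((v (Θ s) : ℂ) ^ 2 * F' (Θ s)) s := by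
    intro F F' hF s
    refine ((hF (Θ s)).scomp s (dΘ s)).congr_deriv ?_
    rw [Complex.real_smul]
    push_cast
    ring
  set m : ℝ → ℝ := fun s => curv v (Θ s) - avgCurv v with hm
  set m' : ℝ → ℝ := fun s => deriv (curv v) (Θ s) * v (Θ s) ^ 2 with hm'
  have hmsq : msq (fun s => (m s : ℂ)) = (2 * π)⁻¹ * oscCurv v := by
    rw [msq, oscCurv]
    simp only [Complex.norm_real, Real.norm_eq_abs, sq_abs]
    rw [← hv.integral_comp_param cΘ hl (h := fun θ => (curv v θ - avgCurv v) ^ 2) (by fun_prop)]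
  have hmsq' : msq (fun s => (m' s : ℂ)) = (2 * π)⁻¹ * dirCurv v := by
    rw [msq, dirCurv]
    simp only [Complex.norm_real, Real.norm_eq_abs, sq_abs]
    rw [hv.integral_comp_param cΘ hl (h := fun θ => (deriv (curv v) θ * v θ ^ 2) ^ 2)
      (by fun_prop)]
    congr 2
    funext θ
    have := hv.ne θ
    field_simp
  have pΘ0 : Θ (2 * π) = Θ 0 + 2 * π := by simpa using pΘ 0
  have pv := hv.per
  have pv1 := periodic_deriv hv.per
  have pv2 := periodic_deriv (periodic_deriv hv.per)
  have key := three_mul_msq_le (m := m) (m' := m') (κ := avgCurv v)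
    (f := fun s => Z (Θ s) * (((v (Θ s) : ℝ) : ℂ) ^ 2)⁻¹)
    (f₁ := fun s => Z₁ (Θ s) - 2 * Z (Θ s) * (deriv v (Θ s) : ℝ) * ((v (Θ s) : ℝ) : ℂ)⁻¹)
    (f₂ := fun s => (v (Θ s) : ℂ) ^ 2 * Z₂ (Θ s) - 2 * (v (Θ s) : ℂ) * (deriv v (Θ s) : ℝ) * Z₁ (Θ s)
      - 2 * (v (Θ s) : ℂ) * (deriv (deriv v) (Θ s) : ℝ) * Z (Θ s)
      + 2 * ((deriv v (Θ s) : ℝ) : ℂ) ^ 2 * Z (Θ s))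
    (f₃ := fun s => (v (Θ s) : ℂ) ^ 2 * (-(v (Θ s) : ℂ) ^ 2 * Z₁ (Θ s)
      - 4 * (v (Θ s) : ℂ) * (deriv (deriv v) (Θ s) : ℝ) * Z₁ (Θ s)
      + 2 * ((deriv v (Θ s) : ℝ) : ℂ) * (deriv (deriv v) (Θ s) : ℝ) * Z (Θ s)
      - 2 * (v (Θ s) : ℂ) * (deriv (deriv (deriv v)) (Θ s) : ℝ) * Z (Θ s)))
    (fun s => by
      exact ((hv.hasDerivAt_curv (Θ s)).comp s (dΘ s)).sub_const _)
    (by fun_prop)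
    (by simp only [hm, pΘ0, hv.curv_per])
    (by
      rw [fc]
      simp only [neg_zero, expI_zero, one_mul, intervalIntegral.integral_ofReal]
      rw [hv.integral_comp_param cΘ hl (h := fun θ => curv v θ - avgCurv v) (by fun_prop),
        hv.integral_osc_eq_zero]
      simp)
    hv.avgCurv_le_one
    (fun s => by
      refine (dΘc _ _ (fun θ => (dZ θ).mul (((d0 θ).pow 2).inv (pow_ne_zero 2 (hne θ)))) s
        ).congr_deriv ?_
      have := hne (Θ s)
      simp only [Pi.inv_apply, Pi.pow_apply]
      field_simp
      ring)
    (fun s => by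
      refine (dΘc _ _ (fun θ => (dZ1 θ).sub ((((dZ θ).const_mul 2).mul (d1 θ)).mul
        ((d0 θ).inv (hne θ)))) s).congr_deriv ?_
      have := hne (Θ s)
      simp only [Pi.inv_apply, Pi.mul_apply]
      field_simp
      ring)
    (fun s => by
      refine (dΘc _ _ (fun θ => (((((d0 θ).pow 2).mul (dZ2 θ)).sub ((((d0 θ).const_mul 2).mul
        (d1 θ)).mul (dZ1 θ))).sub ((((d0 θ).const_mul 2).mul (d2 θ)).mul (dZ θ))).add
        ((((d1 θ).pow 2).const_mul 2).mul (dZ θ))) s).congr_deriv ?_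
      simp only [Pi.mul_apply, Pi.pow_apply]
      push_cast
      ring)
    (by fun_prop)
    (by simp only [pΘ0, pZ, pv])
    (by simp only [pΘ0, pZ, pZ1, pv, pv1])
    (by simp only [pΘ0, pZ, pZ1, pZ2, pv, pv1, pv2])
    (fun s => by
      have := hne (Θ s)
      simp only [hm, hm', dR, curv]
      push_cast
      field_simp
      ring)
    hw0 hw1
    (by
      by_contra hcon
      push Not at hcon
      have hz : ∀ θ ∈ Icc 0 (2 * π), Z θ = 0 := by
        intro θ hθ
        have h1 := hcon (arcLen v θ) ⟨by
          rw [← arcLen_zero v]; exact hv.strictMono_arcLen.monotone hθ.1, by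
          rw [← hv.arcLen_two_pi]; exact hv.strictMono_arcLen.monotone hθ.2⟩
        rw [hl] at h1
        exact (mul_eq_zero.1 h1).resolve_right (inv_ne_zero (pow_ne_zero 2 (hne θ)))
      have hpi := pi_pos
      have e0 := hz 0 ⟨le_rfl, two_pi_pos.le⟩
      have e1 := hz π ⟨hpi.le, by linarith⟩
      have e2 := hz (π / 2) ⟨by linarith, by linarith⟩
      have a1 : expI 1 π = -1 := by simp [expI]
      have a2 : expI (-1) π = -1 := by simp [expI, Complex.exp_neg]
      have a3 : expI 1 (π / 2) = Complex.I := by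
        simp [expI, Complex.exp_mul_I]
      have a4 : expI (-1) (π / 2) = -Complex.I := by
        simp [expI, Complex.exp_neg, Complex.exp_mul_I]
      simp only [hZ, expI_zero, expI_at_zero, a1, a2, a3, a4] at e0 e1 e2
      have w0 : w 0 = 0 := by linear_combination (1 / 2) * e0 + (1 / 2) * e1
      have w12 : w 1 + w 2 = 0 := by linear_combination e0 - w0
      have w12' : w 1 - w 2 = 0 := by
        have : Complex.I * (w 1 - w 2) = 0 := by linear_combination e2 - w0
        exact (mul_eq_zero.1 this).resolve_left Complex.I_ne_zero
      apply hwne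
      funext i
      fin_cases i
      · exact w0
      · show w 1 = 0
        linear_combination (1 / 2) * w12 + (1 / 2) * w12'
      · show w 2 = 0
        linear_combination (1 / 2) * w12 - (1 / 2) * w12')
    (by rw [hmsq]; exact hs)
  rw [hmsq, hmsq', mul_left_comm] at key
  exact le_of_mul_le_mul_left key (inv_pos.2 two_pi_pos)

end Profile

namespace FlowOn

variable {T : ℝ} {u : ℝ → ℝ → ℝ}

theorem profile (h : FlowOn T u) {t : ℝ} (h0 : 0 ≤ t) (hT : t < T) : Profile (fun θ => u θ t) :=
  ⟨h.smooth.slice_x t, fun θ => h.per θ t, fun θ => h.pos θ t, h.length_eq h0 hT⟩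

theorem avgCurv_eq (h : FlowOn T u) {t : ℝ} (h0 : 0 ≤ t) (hT : t < T) :
    avgCurv (fun θ => u θ t) = scalCurvAvg 4 u t := by
  rw [scalCurvAvg, h.length_eq h0 hT, div_eq_inv_mul]
  rfl

theorem dt_scalCurv (h : FlowOn T u) {t : ℝ} (h0 : 0 ≤ t) (hT : t < T) (θ : ℝ) :
    dt (scalCurv 4 u) θ t = u θ t ^ 4 * dx (dx (scalCurv 4 u)) θ t
      + 2 * u θ t ^ 3 * dx u θ t * dx (scalCurv 4 u) θ t
      + (scalCurv 4 u θ t - scalCurvAvg 4 u t) * scalCurv 4 u θ t := by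
  have sR := h.smooth.scalCurv
  have e1 : ∀ x, dx (dt u) x t = 1 / 4 * (dx (scalCurv 4 u) x t * u x t
      + (scalCurv 4 u x t - scalCurvAvg 4 u t) * dx u x t) := by
    intro x
    have : (fun y => dt u y t) = fun y => 1 / 4 * ((scalCurv 4 u y t - scalCurvAvg 4 u t) * u y t) := by
      funext y
      rw [h.flow y t h0 hT]
      ring
    rw [dx, this]
    exact ((((sR.hasDerivAt_x x t).sub_const _).mul (h.smooth.hasDerivAt_x x t)).const_mul _).deriv
  have e2 : dx (dx (dt u)) θ t = 1 / 4 * (dx (dx (scalCurv 4 u)) θ t * u θ t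
      + 2 * dx (scalCurv 4 u) θ t * dx u θ t
      + (scalCurv 4 u θ t - scalCurvAvg 4 u t) * dx (dx u) θ t) := by
    have : (fun y => dx (dt u) y t) = fun x => 1 / 4 * (dx (scalCurv 4 u) x t * u x t
      + (scalCurv 4 u x t - scalCurvAvg 4 u t) * dx u x t) := funext e1
    rw [dx, this]
    refine ((((sR.dx.hasDerivAt_x θ t).mul (h.smooth.hasDerivAt_x θ t)).add
      (((sR.hasDerivAt_x θ t).sub_const _).mul (h.smooth.dx.hasDerivAt_x θ t))).const_mul
      _).deriv.trans ?_
    ring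
  have e3 : dt (dx (dx u)) θ t = dx (dx (dt u)) θ t := by
    rw [h.smooth.dx.dt_dx]
    simp only [dx, show (fun y => dt (dx u) y t) = fun y => dx (dt u) y t from
      funext fun y => h.smooth.dt_dx y t]
  have e4 : dt (scalCurv 4 u) θ t = 3 * u θ t ^ 2 * dt u θ t * (4 * dx (dx u) θ t + u θ t)
      + u θ t ^ 3 * (4 * dt (dx (dx u)) θ t + dt u θ t) := by
    refine ((((h.smooth.hasDerivAt_t θ t).pow 3).mul (((h.smooth.dx.dx.hasDerivAt_t θ t).const_mul
      4).add (h.smooth.hasDerivAt_t θ t))).deriv).trans ?_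
    simp
  rw [e4, e3, e2, h.flow θ t h0 hT, scalCurv_eq]
  ring

theorem hasDerivAt_length (h : FlowOn T u) {t : ℝ} (h0 : 0 ≤ t) (hT : t < T) :
    HasDerivAt (fun s => ∫ θ in (0:ℝ)..(2 * π), ((u θ s) ^ 2)⁻¹) 0 t := by
  refine ((h.smooth_inv 2).hasDerivAt_integral 0 (2 * π) t).congr_deriv ?_
  have h2 : ∀ θ, dt (fun θ t => (u θ t ^ 2)⁻¹) θ t = -(1 / 2) * ((curv (fun θ => u θ t) θ
      - avgCurv (fun θ => u θ t)) * (u θ t ^ 2)⁻¹) := by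
    intro θ
    rw [dt, (h.hasDerivAt_inv_sq h0 hT θ).deriv, h.avgCurv_eq h0 hT]
    show _ = -(1 / 2) * ((scalCurv 4 u θ t - _) * _)
    ring
  simp only [h2]
  rw [intervalIntegral.integral_const_mul, (h.profile h0 hT).integral_osc_eq_zero, mul_zero]

/-- The flux `u² R_θ` differentiated along the circle. -/
theorem hasDerivAt_flux (h : FlowOn T u) (θ t : ℝ) :
    HasDerivAt (fun x => u x t ^ 2 * dx (scalCurv 4 u) x t)
      (2 * u θ t * dx u θ t * dx (scalCurv 4 u) θ t + u θ t ^ 2 * dx (dx (scalCurv 4 u)) θ t) θ := by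
  refine (((h.smooth.hasDerivAt_x θ t).pow 2).mul
    (h.smooth.scalCurv.dx.hasDerivAt_x θ t)).congr_deriv ?_
  simp

theorem curv_per (h : FlowOn T u) (θ t : ℝ) : scalCurv 4 u (θ + 2 * π) t = scalCurv 4 u θ t := by
  rw [scalCurv_eq, scalCurv_eq, dx_periodic (dx_periodic h.per), h.per]

theorem hasDerivAt_integral_curv (h : FlowOn T u) {t : ℝ} (h0 : 0 ≤ t) (hT : t < T) :
    HasDerivAt (fun s => ∫ θ in (0:ℝ)..(2 * π), scalCurv 4 u θ s * ((u θ s) ^ 2)⁻¹)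
      (oscCurv (fun θ => u θ t) / 2) t := by
  refine (h.smooth_curv_inv.hasDerivAt_integral 0 (2 * π) t).congr_deriv ?_
  have c1 := h.smooth.cont_x t
  have c2 := h.smooth.dx.cont_x t
  have c3 := h.smooth.scalCurv.cont_x t
  have c4 := h.smooth.scalCurv.dx.cont_x t
  have c5 := h.smooth.scalCurv.dx.dx.cont_x t
  have c6 := (h.smooth_inv 2).cont_x t
  have hp := h.profile h0 hT
  have i1 := integral_deriv_eq_zero_of_periodic (T := 2 * π) (fun x => h.hasDerivAt_flux x t)
    (by fun_prop) (by
      have := dx_periodic h.curv_per 0 t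
      rw [zero_add] at this
      simp only [h.per_zero, this])
  have i2 : ∫ θ in (0:ℝ)..(2 * π), (scalCurv 4 u θ t - scalCurvAvg 4 u t) * (u θ t ^ 2)⁻¹ = 0 := by
    rw [← h.avgCurv_eq h0 hT]; exact hp.integral_osc_eq_zero
  have i3 : oscCurv (fun θ => u θ t) = ∫ θ in (0:ℝ)..(2 * π),
      (scalCurv 4 u θ t - scalCurvAvg 4 u t) ^ 2 * (u θ t ^ 2)⁻¹ := by
    rw [← h.avgCurv_eq h0 hT]; rfl
  have e : ∀ θ, dt (fun θ t => scalCurv 4 u θ t * (u θ t ^ 2)⁻¹) θ t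
      = (2 * u θ t * dx u θ t * dx (scalCurv 4 u) θ t + u θ t ^ 2 * dx (dx (scalCurv 4 u)) θ t)
        + (1 / 2 * ((scalCurv 4 u θ t - scalCurvAvg 4 u t) ^ 2 * (u θ t ^ 2)⁻¹)
        + 1 / 2 * scalCurvAvg 4 u t * ((scalCurv 4 u θ t - scalCurvAvg 4 u t) * (u θ t ^ 2)⁻¹)) := by
    intro θ
    have hne := h.ne θ t
    refine ((h.smooth.scalCurv.hasDerivAt_t θ t).mul (h.hasDerivAt_inv_sq h0 hT θ)).deriv.trans ?_
    rw [h.dt_scalCurv h0 hT]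
    field_simp
    ring
  simp only [e]
  rw [intervalIntegral.integral_add (Continuous.intervalIntegrable (by fun_prop) _ _)
    (Continuous.intervalIntegrable (by fun_prop) _ _), i1,
    intervalIntegral.integral_add (Continuous.intervalIntegrable (by fun_prop) _ _)
    (Continuous.intervalIntegrable (by fun_prop) _ _), intervalIntegral.integral_const_mul,
    intervalIntegral.integral_const_mul, i2, i3]
  ring

theorem hasDerivAt_avg (h : FlowOn T u) {t : ℝ} (h0 : 0 ≤ t) (hT : t < T) :
    HasDerivAt (scalCurvAvg 4 u) (oscCurv (fun θ => u θ t) / (4 * π)) t := by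
  refine ((h.hasDerivAt_integral_curv h0 hT).div (h.hasDerivAt_length h0 hT)
    (h.length_pos t).ne').congr_deriv ?_
  rw [h.length_eq h0 hT]
  have := pi_pos
  field_simp
  ring

theorem hasDerivAt_integral_curv_sq (h : FlowOn T u) {t : ℝ} (h0 : 0 ≤ t) (hT : t < T) :
    HasDerivAt (fun s => ∫ θ in (0:ℝ)..(2 * π), scalCurv 4 u θ s ^ 2 * ((u θ s) ^ 2)⁻¹)
      (-2 * dirCurv (fun θ => u θ t) + 3 / 2 * (∫ θ in (0:ℝ)..(2 * π),
        (scalCurv 4 u θ t - scalCurvAvg 4 u t) ^ 3 * ((u θ t) ^ 2)⁻¹)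
        + 3 * scalCurvAvg 4 u t * oscCurv (fun θ => u θ t)) t := by
  have sm : Smooth2 (fun θ s => scalCurv 4 u θ s ^ 2 * ((u θ s) ^ 2)⁻¹) :=
    Smooth2.of_contDiff ((h.smooth.scalCurv.contDiff.pow 2).mul (h.smooth_inv 2).contDiff)
  refine (sm.hasDerivAt_integral 0 (2 * π) t).congr_deriv ?_
  have c1 := h.smooth.cont_x t
  have c2 := h.smooth.dx.cont_x t
  have c3 := h.smooth.scalCurv.cont_x t
  have c4 := h.smooth.scalCurv.dx.cont_x t
  have c5 := h.smooth.scalCurv.dx.dx.cont_x t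
  have c6 := (h.smooth_inv 2).cont_x t
  have hp := h.profile h0 hT
  have i1 := integral_deriv_eq_zero_of_periodic (T := 2 * π)
    (fun x => (h.smooth.scalCurv.hasDerivAt_x x t).mul (h.hasDerivAt_flux x t))
    (by fun_prop) (by
      have e1 := dx_periodic h.curv_per 0 t
      have e2 := h.curv_per 0 t
      rw [zero_add] at e1 e2
      simp only [Pi.mul_apply, h.per_zero, e1, e2])
  have i2 : ∫ θ in (0:ℝ)..(2 * π), (scalCurv 4 u θ t - scalCurvAvg 4 u t) * (u θ t ^ 2)⁻¹ = 0 := by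
    rw [← h.avgCurv_eq h0 hT]; exact hp.integral_osc_eq_zero
  have i3 : oscCurv (fun θ => u θ t) = ∫ θ in (0:ℝ)..(2 * π),
      (scalCurv 4 u θ t - scalCurvAvg 4 u t) ^ 2 * (u θ t ^ 2)⁻¹ := by
    rw [← h.avgCurv_eq h0 hT]; rfl
  have i4 : dirCurv (fun θ => u θ t) = ∫ θ in (0:ℝ)..(2 * π),
      dx (scalCurv 4 u) θ t ^ 2 * u θ t ^ 2 := rfl
  have e : ∀ θ, dt (fun θ t => scalCurv 4 u θ t ^ 2 * (u θ t ^ 2)⁻¹) θ t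
      = 2 * (dx (scalCurv 4 u) θ t * (u θ t ^ 2 * dx (scalCurv 4 u) θ t) + scalCurv 4 u θ t *
        (2 * u θ t * dx u θ t * dx (scalCurv 4 u) θ t + u θ t ^ 2 * dx (dx (scalCurv 4 u)) θ t))
        + (-2 * (dx (scalCurv 4 u) θ t ^ 2 * u θ t ^ 2)
        + (3 / 2 * ((scalCurv 4 u θ t - scalCurvAvg 4 u t) ^ 3 * (u θ t ^ 2)⁻¹)
        + (3 * scalCurvAvg 4 u t * ((scalCurv 4 u θ t - scalCurvAvg 4 u t) ^ 2 * (u θ t ^ 2)⁻¹)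
        + 3 / 2 * scalCurvAvg 4 u t ^ 2 *
          ((scalCurv 4 u θ t - scalCurvAvg 4 u t) * (u θ t ^ 2)⁻¹)))) := by
    intro θ
    have hne := h.ne θ t
    refine (((h.smooth.scalCurv.hasDerivAt_t θ t).pow 2).mul
      (h.hasDerivAt_inv_sq h0 hT θ)).deriv.trans ?_
    rw [h.dt_scalCurv h0 hT]
    simp only [Pi.pow_apply]
    field_simp
    push_cast
    ring
  simp only [e]
  rw [intervalIntegral.integral_add (Continuous.intervalIntegrable (by fun_prop) _ _)
    (Continuous.intervalIntegrable (by fun_prop) _ _), intervalIntegral.integral_const_mul, i1,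
    intervalIntegral.integral_add (Continuous.intervalIntegrable (by fun_prop) _ _)
    (Continuous.intervalIntegrable (by fun_prop) _ _),
    intervalIntegral.integral_add (Continuous.intervalIntegrable (by fun_prop) _ _)
    (Continuous.intervalIntegrable (by fun_prop) _ _),
    intervalIntegral.integral_add (Continuous.intervalIntegrable (by fun_prop) _ _)
    (Continuous.intervalIntegrable (by fun_prop) _ _), intervalIntegral.integral_const_mul,
    intervalIntegral.integral_const_mul, intervalIntegral.integral_const_mul,
    intervalIntegral.integral_const_mul, i2, i3, i4]
  ring

theorem oscCurv_eq (h : FlowOn T u) (t : ℝ) : oscCurv (fun θ => u θ t)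
    = (∫ θ in (0:ℝ)..(2 * π), scalCurv 4 u θ t ^ 2 * ((u θ t) ^ 2)⁻¹)
      - 2 * ((2 * π)⁻¹ * ∫ θ in (0:ℝ)..(2 * π), scalCurv 4 u θ t * ((u θ t) ^ 2)⁻¹)
        * (∫ θ in (0:ℝ)..(2 * π), scalCurv 4 u θ t * ((u θ t) ^ 2)⁻¹)
      + ((2 * π)⁻¹ * ∫ θ in (0:ℝ)..(2 * π), scalCurv 4 u θ t * ((u θ t) ^ 2)⁻¹) ^ 2
        * ∫ θ in (0:ℝ)..(2 * π), ((u θ t) ^ 2)⁻¹ := by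
  have c3 := h.smooth.scalCurv.cont_x t
  have c6 := (h.smooth_inv 2).cont_x t
  have e : oscCurv (fun θ => u θ t) = ∫ θ in (0:ℝ)..(2 * π),
    (scalCurv 4 u θ t - (2 * π)⁻¹ * ∫ θ in (0:ℝ)..(2 * π), scalCurv 4 u θ t * ((u θ t) ^ 2)⁻¹) ^ 2
      * ((u θ t) ^ 2)⁻¹ := rfl
  rw [e]
  generalize (2 * π)⁻¹ * ∫ θ in (0:ℝ)..(2 * π), scalCurv 4 u θ t * ((u θ t) ^ 2)⁻¹ = b
  have : ∀ θ, (scalCurv 4 u θ t - b) ^ 2 * ((u θ t) ^ 2)⁻¹ = (scalCurv 4 u θ t ^ 2 * ((u θ t) ^ 2)⁻¹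
      - 2 * b * (scalCurv 4 u θ t * ((u θ t) ^ 2)⁻¹)) + b ^ 2 * ((u θ t) ^ 2)⁻¹ := fun θ => by ring
  simp only [this]
  rw [intervalIntegral.integral_add (Continuous.intervalIntegrable (by fun_prop) _ _)
    (Continuous.intervalIntegrable (by fun_prop) _ _),
    intervalIntegral.integral_sub (Continuous.intervalIntegrable (by fun_prop) _ _)
    (Continuous.intervalIntegrable (by fun_prop) _ _), intervalIntegral.integral_const_mul,
    intervalIntegral.integral_const_mul]

theorem hasDerivAt_osc (h : FlowOn T u) {t : ℝ} (h0 : 0 ≤ t) (hT : t < T) :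
    HasDerivAt (fun t => oscCurv (fun θ => u θ t))
      (-2 * dirCurv (fun θ => u θ t) + 3 / 2 * (∫ θ in (0:ℝ)..(2 * π),
        (scalCurv 4 u θ t - scalCurvAvg 4 u t) ^ 3 * ((u θ t) ^ 2)⁻¹)
        + 2 * scalCurvAvg 4 u t * oscCurv (fun θ => u θ t)) t := by
  have hA := h.hasDerivAt_integral_curv h0 hT
  have hd := ((h.hasDerivAt_integral_curv_sq h0 hT).sub (((hA.const_mul (2 * π)⁻¹).const_mul 2).mul
    hA)).add (((hA.const_mul (2 * π)⁻¹).pow 2).mul (h.hasDerivAt_length h0 hT))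
  rw [show (fun t => oscCurv (fun θ => u θ t)) = _ from funext h.oscCurv_eq]
  refine hd.congr_deriv ?_
  have hL := h.length_eq h0 hT
  have hA2 : ∫ θ in (0:ℝ)..(2 * π), scalCurv 4 u θ t * ((u θ t) ^ 2)⁻¹
      = 2 * π * scalCurvAvg 4 u t := by
    rw [scalCurvAvg, hL, mul_div_cancel₀ _ two_pi_pos.ne']
  simp only [Pi.pow_apply, hL, hA2]
  have := pi_pos
  field_simp
  norm_num
  ring

theorem abs_sub_avg_le (h : FlowOn T u) {t : ℝ} (h0 : 0 ≤ t) (hT : t < T) (θ : ℝ) :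
    |scalCurv 4 u θ t - scalCurvAvg 4 u t| ≤ √(2 * π * dirCurv (fun θ => u θ t)) := by
  rw [← h.avgCurv_eq h0 hT]
  exact (h.profile h0 hT).abs_curv_sub_avg_le θ

theorem avg_le_one (h : FlowOn T u) {t : ℝ} (h0 : 0 ≤ t) (hT : t < T) : scalCurvAvg 4 u t ≤ 1 := by
  rw [← h.avgCurv_eq h0 hT]
  exact (h.profile h0 hT).avgCurv_le_one

theorem integral_cube_le (h : FlowOn T u) {t : ℝ} (h0 : 0 ≤ t) (hT : t < T) :
    ∫ θ in (0:ℝ)..(2 * π), (scalCurv 4 u θ t - scalCurvAvg 4 u t) ^ 3 * ((u θ t) ^ 2)⁻¹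
      ≤ √(2 * π * dirCurv (fun θ => u θ t)) * oscCurv (fun θ => u θ t) := by
  have c3 := h.smooth.scalCurv.cont_x t
  have c6 := (h.smooth_inv 2).cont_x t
  have i3 : oscCurv (fun θ => u θ t) = ∫ θ in (0:ℝ)..(2 * π),
      (scalCurv 4 u θ t - scalCurvAvg 4 u t) ^ 2 * (u θ t ^ 2)⁻¹ := by
    rw [← h.avgCurv_eq h0 hT]; rfl
  rw [i3, ← intervalIntegral.integral_const_mul]
  refine intervalIntegral.integral_mono_on two_pi_pos.le
    (Continuous.intervalIntegrable (by fun_prop) _ _)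
    (Continuous.intervalIntegrable (by fun_prop) _ _) fun θ _ => ?_
  rw [pow_succ', mul_assoc]
  have := h.pos θ t
  exact mul_le_mul_of_nonneg_right ((le_abs_self _).trans (h.abs_sub_avg_le h0 hT θ))
    (by positivity)

/-- If the oscillation of the curvature at time `t` is dominated by the speed of `G`, the conformal
factor moves at most as much as `G`. -/
theorem abs_log_sub_log_le (h : FlowOn T u) {G G' : ℝ → ℝ} {a b : ℝ} (ha : 0 ≤ a) (hab : a ≤ b)
    (hb : b < T) (hG : ∀ t ∈ Icc a b, HasDerivAt G (G' t) t)
    (hle : ∀ t ∈ Icc a b, √(2 * π * dirCurv (fun θ => u θ t)) / 4 ≤ G' t) (θ : ℝ) :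
    |log (u θ b) - log (u θ a)| ≤ G b - G a := by
  have hd : ∀ t ∈ Icc a b, HasDerivAt (fun t => log (u θ t))
      ((scalCurv 4 u θ t - scalCurvAvg 4 u t) / 4) t := by
    intro t ht
    refine ((h.smooth.hasDerivAt_t θ t).log (h.ne θ t)).congr_deriv ?_
    rw [h.flow θ t (ha.trans ht.1) (ht.2.trans_lt hb)]
    have := h.ne θ t
    field_simp
  have hm : ∀ t ∈ Icc a b, |(scalCurv 4 u θ t - scalCurvAvg 4 u t) / 4| ≤ G' t := by
    intro t ht
    rw [abs_div, abs_of_pos (by norm_num : (0:ℝ) < 4)]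
    have := h.abs_sub_avg_le (ha.trans ht.1) (ht.2.trans_lt hb) θ
    linarith [hle t ht]
  have h1 := le_of_hasDerivAt_nonpos hab (fun t ht => (hd t ht).sub (hG t ht)) (fun t ht => by
    linarith [(abs_le.1 (hm t ht)).2])
  have h2 := le_of_hasDerivAt_nonpos hab (fun t ht => ((hd t ht).neg).sub (hG t ht)) (fun t ht => by
    linarith [(abs_le.1 (hm t ht)).1])
  simp only [Pi.sub_apply, Pi.neg_apply] at h1 h2
  rw [abs_le]
  constructor <;> linarith

end FlowOn

namespace FlowOn

variable {T : ℝ} {u : ℝ → ℝ → ℝ}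

theorem avg_mono (h : FlowOn T u) {a b : ℝ} (ha : 0 ≤ a) (hab : a ≤ b) (hb : b < T) :
    scalCurvAvg 4 u a ≤ scalCurvAvg 4 u b := by
  have := le_of_hasDerivAt_nonpos hab
    (fun t ht => (h.hasDerivAt_avg (ha.trans ht.1) (ht.2.trans_lt hb)).neg)
    (fun t _ => neg_nonpos.2 (div_nonneg (Profile.oscCurv_nonneg _) (by positivity)))
  simpa using this

/-- The growth of the curvature oscillation is controlled by the growth of the average curvature. -/
theorem osc_deriv_le (h : FlowOn T u) {t : ℝ} (h0 : 0 ≤ t) (hT : t < T) :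
    -2 * dirCurv (fun θ => u θ t) + 3 / 2 * (∫ θ in (0:ℝ)..(2 * π),
        (scalCurv 4 u θ t - scalCurvAvg 4 u t) ^ 3 * ((u θ t) ^ 2)⁻¹)
        + 2 * scalCurvAvg 4 u t * oscCurv (fun θ => u θ t)
      ≤ -dirCurv (fun θ => u θ t) + 9 * π / 8 * oscCurv (fun θ => u θ t) ^ 2
        + 2 * oscCurv (fun θ => u θ t) := by
  have h1 := h.integral_cube_le h0 hT
  have h2 := h.avg_le_one h0 hT
  set D := dirCurv (fun θ => u θ t) with hD
  have hD0 : 0 ≤ D := Profile.dirCurv_nonneg _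
  set y := oscCurv (fun θ => u θ t) with hy
  have hy0 : 0 ≤ y := Profile.oscCurv_nonneg _
  have hs : √(2 * π * D) ^ 2 = 2 * π * D := Real.sq_sqrt (by positivity)
  have hpi := pi_pos
  have h3 : 3 / 2 * (√(2 * π * D) * y) ≤ D + 9 * π / 8 * y ^ 2 := by
    have : D = √(2 * π * D) ^ 2 / (2 * π) := by rw [hs]; field_simp
    have h4 : √(2 * π * D) ^ 2 / (2 * π) + 9 * π / 8 * y ^ 2 - 3 / 2 * (√(2 * π * D) * y)
        = (√(2 * π * D) - 3 * π / 2 * y) ^ 2 / (2 * π) := by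
      field_simp
      ring
    have h5 : 0 ≤ (√(2 * π * D) - 3 * π / 2 * y) ^ 2 / (2 * π) := by positivity
    linarith
  have h6 := mul_le_mul_of_nonneg_right h2 hy0
  linarith

/-- The weighted curvature oscillation, which decreases along the flow. -/
noncomputable def _root_.YamabeFlow.weightedOsc (u : ℝ → ℝ → ℝ) (t : ℝ) : ℝ :=
  oscCurv (fun θ => u θ t) * exp (-(9 * π ^ 2 / 2) * scalCurvAvg 4 u t - 2 * t)

theorem hasDerivAt_weightedOsc (h : FlowOn T u) {t : ℝ} (h0 : 0 ≤ t) (hT : t < T) :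
    ∃ F', HasDerivAt (weightedOsc u) F' t ∧
      F' ≤ -dirCurv (fun θ => u θ t) * exp (-(9 * π ^ 2 / 2) * scalCurvAvg 4 u t - 2 * t) := by
  refine ⟨_, (h.hasDerivAt_osc h0 hT).mul ((((h.hasDerivAt_avg h0 hT).const_mul
    (-(9 * π ^ 2 / 2))).sub ((hasDerivAt_id t).const_mul 2)).exp), ?_⟩
  have h1 := h.osc_deriv_le h0 hT
  simp only [id, Pi.sub_apply]
  set e := exp (-(9 * π ^ 2 / 2) * scalCurvAvg 4 u t - 2 * t) with he
  have he0 : 0 < e := exp_pos _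
  set y := oscCurv (fun θ => u θ t) with hy
  have h2 := mul_le_mul_of_nonneg_right h1 he0.le
  have hpi := pi_pos
  have h3 : y * (e * (-(9 * π ^ 2 / 2) * (y / (4 * π)) - 2 * 1))
      = -(9 * π / 8 * y ^ 2 + 2 * y) * e := by
    field_simp
    ring
  simp only [mul_one] at h3 ⊢
  linarith

theorem osc_le (h : FlowOn T u) {a b : ℝ} (ha : 0 ≤ a) (hab : a ≤ b) (hb : b < T) :
    oscCurv (fun θ => u θ b) ≤ oscCurv (fun θ => u θ a) *
      exp (9 * π ^ 2 / 2 * (scalCurvAvg 4 u b - scalCurvAvg 4 u a) + 2 * (b - a)) := by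
  have hd : ∀ t, ∃ F', t ∈ Icc a b → HasDerivAt (weightedOsc u) F' t ∧
      F' ≤ -dirCurv (fun θ => u θ t) * exp (-(9 * π ^ 2 / 2) * scalCurvAvg 4 u t - 2 * t) := by
    intro t
    by_cases ht : t ∈ Icc a b
    · obtain ⟨F', hF⟩ := h.hasDerivAt_weightedOsc (ha.trans ht.1) (ht.2.trans_lt hb)
      exact ⟨F', fun _ => hF⟩
    · exact ⟨0, fun h => (ht h).elim⟩
  choose F' hF using hd
  have h1 := le_of_hasDerivAt_nonpos hab (fun t ht => (hF t ht).1) (fun t ht =>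
    (hF t ht).2.trans (by
      rw [neg_mul]
      exact neg_nonpos.2 (mul_nonneg (Profile.dirCurv_nonneg _) (exp_pos _).le)))
  rw [weightedOsc, weightedOsc] at h1
  have h2 := mul_le_mul_of_nonneg_right h1
    (exp_pos (-(-(9 * π ^ 2 / 2) * scalCurvAvg 4 u b - 2 * b))).le
  rw [mul_assoc, ← exp_add, mul_assoc, ← exp_add, add_neg_cancel, exp_zero, mul_one] at h2
  refine h2.trans_eq ?_
  congr 2
  ring

/-- A priori bound for the conformal factor on bounded time intervals. -/
theorem abs_log_sub_log_zero_le (h : FlowOn T u) {t : ℝ} (h0 : 0 ≤ t) (hT : t < T) (θ : ℝ) :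
    |log (u θ t) - log (u θ 0)| ≤ π / 4 * exp (9 * π ^ 2 / 2 + 2 * T) * weightedOsc u 0 + T / 8 := by
  have hd : ∀ s, ∃ F', s ∈ Icc 0 t → HasDerivAt (weightedOsc u) F' s ∧
      F' ≤ -dirCurv (fun θ => u θ s) * exp (-(9 * π ^ 2 / 2) * scalCurvAvg 4 u s - 2 * s) := by
    intro s
    by_cases hs : s ∈ Icc 0 t
    · obtain ⟨F', hF⟩ := h.hasDerivAt_weightedOsc hs.1 (hs.2.trans_lt hT)
      exact ⟨F', fun _ => hF⟩
    · exact ⟨0, fun h => (hs h).elim⟩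
  choose F' hF using hd
  have hpi := pi_pos
  have key := h.abs_log_sub_log_le (G := fun s => π / 4 * exp (9 * π ^ 2 / 2 + 2 * T) *
    (-weightedOsc u s) + 1 / 8 * s)
    (G' := fun s => π / 4 * exp (9 * π ^ 2 / 2 + 2 * T) * (-F' s) + 1 / 8) le_rfl h0 hT
    (fun s hs => (((hF s hs).1.neg.const_mul _).add
      ((hasDerivAt_id s).const_mul (1 / 8))).congr_deriv (by simp)) (fun s hs => by
      set D := dirCurv (fun θ => u θ s) with hD
      have hD0 : 0 ≤ D := Profile.dirCurv_nonneg _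
      have hs2 : √(2 * π * D) ^ 2 = 2 * π * D := Real.sq_sqrt (by positivity)
      have h1 : √(2 * π * D) ≤ π * D + 1 / 2 := by nlinarith [sq_nonneg (√(2 * π * D) - 1)]
      have h2 := (hF s hs).2
      have h3 : exp (-(9 * π ^ 2 / 2 + 2 * T))
          ≤ exp (-(9 * π ^ 2 / 2) * scalCurvAvg 4 u s - 2 * s) := by
        apply exp_le_exp.2
        have := h.avg_le_one hs.1 (hs.2.trans_lt hT)
        have h5 : 9 * π ^ 2 / 2 * scalCurvAvg 4 u s ≤ 9 * π ^ 2 / 2 * 1 :=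
          mul_le_mul_of_nonneg_left this (by positivity)
        linarith [hs.2]
      have h4 : D * exp (-(9 * π ^ 2 / 2 + 2 * T)) ≤ -F' s := by
        have := mul_le_mul_of_nonneg_left h3 hD0
        linarith
      have h6 : D ≤ exp (9 * π ^ 2 / 2 + 2 * T) * -F' s := by
        have := mul_le_mul_of_nonneg_left h4 (exp_pos (9 * π ^ 2 / 2 + 2 * T)).le
        rwa [mul_left_comm, ← exp_add, add_neg_cancel, exp_zero, mul_one] at this
      have h7 : π / 4 * D ≤ π / 4 * (exp (9 * π ^ 2 / 2 + 2 * T) * -F' s) :=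
        mul_le_mul_of_nonneg_left h6 (by positivity)
      linarith) θ
  refine key.trans ?_
  have h8 : 0 ≤ weightedOsc u t := mul_nonneg (Profile.oscCurv_nonneg _) (exp_pos _).le
  have h9 : 0 ≤ π / 4 * exp (9 * π ^ 2 / 2 + 2 * T) * weightedOsc u t := by positivity
  simp only [mul_zero, add_zero]
  linarith

end FlowOn

/-- The geometric quantities that control the existence time of the flow. -/
structure Controlled (K : ℝ) (v : ℝ → ℝ) : Prop where
  le : ∀ θ, v θ ≤ K
  osc : oscCurv v ≤ K
  avg : -K ≤ avgCurv v

/-- Along the flow the controlling quantities stay bounded on bounded time intervals. -/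
theorem exists_controlled {v : ℝ → ℝ} (hv : Profile v) (T₀ : ℝ) : ∃ K, ∀ T ≤ T₀, ∀ u, FlowOn T u →
    (∀ θ, u θ 0 = v θ) → ∀ t, 0 ≤ t → t < T → Controlled K (fun θ => u θ t) := by
  obtain ⟨B, hB⟩ := (isCompact_Icc (a := (0:ℝ)) (b := 2 * π)).exists_bound_of_continuousOn
    hv.smooth.continuous.continuousOn
  have hB' : ∀ θ, v θ ≤ B := by
    intro θ
    obtain ⟨x, hx, hxe⟩ := Function.Periodic.exists_mem_Ico₀ (f := v) hv.per two_pi_pos θ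
    rw [hxe]
    exact (le_abs_self _).trans (hB x ⟨hx.1, hx.2.le⟩)
  set W := oscCurv v * exp (-(9 * π ^ 2 / 2) * avgCurv v) with hW
  set K₁ := B * exp (π / 4 * exp (9 * π ^ 2 / 2 + 2 * T₀) * W + T₀ / 8) with hK1
  set K₂ := oscCurv v * exp (9 * π ^ 2 / 2 * (1 - avgCurv v) + 2 * T₀) with hK2
  refine ⟨max K₁ (max K₂ (-avgCurv v)), fun T hT u hu h0 t ht htT => ?_⟩
  have hu0 : (fun θ => u θ 0) = v := funext h0
  have hpi := pi_pos
  have hT0 : 0 < T := ht.trans_lt htT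
  have ha : scalCurvAvg 4 u 0 = avgCurv v := by rw [← hu.avgCurv_eq le_rfl hT0, hu0]
  refine ⟨fun θ => le_trans ?_ (le_max_left _ _), le_trans ?_ ((le_max_left _ _).trans
    (le_max_right _ _)), ?_⟩
  · have h1 := (abs_le.1 (hu.abs_log_sub_log_zero_le ht htT θ)).2
    have h2 : weightedOsc u 0 = W := by
      rw [weightedOsc, hu0, ha, hW]
      simp
    rw [h2] at h1
    have hW0 : 0 ≤ W := mul_nonneg (Profile.oscCurv_nonneg _) (exp_pos _).le
    have h3 : log (u θ t) ≤ log (u θ 0) + (π / 4 * exp (9 * π ^ 2 / 2 + 2 * T₀) * W + T₀ / 8) := by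
      have : π / 4 * exp (9 * π ^ 2 / 2 + 2 * T) * W ≤ π / 4 * exp (9 * π ^ 2 / 2 + 2 * T₀) * W := by
        gcongr
      linarith
    have h4 := exp_le_exp.2 h3
    rw [exp_add, exp_log (hu.pos θ t), exp_log (hu.pos θ 0), h0] at h4
    exact h4.trans (mul_le_mul_of_nonneg_right (hB' θ) (exp_pos _).le)
  · have h1 := hu.osc_le le_rfl ht htT
    rw [hu0, ha] at h1
    refine h1.trans (mul_le_mul_of_nonneg_left (exp_le_exp.2 ?_) (Profile.oscCurv_nonneg _))
    have h5 : 9 * π ^ 2 / 2 * (scalCurvAvg 4 u t - avgCurv v) ≤ 9 * π ^ 2 / 2 * (1 - avgCurv v) :=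
      mul_le_mul_of_nonneg_left (by linarith [hu.avg_le_one ht htT]) (by positivity)
    linarith
  · rw [hu.avgCurv_eq ht htT]
    have h1 := hu.avg_mono le_rfl ht htT
    rw [ha] at h1
    have h2 : -avgCurv v ≤ max K₁ (max K₂ (-avgCurv v)) :=
      (le_max_right _ _).trans (le_max_right _ _)
    linarith

section Convergence

variable {u : ℝ → ℝ → ℝ}

theorem exists_osc_le (h : ∀ T, FlowOn T u) {ε : ℝ} (hε : 0 < ε) :
    ∃ t₁, 0 ≤ t₁ ∧ ∀ t, t₁ ≤ t → oscCurv (fun θ => u θ t) ≤ ε := by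
  have hpi := pi_pos
  set M := 9 * π ^ 2 / 2 * (1 - scalCurvAvg 4 u 0) + 2 with hM
  set δ := ε / (4 * π * exp M) with hδ
  have hδ0 : 0 < δ := by positivity
  set S := scalCurvAvg 4 u '' Ici 0 with hS
  have hbdd : BddAbove S := ⟨1, by
    rintro _ ⟨t, ht, rfl⟩
    exact (h (t + 1)).avg_le_one ht (by linarith)⟩
  obtain ⟨_, ⟨t₀, ht₀, rfl⟩, hlt⟩ := exists_lt_of_lt_csSup (s := S) ⟨_, 0, self_mem_Ici, rfl⟩
    (show sSup S - δ < sSup S by linarith)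
  have ht₀' : 0 ≤ t₀ := ht₀
  refine ⟨t₀ + 1, by linarith, fun t ht => ?_⟩
  have hc := (h 0).continuous_avg
  obtain ⟨ξ, hξ, hξe⟩ := exists_hasDerivAt_eq_slope (scalCurvAvg 4 u)
    (fun t => oscCurv (fun θ => u θ t) / (4 * π)) (a := t - 1) (b := t) (by linarith)
    hc.continuousOn (fun x hx => (h (x + 1)).hasDerivAt_avg (by linarith [hx.1]) (by linarith))
  have h1 : scalCurvAvg 4 u t ≤ sSup S := le_csSup hbdd ⟨t, by show 0 ≤ t; linarith, rfl⟩
  have h2 := (h t).avg_mono ht₀ (show t₀ ≤ t - 1 by linarith) (by linarith)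
  have h3 : oscCurv (fun θ => u θ ξ) ≤ 4 * π * δ := by
    have : oscCurv (fun θ => u θ ξ) / (4 * π) ≤ δ := by
      rw [hξe, sub_sub_cancel, div_one]
      linarith
    rw [div_le_iff₀ (by positivity)] at this
    linarith
  have hξ0 : 0 ≤ ξ := by linarith [hξ.1]
  have h4 := (h (t + 1)).osc_le hξ0 hξ.2.le (by linarith)
  have h5 : 9 * π ^ 2 / 2 * (scalCurvAvg 4 u t - scalCurvAvg 4 u ξ) + 2 * (t - ξ) ≤ M := by
    have e1 := (h (t + 1)).avg_le_one (show 0 ≤ t by linarith) (by linarith)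
    have e2 := (h (t + 1)).avg_mono le_rfl hξ0 (by linarith [hξ.2])
    have : 9 * π ^ 2 / 2 * (scalCurvAvg 4 u t - scalCurvAvg 4 u ξ)
        ≤ 9 * π ^ 2 / 2 * (1 - scalCurvAvg 4 u 0) :=
      mul_le_mul_of_nonneg_left (by linarith) (by positivity)
    linarith [hξ.1]
  calc oscCurv (fun θ => u θ t) ≤ 4 * π * δ * exp M :=
        h4.trans (mul_le_mul h3 (exp_le_exp.2 h5) (exp_pos _).le (by positivity))
    _ = ε := by rw [hδ]; field_simp

theorem osc_deriv_le_of_small {T : ℝ} (h : FlowOn T u) {t : ℝ} (h0 : 0 ≤ t) (hT : t < T)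
    (hs : 48 * (1 + invSqSum) * ((2 * π)⁻¹ * oscCurv (fun θ => u θ t)) ≤ 1)
    (hs' : oscCurv (fun θ => u θ t) ≤ 1 / (18 * π)) :
    -2 * dirCurv (fun θ => u θ t) + 3 / 2 * (∫ θ in (0:ℝ)..(2 * π),
        (scalCurv 4 u θ t - scalCurvAvg 4 u t) ^ 3 * ((u θ t) ^ 2)⁻¹)
        + 2 * scalCurvAvg 4 u t * oscCurv (fun θ => u θ t)
      ≤ -(1 / 2) * dirCurv (fun θ => u θ t) - 1 / 2 * oscCurv (fun θ => u θ t) := by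
  have h1 := h.integral_cube_le h0 hT
  have h2 := h.avg_le_one h0 hT
  have h3 := (h.profile h0 hT).three_mul_oscCurv_le hs
  set D := dirCurv (fun θ => u θ t) with hD
  have hD0 : 0 ≤ D := Profile.dirCurv_nonneg _
  set y := oscCurv (fun θ => u θ t) with hy
  have hy0 : 0 ≤ y := Profile.oscCurv_nonneg _
  have hsq : √(2 * π * D) ^ 2 = 2 * π * D := Real.sq_sqrt (by positivity)
  have hpi := pi_pos
  have h4 : 3 / 2 * (√(2 * π * D) * y) ≤ 1 / 4 * D + 9 * π / 2 * y ^ 2 := by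
    have : D = √(2 * π * D) ^ 2 / (2 * π) := by rw [hsq]; field_simp
    have h4 : 1 / 4 * (√(2 * π * D) ^ 2 / (2 * π)) + 9 * π / 2 * y ^ 2 - 3 / 2 * (√(2 * π * D) * y)
        = (√(2 * π * D) - 6 * π * y) ^ 2 / (8 * π) := by
      field_simp
      ring
    have h5 : 0 ≤ (√(2 * π * D) - 6 * π * y) ^ 2 / (8 * π) := by positivity
    linarith
  have h5 : 9 * π / 2 * y ^ 2 ≤ 1 / 4 * y := by
    have h6 : y * (18 * π) ≤ 1 := by rwa [le_div_iff₀ (by positivity)] at hs'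
    nlinarith
  have h6 := mul_le_mul_of_nonneg_right h2 hy0
  linarith

/-- Eventually the curvature oscillation and the increments of the conformal factor decay
exponentially. -/
theorem exists_exp_decay (h : ∀ T, FlowOn T u) : ∃ t₁ C, 0 ≤ t₁ ∧ 0 < C ∧
    (∀ t, t₁ ≤ t → oscCurv (fun θ => u θ t) ≤ C * exp (-(1 / 2) * t)) ∧
    ∀ θ t t', t₁ ≤ t → t ≤ t' → |log (u θ t') - log (u θ t)| ≤ C * exp (-(1 / 4) * t) := by
  have hpi := pi_pos
  have hk : 0 ≤ invSqSum := invSqSum_nonneg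
  obtain ⟨t₁, ht₁, hsm⟩ := exists_osc_le h
    (ε := min (1 / (18 * π)) (1 / (48 * (1 + invSqSum) * (2 * π)⁻¹))) (by positivity)
  have hd : ∀ t, t₁ ≤ t → ∃ y', HasDerivAt (fun t => oscCurv (fun θ => u θ t)) y' t ∧
      y' ≤ -(1 / 2) * dirCurv (fun θ => u θ t) - 1 / 2 * oscCurv (fun θ => u θ t) := by
    intro t ht
    refine ⟨_, (h (t + 1)).hasDerivAt_osc (ht₁.trans ht) (by linarith),
      osc_deriv_le_of_small (h (t + 1)) (ht₁.trans ht) (by linarith) ?_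
        ((hsm t ht).trans (min_le_left _ _))⟩
    have := (hsm t ht).trans (min_le_right _ _)
    rw [le_div_iff₀ (by positivity)] at this
    linarith
  choose! y' hy' hle using hd
  set y₁ := oscCurv (fun θ => u θ t₁) with hy1
  have hy10 : 0 ≤ y₁ := Profile.oscCurv_nonneg _
  have hdec : ∀ t, t₁ ≤ t → oscCurv (fun θ => u θ t) ≤ y₁ * exp (1 / 2 * t₁) * exp (-(1 / 2) * t) := by
    intro t ht
    have := le_exp_mul_of_hasDerivAt_le (C := -(1 / 2)) ht (fun s hs => hy' s hs.1) (fun s hs => by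
      have h1 := hle s hs.1
      have h2 := Profile.dirCurv_nonneg (fun θ => u θ s)
      linarith)
    refine this.trans_eq ?_
    rw [mul_assoc, ← exp_add]
    congr 2
    ring
  have hC : 0 ≤ y₁ * exp (1 / 2 * t₁) := by positivity
  refine ⟨t₁, (π / 2 + 1) * (y₁ * exp (1 / 2 * t₁)) + 1 / 2, ht₁, by positivity, fun t ht =>
    (hdec t ht).trans (mul_le_mul_of_nonneg_right (by nlinarith) (exp_pos _).le),
    fun θ t t' ht htt => ?_⟩
  have he : ∀ s : ℝ, exp (-(1 / 4) * s) * exp (1 / 4 * s) = 1 := fun s => by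
    rw [← exp_add]; simp
  have key := (h (t' + 1)).abs_log_sub_log_le
    (G := fun s => -(π / 2) * (oscCurv (fun θ => u θ s) * exp (1 / 4 * s))
      - 1 / 2 * exp (-(1 / 4) * s))
    (G' := fun s => -(π / 2) * (y' s * exp (1 / 4 * s)
      + oscCurv (fun θ => u θ s) * (exp (1 / 4 * s) * (1 / 4)))
      - 1 / 2 * (exp (-(1 / 4) * s) * (-(1 / 4)))) (ht₁.trans ht) htt (by linarith)
    (fun s hs => by
      have e1 := ((hasDerivAt_id s).const_mul (1 / 4)).exp
      have e2 := ((hasDerivAt_id s).const_mul (-(1 / 4))).exp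
      simp only [id, mul_one] at e1 e2
      exact (((hy' s (ht.trans hs.1)).mul e1).const_mul _).sub (e2.const_mul _))
    (fun s hs => by
      have h1 := hle s (ht.trans hs.1)
      have h3 := he s
      set D := dirCurv (fun θ => u θ s) with hD
      have hD0 : 0 ≤ D := Profile.dirCurv_nonneg _
      have hs2 : √(2 * π * D) ^ 2 = 2 * π * D := Real.sq_sqrt (by positivity)
      set y := oscCurv (fun θ => u θ s) with hy
      have hy0 : 0 ≤ y := Profile.oscCurv_nonneg _
      set e := exp (1 / 4 * s) with hee
      have he0 : 0 < e := exp_pos _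
      set e' := exp (-(1 / 4) * s) with hee'
      have he0' : 0 < e' := exp_pos _
      have h4 : √(2 * π * D) ≤ π * D * e + e' / 2 := by
        have : e * e' = 1 := by linarith
        have h5 : π * D * e + e' / 2 - √(2 * π * D) = (√(2 * π * D) * e - 1) ^ 2 * (e' / 2) := by
          linear_combination (-(e * e' / 2)) * hs2 * e + (√(2 * π * D) - π * D * e) * this
        have h6 : 0 ≤ (√(2 * π * D) * e - 1) ^ 2 * (e' / 2) := by positivity
        linarith
      have h7 : y' s * e ≤ (-(1 / 2) * D - 1 / 2 * y) * e := mul_le_mul_of_nonneg_right h1 he0.le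
      have h8 : y' s * e + y * (e * (1 / 4)) ≤ -(1 / 2) * (D * e) := by
        have := mul_nonneg hy0 he0.le
        linarith
      have h9 : π / 2 * (y' s * e + y * (e * (1 / 4))) ≤ π / 2 * (-(1 / 2) * (D * e)) :=
        mul_le_mul_of_nonneg_left h8 (by positivity)
      linarith) θ
  refine key.trans ?_
  have h5 : 0 ≤ π / 2 * (oscCurv (fun θ => u θ t') * exp (1 / 4 * t')) :=
    mul_nonneg (by positivity) (mul_nonneg (Profile.oscCurv_nonneg _) (exp_pos _).le)
  have h6 : oscCurv (fun θ => u θ t) * exp (1 / 4 * t)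
      ≤ y₁ * exp (1 / 2 * t₁) * exp (-(1 / 4) * t) := by
    refine (mul_le_mul_of_nonneg_right (hdec t ht) (exp_pos _).le).trans_eq ?_
    rw [mul_assoc, ← exp_add]
    congr 2
    ring
  have h7 := mul_le_mul_of_nonneg_left h6 (show 0 ≤ π / 2 by positivity)
  have h8 := exp_pos (-(1 / 4) * t')
  have h9 := mul_nonneg hC (exp_pos (-(1 / 4) * t)).le
  simp only [add_mul, one_mul]
  linarith

end Convergence

theorem abs_exp_sub_exp_le {a b M : ℝ} (ha : a ≤ M) (hb : b ≤ M) :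
    |exp a - exp b| ≤ exp M * |a - b| := by
  have := Convex.norm_image_sub_le_of_norm_hasDerivWithin_le (f := exp) (f' := exp) (s := Iic M)
    (C := exp M) (fun x _ => (hasDerivAt_exp x).hasDerivWithinAt)
    (fun x hx => by rw [Real.norm_eq_abs, abs_of_pos (exp_pos _)]; exact exp_le_exp.2 hx)
    (convex_Iic M) (x := b) (y := a) hb ha
  simpa [Real.norm_eq_abs] using this

theorem integral_periodic_shift {f : ℝ → ℝ} (hp : ∀ x, f (x + 2 * π) = f x) (a : ℝ) :
    ∫ x in a..(a + 2 * π), f x = ∫ x in (0:ℝ)..(2 * π), f x := by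
  have := Function.Periodic.intervalIntegral_add_eq (f := f) hp a 0
  rwa [zero_add] at this

/-- Taylor's formula with integral remainder of order two. -/
theorem taylor_two {v v' v'' : ℝ → ℝ} (h1 : ∀ x, HasDerivAt v (v' x) x)
    (h2 : ∀ x, HasDerivAt v' (v'' x) x) (hc : Continuous v'') (a θ : ℝ) :
    v θ = v a + v' a * (θ - a) + ∫ τ in a..θ, (θ - τ) * v'' τ := by
  have c1 : Continuous v' := continuous_iff_continuousAt.2 fun x => (h2 x).continuousAt
  rw [intervalIntegral.integral_eq_sub_of_hasDerivAt (f := fun τ => (θ - τ) * v' τ + v τ)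
    (fun τ _ => ((((hasDerivAt_id τ).const_sub θ).mul (h2 τ)).add (h1 τ)).congr_deriv (by
      simp only [id]; ring)) (Continuous.intervalIntegrable (by fun_prop) _ _)]
  ring

/-- A positive solution of a second order equation with smooth right hand side is smooth. -/
theorem contDiff_of_second_order {U U' : ℝ → ℝ} {c : ℝ} (hpos : ∀ x, 0 < U x)
    (h1 : ∀ x, HasDerivAt U (U' x) x)
    (h2 : ∀ x, HasDerivAt U' (1 / 4 * (c * (U x ^ 3)⁻¹ - U x)) x) : ContDiff ℝ ∞ U := by
  have key : ∀ n : ℕ, ContDiff ℝ n U ∧ ContDiff ℝ n U' := by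
    intro n
    induction n with
    | zero =>
      exact ⟨contDiff_zero.2 (continuous_iff_continuousAt.2 fun x => (h1 x).continuousAt),
        contDiff_zero.2 (continuous_iff_continuousAt.2 fun x => (h2 x).continuousAt)⟩
    | succ n ih =>
      push_cast
      refine ⟨contDiff_succ_iff_deriv.2 ⟨fun x => (h1 x).differentiableAt, by simp, ?_⟩,
        contDiff_succ_iff_deriv.2 ⟨fun x => (h2 x).differentiableAt, by simp, ?_⟩⟩
      · rw [show deriv U = U' from funext fun x => (h1 x).deriv]
        exact ih.2
      · rw [show deriv U' = fun x => 1 / 4 * (c * (U x ^ 3)⁻¹ - U x) from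
          funext fun x => (h2 x).deriv]
        exact contDiff_const.mul ((contDiff_const.mul ((ih.1.pow 3).inv fun x =>
          (pow_pos (hpos x) 3).ne')).sub ih.1)
  exact contDiff_infty.2 fun n => (key n).1

section Limit

variable {u : ℝ → ℝ → ℝ}

theorem exists_limit (h : ∀ T, FlowOn T u) : ∃ (U : ℝ → ℝ) (C a : ℝ), 0 < C ∧ 0 < a ∧
    ContDiff ℝ ∞ U ∧ (∀ θ, U (θ + 2 * π) = U θ) ∧ (∀ θ, 0 < U θ) ∧
    (∀ t, 0 ≤ t → ∀ θ, |u θ t - U θ| ≤ C * exp (-a * t)) ∧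
    ∃ c, ∀ θ, U θ ^ 3 * (4 * deriv (deriv U) θ + U θ) = c := by
  obtain ⟨t₁, C₁, ht₁, hC₁, hosc, hlog⟩ := exists_exp_decay h
  have hpi := pi_pos
  have h0 := h 0
  -- the pointwise limit
  have hexp0 : Tendsto (fun t : ℝ => exp (-(1 / 4) * t)) atTop (𝓝 0) :=
    Real.tendsto_exp_atBot.comp (tendsto_id.const_mul_atTop_of_neg (by norm_num))
  have hcau : ∀ θ, ∃ l, Tendsto (fun t => log (u θ t)) atTop (𝓝 l) := by
    intro θ
    refine cauchy_map_iff_exists_tendsto.1 (Metric.cauchy_iff.2 ⟨inferInstance, fun ε hε => ?_⟩)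
    have h1 : Tendsto (fun t : ℝ => C₁ * exp (-(1 / 4) * t)) atTop (𝓝 0) := by
      simpa using hexp0.const_mul C₁
    obtain ⟨s, hs1, hs2⟩ := ((h1.eventually (gt_mem_nhds (half_pos hε))).and
      (eventually_ge_atTop t₁)).exists
    refine ⟨_, image_mem_map (Ici_mem_atTop s), ?_⟩
    rintro _ ⟨a, ha, rfl⟩ _ ⟨b, hb, rfl⟩
    have e1 := hlog θ s a hs2 ha
    have e2 := hlog θ s b hs2 hb
    rw [Real.dist_eq]
    have := abs_sub_le (log (u θ a)) (log (u θ s)) (log (u θ b))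
    rw [abs_sub_comm (log (u θ s))] at this
    linarith
  choose l hl using hcau
  have hll : ∀ θ t, t₁ ≤ t → |l θ - log (u θ t)| ≤ C₁ * exp (-(1 / 4) * t) := fun θ t ht =>
    le_of_tendsto (((hl θ).sub_const _).abs) ((eventually_ge_atTop t).mono fun s hs =>
      hlog θ t s ht hs)
  obtain ⟨B, hB0, hB⟩ : ∃ B, 0 ≤ B ∧ ∀ θ, |log (u θ t₁)| ≤ B := by
    have c : Continuous fun θ => log (u θ t₁) := (h0.smooth.cont_x t₁).log fun θ => h0.ne θ t₁
    obtain ⟨B, hB⟩ := (isCompact_Icc (a := (0:ℝ)) (b := 2 * π)).exists_bound_of_continuousOn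
      c.continuousOn
    refine ⟨max B 0, le_max_right _ _, fun θ => ?_⟩
    obtain ⟨x, hx, hxe⟩ := Function.Periodic.exists_mem_Ico₀ (f := fun θ => u θ t₁)
      (fun θ => h0.per θ t₁) two_pi_pos θ
    rw [hxe]
    exact (hB x ⟨hx.1, hx.2.le⟩).trans (le_max_left _ _)
  set M := B + C₁ with hM
  have hM0 : 0 ≤ M := by positivity
  have he1 : ∀ t, t₁ ≤ t → exp (-(1 / 4) * t) ≤ 1 := fun t ht =>
    exp_le_one_iff.2 (by linarith)
  have hub : ∀ θ t, t₁ ≤ t → |log (u θ t)| ≤ M := by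
    intro θ t ht
    have e1 := hlog θ t₁ t le_rfl ht
    have e2 := hB θ
    have e3 := mul_le_mul_of_nonneg_left (he1 t₁ le_rfl) hC₁.le
    have := abs_sub_abs_le_abs_sub (log (u θ t)) (log (u θ t₁))
    linarith
  have hlb : ∀ θ, |l θ| ≤ M := fun θ => le_of_tendsto (hl θ).abs
    ((eventually_ge_atTop t₁).mono fun t ht => hub θ t ht)
  set U : ℝ → ℝ := fun θ => exp (l θ) with hU
  have hUpos : ∀ θ, 0 < U θ := fun θ => exp_pos _
  have hUlim : ∀ θ, Tendsto (u θ) atTop (𝓝 (U θ)) := fun θ =>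
    ((continuous_exp.tendsto _).comp (hl θ)).congr fun t => exp_log (h0.pos θ t)
  have hUper : ∀ θ, U (θ + 2 * π) = U θ := fun θ =>
    tendsto_nhds_unique (hUlim _) ((hUlim θ).congr fun t => (h0.per θ t).symm)
  have hule : ∀ θ t, t₁ ≤ t → u θ t ≤ exp M := fun θ t ht => by
    rw [← exp_log (h0.pos θ t)]
    exact exp_le_exp.2 ((le_abs_self _).trans (hub θ t ht))
  have huge : ∀ θ t, t₁ ≤ t → exp (-M) ≤ u θ t := fun θ t ht => by
    rw [← exp_log (h0.pos θ t)]
    exact exp_le_exp.2 (neg_le_of_abs_le (hub θ t ht))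
  have hrate : ∀ θ t, t₁ ≤ t → |u θ t - U θ| ≤ exp M * C₁ * exp (-(1 / 4) * t) := by
    intro θ t ht
    rw [← exp_log (h0.pos θ t)]
    refine (abs_exp_sub_exp_le ((le_abs_self _).trans (hub θ t ht))
      ((le_abs_self _).trans (hlb θ))).trans ?_
    rw [abs_sub_comm, mul_assoc]
    exact mul_le_mul_of_nonneg_left (hll θ t ht) (exp_pos _).le
  have hUcont : Continuous U := by
    refine TendstoUniformly.continuous (F := fun (t : ℝ) θ => u θ t) (p := atTop)
      (Metric.tendstoUniformly_iff.2 fun ε hε => ?_)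
      (Frequently.of_forall fun t => h0.smooth.cont_x t)
    have h1 : Tendsto (fun t : ℝ => exp M * C₁ * exp (-(1 / 4) * t)) atTop (𝓝 0) := by
      simpa using hexp0.const_mul (exp M * C₁)
    filter_upwards [h1.eventually (gt_mem_nhds hε), eventually_ge_atTop t₁] with t h2 h3 θ
    rw [dist_comm, Real.dist_eq]
    exact (hrate θ t h3).trans_lt h2
  -- the average curvature converges
  obtain ⟨c, hc⟩ : ∃ c, Tendsto (scalCurvAvg 4 u) atTop (𝓝 c) := by
    have hm : Monotone fun t => scalCurvAvg 4 u (max t 0) := fun a b hab =>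
      (h (max b 0 + 1)).avg_mono (le_max_right _ _) (max_le_max hab le_rfl) (by linarith)
    have hb : BddAbove (range fun t => scalCurvAvg 4 u (max t 0)) := ⟨1, by
      rintro _ ⟨t, rfl⟩
      exact (h (max t 0 + 1)).avg_le_one (le_max_right _ _) (by linarith)⟩
    refine ⟨_, (tendsto_atTop_ciSup hm hb).congr' ?_⟩
    filter_upwards [eventually_ge_atTop 0] with t ht
    rw [max_eq_left ht]
  set g : ℝ → ℝ := fun θ => 1 / 4 * (c * (U θ ^ 3)⁻¹ - U θ) with hg
  have hgc : Continuous g := by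
    have := (hUcont.pow 3).inv₀ fun θ => (pow_pos (hUpos θ) 3).ne'
    exact continuous_const.mul ((continuous_const.mul this).sub hUcont)
  -- the second order equation along the flow
  have hsec : ∀ θ t, dx (dx u) θ t = 1 / 4 * ((scalCurv 4 u θ t - scalCurvAvg 4 u t) * (u θ t ^ 3)⁻¹)
      + 1 / 4 * (scalCurvAvg 4 u t * (u θ t ^ 3)⁻¹ - u θ t) := by
    intro θ t
    rw [scalCurv_eq]
    have := h0.ne θ t
    field_simp
    ring
  have hosc0 : Tendsto (fun t => √(2 * π * oscCurv (fun θ => u θ t))) atTop (𝓝 0) := by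
    have hexp1 : Tendsto (fun t : ℝ => exp (-(1 / 2) * t)) atTop (𝓝 0) :=
      Real.tendsto_exp_atBot.comp (tendsto_id.const_mul_atTop_of_neg (by norm_num))
    have h1 : Tendsto (fun t => oscCurv (fun θ => u θ t)) atTop (𝓝 0) :=
      tendsto_of_tendsto_of_tendsto_of_le_of_le' tendsto_const_nhds
        (by simpa using hexp1.const_mul C₁)
        (Eventually.of_forall fun t => Profile.oscCurv_nonneg _)
        ((eventually_ge_atTop t₁).mono hosc)
    have h2 := (Real.continuous_sqrt.tendsto _).comp (h1.const_mul (2 * π))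
    rwa [mul_zero, Real.sqrt_zero] at h2
  have hconv : ∀ a θ, θ ∈ Icc a (a + 2 * π) → Tendsto (fun t => ∫ τ in a..θ, (θ - τ) * dx (dx u) τ t)
      atTop (𝓝 (∫ τ in a..θ, (θ - τ) * g τ)) := by
    intro a θ hθ
    have split : ∀ t, ∫ τ in a..θ, (θ - τ) * dx (dx u) τ t
        = (∫ τ in a..θ, (θ - τ) * (1 / 4 * ((scalCurv 4 u τ t - scalCurvAvg 4 u t) * (u τ t ^ 3)⁻¹)))
          + ∫ τ in a..θ, (θ - τ) * (1 / 4 * (scalCurvAvg 4 u t * (u τ t ^ 3)⁻¹ - u τ t)) := by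
      intro t
      have c1 := h0.smooth.cont_x t
      have c2 := h0.smooth.scalCurv.cont_x t
      have c3 := (h0.smooth_inv 3).cont_x t
      rw [← intervalIntegral.integral_add (Continuous.intervalIntegrable (by fun_prop) _ _)
        (Continuous.intervalIntegrable (by fun_prop) _ _)]
      congr 1
      funext τ
      rw [hsec]
      ring
    rw [show (fun t => ∫ τ in a..θ, (θ - τ) * dx (dx u) τ t) = _ from funext split,
      ← zero_add (∫ τ in a..θ, (θ - τ) * g τ)]
    refine Tendsto.add ?_ ?_
    · refine squeeze_zero_norm' (a := fun t => π / 2 * exp (2 * M) *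
        √(2 * π * oscCurv (fun θ => u θ t))) ?_ (by simpa using hosc0.const_mul _)
      filter_upwards [eventually_ge_atTop t₁] with t ht
      have c1 := h0.smooth.cont_x t
      have c2 := h0.smooth.scalCurv.cont_x t
      have c3 := (h0.smooth_inv 1).cont_x t
      simp only [pow_one] at c3
      have t0 : 0 ≤ t := ht₁.trans ht
      have htT : t < t + 1 := by linarith
      have b1 : ‖∫ τ in a..θ, (θ - τ) * (1 / 4 * ((scalCurv 4 u τ t - scalCurvAvg 4 u t)
          * (u τ t ^ 3)⁻¹))‖ ≤ ∫ τ in a..θ, π / 2 * exp (2 * M) *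
            (|scalCurv 4 u τ t - scalCurvAvg 4 u t| * (u τ t)⁻¹) := by
        refine intervalIntegral.norm_integral_le_of_norm_le hθ.1 (Eventually.of_forall
          fun τ hτ => ?_) (Continuous.intervalIntegrable (by fun_prop) _ _)
        have hp := h0.pos τ t
        rw [norm_mul, norm_mul, norm_mul, Real.norm_eq_abs, Real.norm_eq_abs, Real.norm_eq_abs,
          Real.norm_eq_abs, abs_of_nonneg (show 0 ≤ θ - τ by linarith [hτ.2]),
          abs_of_pos (show 0 < (u τ t ^ 3)⁻¹ by positivity),
          abs_of_pos (show (0:ℝ) < 1 / 4 by norm_num)]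
        have e1 : (u τ t ^ 3)⁻¹ = (u τ t)⁻¹ ^ 2 * (u τ t)⁻¹ := by
          rw [← pow_succ, inv_pow]
        have e2 : (u τ t)⁻¹ ^ 2 ≤ exp (2 * M) := by
          have e3 : (u τ t)⁻¹ ≤ exp M := by
            rw [← inv_inv (exp M), ← exp_neg]
            exact inv_anti₀ (exp_pos _) (huge τ t ht)
          calc (u τ t)⁻¹ ^ 2 ≤ exp M ^ 2 := pow_le_pow_left₀ (by positivity) e3 2
            _ = exp (2 * M) := by rw [← exp_nat_mul]; push_cast; rfl
        rw [e1]
        have e4 : θ - τ ≤ 2 * π := by linarith [hτ.1, hθ.2]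
        calc (θ - τ) * (1 / 4 * (|scalCurv 4 u τ t - scalCurvAvg 4 u t| * ((u τ t)⁻¹ ^ 2 * (u τ t)⁻¹)))
            ≤ 2 * π * (1 / 4 * (|scalCurv 4 u τ t - scalCurvAvg 4 u t| *
              (exp (2 * M) * (u τ t)⁻¹))) := by
              refine mul_le_mul e4 ?_ (by positivity) (by positivity)
              gcongr
          _ = _ := by ring
      refine b1.trans ?_
      rw [intervalIntegral.integral_const_mul]
      refine mul_le_mul_of_nonneg_left ?_ (by positivity)
      have cf : Continuous fun τ => |scalCurv 4 u τ t - scalCurvAvg 4 u t| * (u τ t)⁻¹ := by fun_prop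
      have b2 : ∫ τ in a..θ, |scalCurv 4 u τ t - scalCurvAvg 4 u t| * (u τ t)⁻¹
          ≤ ∫ τ in a..(a + 2 * π), |scalCurv 4 u τ t - scalCurvAvg 4 u t| * (u τ t)⁻¹ :=
        intervalIntegral.integral_mono_interval le_rfl hθ.1 hθ.2
          (Eventually.of_forall fun τ => mul_nonneg (abs_nonneg _) (inv_pos.2 (h0.pos τ t)).le)
          (cf.intervalIntegrable _ _)
      refine b2.trans ?_
      rw [integral_periodic_shift (fun x => by simp only [h0.curv_per, h0.per])]
      refine Real.le_sqrt_of_sq_le ?_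
      have b3 := sq_integral_abs_le cf
      refine (le_of_eq ?_).trans (b3.trans_eq ?_)
      · congr 2
        funext τ
        rw [abs_of_nonneg (mul_nonneg (abs_nonneg _) (inv_pos.2 (h0.pos τ t)).le)]
      · congr 1
        rw [oscCurv, (h (t + 1)).avgCurv_eq t0 htT]
        congr 1
        funext τ
        rw [mul_pow, sq_abs, inv_pow]
        rfl
    · refine intervalIntegral.tendsto_integral_filter_of_dominated_convergence
        (fun _ => 2 * π * (1 / 4 * ((‖c‖ + 1) * exp M ^ 3 + exp M))) ?_ ?_ (by simp) ?_
      · refine Eventually.of_forall fun t => ?_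
        have c1 := h0.smooth.cont_x t
        have c3 := (h0.smooth_inv 3).cont_x t
        exact Continuous.aestronglyMeasurable (by fun_prop)
      · filter_upwards [eventually_ge_atTop t₁,
          hc.norm.eventually (ge_mem_nhds (lt_add_one ‖c‖))] with t ht hct
        refine Eventually.of_forall fun τ hτ => ?_
        rw [uIoc_of_le hθ.1] at hτ
        have hp := h0.pos τ t
        have e3 : (u τ t)⁻¹ ≤ exp M := by
          rw [← inv_inv (exp M), ← exp_neg]
          exact inv_anti₀ (exp_pos _) (huge τ t ht)
        have e5 : (u τ t ^ 3)⁻¹ ≤ exp M ^ 3 := by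
          rw [← inv_pow]
          exact pow_le_pow_left₀ (by positivity) e3 3
        have e4 : θ - τ ≤ 2 * π := by linarith [hτ.1, hθ.2]
        have e6 : ‖scalCurvAvg 4 u t * (u τ t ^ 3)⁻¹ - u τ t‖ ≤ (‖c‖ + 1) * exp M ^ 3 + exp M := by
          refine (norm_sub_le _ _).trans (add_le_add ?_ ?_)
          · rw [norm_mul, Real.norm_of_nonneg (show 0 ≤ (u τ t ^ 3)⁻¹ by positivity)]
            exact mul_le_mul hct e5 (by positivity) (by positivity)
          · rw [Real.norm_of_nonneg hp.le]
            exact hule τ t ht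
        rw [norm_mul, norm_mul, Real.norm_of_nonneg (show 0 ≤ θ - τ by linarith [hτ.2]),
          Real.norm_of_nonneg (show (0:ℝ) ≤ 1 / 4 by norm_num)]
        exact mul_le_mul e4 (mul_le_mul_of_nonneg_left e6 (by norm_num)) (by positivity)
          (by positivity)
      · refine Eventually.of_forall fun τ _ => ?_
        have e1 := ((hUlim τ).pow 3).inv₀ (pow_pos (hUpos τ) 3).ne'
        exact (((hc.mul e1).sub (hUlim τ)).const_mul _).const_mul _
  have htay : ∀ a θ t, u θ t = u a t + dx u a t * (θ - a) + ∫ τ in a..θ, (θ - τ) * dx (dx u) τ t :=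
    fun a θ t => taylor_two (fun x => h0.smooth.hasDerivAt_x x t)
      (fun x => h0.smooth.dx.hasDerivAt_x x t) (h0.smooth.dx.dx.cont_x t) a θ
  have hb : ∀ a, ∃ b, Tendsto (fun t => dx u a t) atTop (𝓝 b) := by
    intro a
    have h1 := hconv a (a + 2 * π) ⟨by linarith, le_rfl⟩
    refine ⟨_, (h1.const_mul (-(2 * π)⁻¹)).congr fun t => ?_⟩
    have h2 := htay a (a + 2 * π) t
    rw [h0.per] at h2
    have h3 : ∫ τ in a..(a + 2 * π), (a + 2 * π - τ) * dx (dx u) τ t = -(dx u a t * (2 * π)) := by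
      linear_combination -h2
    rw [h3]
    field_simp
  choose b hb using hb
  have hUeq : ∀ a θ, θ ∈ Icc a (a + 2 * π) →
      U θ = U a + b a * (θ - a) + ∫ τ in a..θ, (θ - τ) * g τ := fun a θ hθ =>
    tendsto_nhds_unique (hUlim θ) ((((hUlim a).add ((hb a).mul_const _)).add
      (hconv a θ hθ)).congr fun t => (htay a θ t).symm)
  have hG : ∀ a θ, HasDerivAt (fun θ => ∫ τ in a..θ, g τ) (g θ) θ := fun a θ =>
    intervalIntegral.integral_hasDerivAt_right (hgc.intervalIntegrable _ _)
      (hgc.stronglyMeasurableAtFilter _ _) hgc.continuousAt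
  have hG' : ∀ a θ, HasDerivAt (fun θ => ∫ τ in a..θ, τ * g τ) (θ * g θ) θ := fun a θ =>
    intervalIntegral.integral_hasDerivAt_right (Continuous.intervalIntegrable (by fun_prop) _ _)
      (Continuous.stronglyMeasurableAtFilter (by fun_prop) _ _)
      (Continuous.continuousAt (by fun_prop))
  have hU1 : ∀ a θ, θ ∈ Ioo a (a + 2 * π) → HasDerivAt U (b a + ∫ τ in a..θ, g τ) θ := by
    intro a θ hθ
    have h1 : HasDerivAt (fun θ => U a + b a * (θ - a) + (θ * (∫ τ in a..θ, g τ)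
        - ∫ τ in a..θ, τ * g τ)) (b a + ∫ τ in a..θ, g τ) θ :=
      (((((hasDerivAt_id θ).sub_const a).const_mul (b a)).const_add (U a)).add
        (((hasDerivAt_id θ).mul (hG a θ)).sub (hG' a θ))).congr_deriv (by simp only [id]; ring)
    refine h1.congr_of_eventuallyEq ?_
    filter_upwards [Ioo_mem_nhds hθ.1 hθ.2] with x hx
    rw [hUeq a x ⟨hx.1.le, hx.2.le⟩, ← intervalIntegral.integral_const_mul,
      ← intervalIntegral.integral_sub (Continuous.intervalIntegrable (by fun_prop) _ _)
      (Continuous.intervalIntegrable (by fun_prop) _ _)]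
    simp only [sub_mul]
  have hU1' : ∀ θ, HasDerivAt U (deriv U θ) θ := fun θ =>
    (hU1 (θ - π) θ ⟨by linarith, by linarith⟩).differentiableAt.hasDerivAt
  have hU2 : ∀ θ, HasDerivAt (deriv U) (g θ) θ := by
    intro θ
    refine ((hG (θ - π) θ).const_add (b (θ - π))).congr_of_eventuallyEq ?_
    filter_upwards [Ioo_mem_nhds (show θ - π < θ by linarith) (show θ < θ - π + 2 * π by linarith)]
      with x hx
    exact (hU1 _ x hx).deriv
  obtain ⟨C₂, hC20, hC₂⟩ := exists_bound_of_continuous₂ (f := fun θ t => u θ t - U θ)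
    (h0.smooth.continuous.sub (hUcont.comp continuous_fst)) 0 (2 * π) 0 t₁
  have hC₂' : ∀ θ t, 0 ≤ t → t ≤ t₁ → |u θ t - U θ| ≤ C₂ := by
    intro θ t h1 h2
    obtain ⟨x, hx, hxe⟩ := Function.Periodic.exists_mem_Ico₀ (f := fun θ => u θ t - U θ)
      (fun θ => by simp only [h0.per, hUper]) two_pi_pos θ
    rw [hxe]
    exact hC₂ x ⟨hx.1, hx.2.le⟩ t ⟨h1, h2⟩
  refine ⟨U, exp M * C₁ + C₂ * exp (1 / 4 * t₁), 1 / 4, by positivity, by norm_num,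
    contDiff_of_second_order hUpos hU1' hU2, hUper, hUpos, fun t ht θ => ?_, c, fun θ => ?_⟩
  · rcases le_total t₁ t with h1 | h1
    · refine (hrate θ t h1).trans (mul_le_mul_of_nonneg_right ?_ (exp_pos _).le)
      have : 0 ≤ C₂ * exp (1 / 4 * t₁) := by positivity
      linarith
    · refine (hC₂' θ t ht h1).trans ?_
      have e1 : 1 ≤ exp (1 / 4 * t₁) * exp (-(1 / 4) * t) := by
        rw [← exp_add]
        exact one_le_exp (by linarith)
      have e2 := mul_le_mul_of_nonneg_left e1 hC20
      have e3 : 0 ≤ exp M * C₁ * exp (-(1 / 4) * t) := by positivity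
      linarith
  · rw [(hU2 θ).deriv]
    have := (hUpos θ).ne'
    simp only [hg]
    field_simp
    ring

end Limit

section Convolution

variable {A : Type*} [NormedRing A]

/-- Convolution of two-sided sequences. -/
noncomputable def conv (a b : ℤ → A) (n : ℤ) : A := ∑' m, a m * b (n - m)

theorem summable_conv_prod {a b : ℤ → ℝ} (ha : Summable a) (hb : Summable b)
    (ha0 : ∀ n, 0 ≤ a n) (hb0 : ∀ n, 0 ≤ b n) :
    Summable fun p : ℤ × ℤ => a p.2 * b (p.1 - p.2) := by
  have h := ha.mul_of_nonneg hb ha0 hb0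
  let e : ℤ × ℤ ≃ ℤ × ℤ :=
    { toFun := fun p => (p.2, p.1 - p.2)
      invFun := fun p => (p.1 + p.2, p.1)
      left_inv := fun p => by ext <;> simp
      right_inv := fun p => by ext <;> simp }
  exact (e.summable_iff (f := fun x : ℤ × ℤ => a x.1 * b x.2)).2 h

theorem tsum_conv_prod {a b : ℤ → ℝ} :
    ∑' p : ℤ × ℤ, a p.2 * b (p.1 - p.2) = ∑' p : ℤ × ℤ, a p.1 * b p.2 := by
  let e : ℤ × ℤ ≃ ℤ × ℤ :=
    { toFun := fun p => (p.2, p.1 - p.2)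
      invFun := fun p => (p.1 + p.2, p.1)
      left_inv := fun p => by ext <;> simp
      right_inv := fun p => by ext <;> simp }
  exact e.tsum_eq (fun x : ℤ × ℤ => a x.1 * b x.2)

theorem summable_conv_term {a b : ℤ → ℝ} (ha : Summable a) (hb : Summable b)
    (ha0 : ∀ n, 0 ≤ a n) (hb0 : ∀ n, 0 ≤ b n) (n : ℤ) : Summable fun m => a m * b (n - m) :=
  (summable_conv_prod ha hb ha0 hb0).prod_factor n

theorem summable_conv {a b : ℤ → ℝ} (ha : Summable a) (hb : Summable b)
    (ha0 : ∀ n, 0 ≤ a n) (hb0 : ∀ n, 0 ≤ b n) : Summable (conv a b) :=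
  (summable_conv_prod ha hb ha0 hb0).prod

theorem tsum_conv {a b : ℤ → ℝ} (ha : Summable a) (hb : Summable b)
    (ha0 : ∀ n, 0 ≤ a n) (hb0 : ∀ n, 0 ≤ b n) :
    ∑' n, conv a b n = (∑' n, a n) * ∑' n, b n := by
  rw [ha.tsum_mul_tsum hb (ha.mul_of_nonneg hb ha0 hb0), ← tsum_conv_prod]
  exact ((summable_conv_prod ha hb ha0 hb0).tsum_prod).symm

theorem conv_nonneg {a b : ℤ → ℝ} (ha0 : ∀ n, 0 ≤ a n) (hb0 : ∀ n, 0 ≤ b n) (n : ℤ) :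
    0 ≤ conv a b n := tsum_nonneg fun m => mul_nonneg (ha0 m) (hb0 _)

variable {a b : ℤ → A} {α β : ℤ → ℝ}

theorem summable_norm_conv_term (hα : Summable α) (hβ : Summable β)
    (ha : ∀ n, ‖a n‖ ≤ α n) (hb : ∀ n, ‖b n‖ ≤ β n) (n : ℤ) :
    Summable fun m => ‖a m * b (n - m)‖ :=
  Summable.of_nonneg_of_le (fun _ => norm_nonneg _)
    (fun m => (norm_mul_le _ _).trans
      (mul_le_mul (ha m) (hb _) (norm_nonneg _) ((norm_nonneg _).trans (ha m))))
    (summable_conv_term hα hβ (fun n => (norm_nonneg _).trans (ha n))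
      (fun n => (norm_nonneg _).trans (hb n)) n)

theorem norm_conv_le (hα : Summable α) (hβ : Summable β)
    (ha : ∀ n, ‖a n‖ ≤ α n) (hb : ∀ n, ‖b n‖ ≤ β n) (n : ℤ) : ‖conv a b n‖ ≤ conv α β n := by
  have h1 := summable_norm_conv_term hα hβ ha hb n
  refine (norm_tsum_le_tsum_norm h1).trans (h1.tsum_le_tsum (fun m => ?_)
    (summable_conv_term hα hβ (fun n => (norm_nonneg _).trans (ha n))
      (fun n => (norm_nonneg _).trans (hb n)) n))
  exact (norm_mul_le _ _).trans
    (mul_le_mul (ha m) (hb _) (norm_nonneg _) ((norm_nonneg _).trans (ha m)))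

/-- The polynomial weight. -/
noncomputable def wt (k : ℕ) (n : ℤ) : ℝ := (1 + |(n : ℝ)|) ^ k

theorem wt_pos (k : ℕ) (n : ℤ) : 0 < wt k n := by unfold wt; positivity

theorem one_le_wt (k : ℕ) (n : ℤ) : 1 ≤ wt k n :=
  one_le_pow₀ (by linarith [abs_nonneg (n : ℝ)])

theorem wt_add (k l : ℕ) (n : ℤ) : wt (k + l) n = wt k n * wt l n := pow_add _ _ _

theorem wt_le_mul (k : ℕ) (m n : ℤ) : wt k n ≤ wt k m * wt k (n - m) := by
  rw [wt, wt, wt, ← mul_pow]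
  refine pow_le_pow_left₀ (by positivity) ?_ k
  have h1 : |(n : ℝ)| ≤ |(m : ℝ)| + |((n - m : ℤ) : ℝ)| := by
    have := abs_add_le (m : ℝ) ((n - m : ℤ) : ℝ)
    push_cast at this ⊢
    rwa [add_sub_cancel] at this
  nlinarith [abs_nonneg (m : ℝ), abs_nonneg ((n - m : ℤ) : ℝ)]

theorem summable_of_wt {k : ℕ} (h0 : ∀ n, 0 ≤ α n) (h : Summable fun n => wt k n * α n) :
    Summable α :=
  Summable.of_nonneg_of_le h0 (fun n => le_mul_of_one_le_left (h0 n) (one_le_wt k n)) h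

theorem summable_wt_conv {k : ℕ} (hα : Summable fun n => wt k n * α n)
    (hβ : Summable fun n => wt k n * β n) (ha0 : ∀ n, 0 ≤ α n) (hb0 : ∀ n, 0 ≤ β n) :
    Summable fun n => wt k n * conv α β n := by
  have ha1 := fun n => mul_nonneg (wt_pos k n).le (ha0 n)
  have hb1 := fun n => mul_nonneg (wt_pos k n).le (hb0 n)
  refine Summable.of_nonneg_of_le
    (fun n => mul_nonneg (wt_pos k n).le (conv_nonneg ha0 hb0 n)) (fun n => ?_)
    (summable_conv hα hβ ha1 hb1)
  rw [conv, ← tsum_mul_left]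
  have s := summable_conv_term (summable_of_wt ha0 hα) (summable_of_wt hb0 hβ) ha0 hb0 n
  refine (s.mul_left (wt k n)).tsum_le_tsum (fun m => ?_) (summable_conv_term hα hβ ha1 hb1 n)
  calc wt k n * (α m * β (n - m)) ≤ (wt k m * wt k (n - m)) * (α m * β (n - m)) :=
        mul_le_mul_of_nonneg_right (wt_le_mul k m n) (mul_nonneg (ha0 m) (hb0 _))
    _ = wt k m * α m * (wt k (n - m) * β (n - m)) := by ring

end Convolution

section SequenceSpace

variable {A : Type*} [NormedRing A]

/-- Absolutely summable two-sided sequences. -/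
abbrev Ell (A : Type*) [NormedRing A] := lp (fun _ : ℤ => A) 1

theorem memEll_iff {a : ℤ → A} : Memℓp a 1 ↔ Summable fun n => ‖a n‖ := by
  rw [memℓp_gen_iff (by simp)]
  simp

theorem ell_summable (a : Ell A) : Summable fun n => ‖a n‖ := memEll_iff.1 (lp.memℓp a)

theorem ell_norm_eq (a : Ell A) : ‖a‖ = ∑' n, ‖a n‖ := by
  rw [lp.norm_eq_tsum_rpow (by simp)]
  simp

/-- The absolutely summable sequence with given terms. -/
def ellMk (a : ℤ → A) (h : Summable fun n => ‖a n‖) : Ell A := ⟨a, memEll_iff.2 h⟩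

theorem ell_norm_le (a b : Ell A) (c : ℝ) (h : ∀ n, ‖a n‖ ≤ c * ‖b n‖) : ‖a‖ ≤ c * ‖b‖ := by
  rw [ell_norm_eq, ell_norm_eq, ← tsum_mul_left]
  exact (ell_summable a).tsum_le_tsum h ((ell_summable b).mul_left c)

/-- Convolution of absolutely summable sequences. -/
noncomputable def ellConv (a b : Ell A) : Ell A :=
  ellMk (conv (a : ℤ → A) b) (Summable.of_nonneg_of_le (fun _ => norm_nonneg _)
    (norm_conv_le (ell_summable a) (ell_summable b) (fun _ => le_rfl) fun _ => le_rfl)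
    (summable_conv (ell_summable a) (ell_summable b) (fun _ => norm_nonneg _) fun _ => norm_nonneg _))

theorem norm_ellConv_le (a b : Ell A) : ‖ellConv a b‖ ≤ ‖a‖ * ‖b‖ := by
  rw [ell_norm_eq, ell_norm_eq, ell_norm_eq, ← tsum_conv (ell_summable a) (ell_summable b)
    (fun _ => norm_nonneg _) fun _ => norm_nonneg _]
  exact (ell_summable (ellConv a b)).tsum_le_tsum
    (norm_conv_le (ell_summable a) (ell_summable b) (fun _ => le_rfl) fun _ => le_rfl)
    (summable_conv (ell_summable a) (ell_summable b) (fun _ => norm_nonneg _) fun _ => norm_nonneg _)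

variable [CompleteSpace A]

theorem ellConv_term_summable (a b : Ell A) (n : ℤ) : Summable fun m => a m * b (n - m) :=
  (summable_norm_conv_term (ell_summable a) (ell_summable b) (fun _ => le_rfl) (fun _ => le_rfl) n).of_norm

theorem ellConv_sub (a b a' b' : Ell A) :
    ellConv a b - ellConv a' b' = ellConv (a - a') b + ellConv a' (b - b') := by
  ext n
  change (∑' m, a m * b (n - m)) - ∑' m, a' m * b' (n - m) =
    (∑' m, (a - a') m * b (n - m)) + ∑' m, a' m * (b - b') (n - m)
  rw [← (ellConv_term_summable a b n).tsum_sub (ellConv_term_summable a' b' n),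
    ← (ellConv_term_summable (a - a') b n).tsum_add (ellConv_term_summable a' (b - b') n)]
  congr 1
  ext m
  simp only [lp.coeFn_sub, Pi.sub_apply]
  noncomm_ring

/-- Bounded and Lipschitz on bounded sets. -/
def LocLip {X Y : Type*} [NormedAddCommGroup X] [NormedAddCommGroup Y] (f : X → Y) : Prop :=
  ∀ ρ : ℝ, ∃ L : ℝ, 0 ≤ L ∧ (∀ a, ‖a‖ ≤ ρ → ‖f a‖ ≤ L) ∧
    ∀ a b, ‖a‖ ≤ ρ → ‖b‖ ≤ ρ → ‖f a - f b‖ ≤ L * ‖a - b‖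

section LocLip

variable {X Y Z : Type*} [NormedAddCommGroup X] [NormedAddCommGroup Y] [NormedAddCommGroup Z]

theorem LocLip.of_additive {g : X → Y} (C : ℝ) (hs : ∀ a b, g (a - b) = g a - g b)
    (hn : ∀ a, ‖g a‖ ≤ C * ‖a‖) : LocLip g := by
  intro ρ
  refine ⟨|C| * (1 + |ρ|), by positivity, fun a ha => ?_, fun a b _ _ => ?_⟩
  · calc ‖g a‖ ≤ C * ‖a‖ := hn a
      _ ≤ |C| * ‖a‖ := by gcongr; exact le_abs_self C
      _ ≤ |C| * (1 + |ρ|) := by gcongr; linarith [le_abs_self ρ]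
  · rw [← hs]
    calc ‖g (a - b)‖ ≤ C * ‖a - b‖ := hn _
      _ ≤ |C| * 1 * ‖a - b‖ := by rw [mul_one]; gcongr; exact le_abs_self C
      _ ≤ |C| * (1 + |ρ|) * ‖a - b‖ := by gcongr; linarith [abs_nonneg ρ]

theorem LocLip.comp {g : Y → Z} {f : X → Y} (hg : LocLip g) (hf : LocLip f) :
    LocLip fun a => g (f a) := by
  intro ρ
  obtain ⟨L, hL, h1, h2⟩ := hf ρ
  obtain ⟨L', hL', h1', h2'⟩ := hg L
  refine ⟨max L' (L' * L), le_max_of_le_left hL', fun a ha => le_max_of_le_left (h1' _ (h1 a ha)),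
    fun a b ha hb => ?_⟩
  calc _ ≤ L' * ‖f a - f b‖ := h2' _ _ (h1 a ha) (h1 b hb)
    _ ≤ L' * (L * ‖a - b‖) := by gcongr; exact h2 a b ha hb
    _ = L' * L * ‖a - b‖ := by ring
    _ ≤ _ := by gcongr; exact le_max_right _ _

theorem LocLip.add {f g : X → Y} (hf : LocLip f) (hg : LocLip g) : LocLip fun a => f a + g a := by
  intro ρ
  obtain ⟨L, hL, h1, h2⟩ := hf ρ
  obtain ⟨L', hL', h1', h2'⟩ := hg ρ
  refine ⟨L + L', by positivity, fun a ha => norm_add_le_of_le (h1 a ha) (h1' a ha),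
    fun a b ha hb => ?_⟩
  rw [add_sub_add_comm, add_mul]
  exact norm_add_le_of_le (h2 a b ha hb) (h2' a b ha hb)

theorem LocLip.conv {f g : X → Ell A} (hf : LocLip f) (hg : LocLip g) :
    LocLip fun a => ellConv (f a) (g a) := by
  intro ρ
  obtain ⟨L, hL, h1, h2⟩ := hf ρ
  obtain ⟨L', hL', h1', h2'⟩ := hg ρ
  refine ⟨2 * (L * L'), by positivity, fun a ha => ?_, fun a b ha hb => ?_⟩
  · have : 0 ≤ L * L' := by positivity
    calc _ ≤ ‖f a‖ * ‖g a‖ := norm_ellConv_le _ _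
      _ ≤ L * L' := by gcongr; exacts [h1 a ha, h1' a ha]
      _ ≤ _ := by linarith
  · rw [ellConv_sub]
    refine (norm_add_le _ _).trans ?_
    have e1 : ‖ellConv (f a - f b) (g a)‖ ≤ L * ‖a - b‖ * L' :=
      (norm_ellConv_le _ _).trans (by gcongr; exacts [h2 a b ha hb, h1' a ha])
    have e2 : ‖ellConv (f b) (g a - g b)‖ ≤ L * (L' * ‖a - b‖) :=
      (norm_ellConv_le _ _).trans (by gcongr; exacts [h1 b hb, h2' a b ha hb])
    linarith

end LocLip

/-- A contraction argument: small locally Lipschitz perturbations of a point have fixed points. -/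
theorem exists_fixedPoint_of_small {X : Type*} [NormedAddCommGroup X] [CompleteSpace X]
    {M L ε : ℝ} {c : X} {Φ : X → X} (hc : ‖c‖ ≤ M)
    (hε : ε * L ≤ 1 / 2)
    (h1 : ∀ a, ‖a‖ ≤ M + 1 → ‖Φ a - c‖ ≤ ε * L)
    (h2 : ∀ a b, ‖a‖ ≤ M + 1 → ‖b‖ ≤ M + 1 → ‖Φ a - Φ b‖ ≤ ε * (L * ‖a - b‖)) :
    ∃ a, Φ a = a := by
  have hs : IsComplete (Metric.closedBall (0 : X) (M + 1)) := Metric.isClosed_closedBall.isComplete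
  have hm : MapsTo Φ (Metric.closedBall (0 : X) (M + 1)) (Metric.closedBall (0 : X) (M + 1)) := by
    intro a ha
    rw [mem_closedBall_zero_iff] at ha ⊢
    calc ‖Φ a‖ = ‖(Φ a - c) + c‖ := by rw [sub_add_cancel]
      _ ≤ ε * L + M := norm_add_le_of_le (h1 a ha) hc
      _ ≤ M + 1 := by linarith
  have hM : 0 ≤ M := (norm_nonneg _).trans hc
  have hk : ContractingWith (1 / 2) (hm.restrict Φ _ _) := by
    refine ⟨NNReal.half_lt_self one_ne_zero, LipschitzWith.of_dist_le_mul ?_⟩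
    rintro ⟨a, ha⟩ ⟨b, hb⟩
    rw [mem_closedBall_zero_iff] at ha hb
    change dist (Φ a) (Φ b) ≤ _ * dist a b
    rw [dist_eq_norm, dist_eq_norm]
    have h3 : ((1 / 2 : NNReal) : ℝ) = 1 / 2 := by norm_num
    rw [h3]
    calc _ ≤ ε * (L * ‖a - b‖) := h2 a b ha hb
      _ = ε * L * ‖a - b‖ := by ring
      _ ≤ _ := by gcongr
  obtain ⟨y, _, hy, _⟩ := hk.exists_fixedPoint' (x := 0) hs hm
    (by rw [mem_closedBall_zero_iff, norm_zero]; linarith) (edist_ne_top _ _)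
  exact ⟨y, hy⟩

end SequenceSpace

theorem hasFDerivAt_of_partials {E : Type*} [NormedAddCommGroup E] [NormedSpace ℝ E]
    {f f₁ f₂ : ℝ → ℝ → E} (h₁ : ∀ x t, HasDerivAt (fun y => f y t) (f₁ x t) x)
    (h₂ : ∀ x t, HasDerivAt (fun s => f x s) (f₂ x t) t)
    (c₁ : Continuous fun p : ℝ × ℝ => f₁ p.1 p.2) (c₂ : Continuous fun p : ℝ × ℝ => f₂ p.1 p.2)
    (p : ℝ × ℝ) : HasFDerivAt (fun p : ℝ × ℝ => f p.1 p.2)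
      ((ContinuousLinearMap.fst ℝ ℝ ℝ).smulRight (f₁ p.1 p.2) +
        (ContinuousLinearMap.snd ℝ ℝ ℝ).smulRight (f₂ p.1 p.2)) p := by
  have hs := (hasStrictFDerivAt_uncurry_coprod (u := p) (f := f)
    (f₁ := fun x t => (ContinuousLinearMap.id ℝ ℝ).smulRight (f₁ x t))
    (f₂ := fun x t => (ContinuousLinearMap.id ℝ ℝ).smulRight (f₂ x t))
    (Eventually.of_forall fun v => (h₁ v.1 v.2).hasFDerivAt.congr_fderiv (by ext; simp [Function.HasUncurry.uncurry]))
    (Eventually.of_forall fun v => (h₂ v.1 v.2).hasFDerivAt.congr_fderiv (by ext; simp [Function.HasUncurry.uncurry]))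
    (Continuous.continuousAt (by
      simp only [Function.HasUncurry.uncurry, id]
      fun_prop))
    (Continuous.continuousAt (by
      simp only [Function.HasUncurry.uncurry, id]
      fun_prop))).hasFDerivAt
  refine hs.congr_fderiv ?_
  ext <;> simp [Function.HasUncurry.uncurry]

/-- Continuous time-dependent coefficients with uniformly rapid decay. -/
structure RapidBound (a : ℤ → ℝ → ℂ) : Prop where
  cont : ∀ n, Continuous (a n)
  bound : ∃ B : ℤ → ℝ, (∀ k, Summable fun n => wt k n * B n) ∧ ∀ n t, ‖a n t‖ ≤ B n

/-- Coefficients with `j` rapidly decaying time derivatives. -/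
def Rap : ℕ → (ℤ → ℝ → ℂ) → Prop
  | 0, a => RapidBound a
  | j + 1, a => RapidBound a ∧ ∃ b : ℤ → ℝ → ℂ, (∀ n t, HasDerivAt (a n) (b n t) t) ∧ Rap j b

/-- Pointwise-in-time convolution. -/
noncomputable def tconv (a b : ℤ → ℝ → ℂ) (n : ℤ) (t : ℝ) : ℂ :=
  conv (fun m => a m t) (fun m => b m t) n

/-- Coefficients of the complex conjugate. -/
noncomputable def tstar (a : ℤ → ℝ → ℂ) (n : ℤ) (t : ℝ) : ℂ := (starRingEnd ℂ) (a (-n) t)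

/-- Smooth functions all of whose derivatives are bounded. -/
def BddSmooth (f : ℝ → ℝ) : Prop := ContDiff ℝ ∞ f ∧ ∀ i, ∃ C, ∀ x, |iteratedDeriv i f x| ≤ C

variable {a b : ℤ → ℝ → ℂ}

theorem RapidBound.nonneg {a : ℤ → ℝ → ℂ} {B : ℤ → ℝ} (h : ∀ n t, ‖a n t‖ ≤ B n) (n : ℤ) :
    0 ≤ B n := (norm_nonneg _).trans (h n 0)

theorem summable_of_wt_all {B : ℤ → ℝ} (h : ∀ k, Summable fun n => wt k n * B n) : Summable B := by
  simpa [wt] using h 0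

theorem RapidBound.add (ha : RapidBound a) (hb : RapidBound b) :
    RapidBound fun n t => a n t + b n t := by
  obtain ⟨B, hB, h1⟩ := ha.bound
  obtain ⟨B', hB', h1'⟩ := hb.bound
  refine ⟨fun n => (ha.cont n).add (hb.cont n), fun n => B n + B' n, fun k => ?_,
    fun n t => norm_add_le_of_le (h1 n t) (h1' n t)⟩
  simp only [mul_add]
  exact (hB k).add (hB' k)

theorem RapidBound.coef_mul {m : ℤ → ℂ} {C : ℝ} {l : ℕ} (hm : ∀ n, ‖m n‖ ≤ C * wt l n)
    (ha : RapidBound a) : RapidBound fun n t => m n * a n t := by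
  obtain ⟨B, hB, h1⟩ := ha.bound
  refine ⟨fun n => continuous_const.mul (ha.cont n), fun n => C * wt l n * B n, fun k => ?_,
    fun n t => ?_⟩
  · refine ((hB (k + l)).mul_left C).congr fun n => ?_
    rw [wt_add]
    ring
  · rw [norm_mul]
    exact mul_le_mul (hm n) (h1 n t) (norm_nonneg _) ((norm_nonneg _).trans (hm n))

theorem RapidBound.fun_mul {χ : ℝ → ℝ} (hχ : Continuous χ) {C : ℝ} (hC : ∀ x, |χ x| ≤ C)
    (ha : RapidBound a) : RapidBound fun n t => (χ t : ℂ) * a n t := by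
  obtain ⟨B, hB, h1⟩ := ha.bound
  refine ⟨fun n => (Complex.continuous_ofReal.comp hχ).mul (ha.cont n), fun n => C * B n,
    fun k => ?_, fun n t => ?_⟩
  · refine ((hB k).mul_left C).congr fun n => ?_
    ring
  · rw [norm_mul, Complex.norm_real]
    exact mul_le_mul (hC t) (h1 n t) (norm_nonneg _) ((abs_nonneg _).trans (hC t))

theorem RapidBound.star (ha : RapidBound a) : RapidBound (tstar a) := by
  obtain ⟨B, hB, h1⟩ := ha.bound
  refine ⟨fun n => Complex.continuous_conj.comp (ha.cont _), fun n => B (-n), fun k => ?_,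
    fun n t => ?_⟩
  · refine ((Equiv.neg ℤ).summable_iff.2 (hB k)).congr fun n => ?_
    simp [wt]
  · rw [tstar, RCLike.norm_conj]
    exact h1 _ _

theorem RapidBound.conv (ha : RapidBound a) (hb : RapidBound b) : RapidBound (tconv a b) := by
  obtain ⟨B, hB, h1⟩ := ha.bound
  obtain ⟨B', hB', h1'⟩ := hb.bound
  have s := summable_of_wt_all hB
  have s' := summable_of_wt_all hB'
  refine ⟨fun n => ?_, YamabeFlow.conv B B', fun k => summable_wt_conv (hB k) (hB' k)
    (RapidBound.nonneg h1) (RapidBound.nonneg h1'), fun n t => ?_⟩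
  · refine continuous_tsum (fun m => (ha.cont m).mul (hb.cont (n - m)))
      (summable_conv_term s s' (RapidBound.nonneg h1) (RapidBound.nonneg h1') n) fun m t => ?_
    exact (norm_mul_le _ _).trans
      (mul_le_mul (h1 _ _) (h1' _ _) (norm_nonneg _) (RapidBound.nonneg h1 m))
  · exact norm_conv_le s s' (fun m => h1 m t) (fun m => h1' m t) n

theorem RapidBound.hasDerivAt_conv {a' b' : ℤ → ℝ → ℂ} (ha : RapidBound a) (hb : RapidBound b)
    (ha' : RapidBound a') (hb' : RapidBound b') (hda : ∀ n t, HasDerivAt (a n) (a' n t) t)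
    (hdb : ∀ n t, HasDerivAt (b n) (b' n t) t) (n : ℤ) (t : ℝ) :
    HasDerivAt (tconv a b n) (tconv a' b n t + tconv a b' n t) t := by
  obtain ⟨A, hA, h1⟩ := ha.bound
  obtain ⟨A', hA', h2⟩ := ha'.bound
  obtain ⟨B, hB, h3⟩ := hb.bound
  obtain ⟨B', hB', h4⟩ := hb'.bound
  have sA := summable_of_wt_all hA
  have sA' := summable_of_wt_all hA'
  have sB := summable_of_wt_all hB
  have sB' := summable_of_wt_all hB'
  have e1 := summable_norm_conv_term sA' sB (a := fun m => a' m t) (b := fun m => b m t)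
    (fun m => h2 m t) (fun m => h3 m t) n
  have e2 := summable_norm_conv_term sA sB' (a := fun m => a m t) (b := fun m => b' m t)
    (fun m => h1 m t) (fun m => h4 m t) n
  have e3 := summable_norm_conv_term sA sB (a := fun m => a m t) (b := fun m => b m t)
    (fun m => h1 m t) (fun m => h3 m t) n
  have e : tconv a' b n t + tconv a b' n t
      = ∑' m, (a' m t * b (n - m) t + a m t * b' (n - m) t) :=
    (e1.of_norm.tsum_add e2.of_norm).symm
  rw [e]
  refine hasDerivAt_tsum (u := fun m => A' m * B (n - m) + A m * B' (n - m))
    ((summable_conv_term sA' sB (RapidBound.nonneg h2) (RapidBound.nonneg h3) n).add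
      (summable_conv_term sA sB' (RapidBound.nonneg h1) (RapidBound.nonneg h4) n))
    (fun m y => (hda m y).mul (hdb (n - m) y)) (fun m y => ?_) (y₀ := t) e3.of_norm t
  refine norm_add_le_of_le ?_ ?_
  · exact (norm_mul_le _ _).trans
      (mul_le_mul (h2 _ _) (h3 _ _) (norm_nonneg _) (RapidBound.nonneg h2 m))
  · exact (norm_mul_le _ _).trans
      (mul_le_mul (h1 _ _) (h4 _ _) (norm_nonneg _) (RapidBound.nonneg h1 m))

theorem BddSmooth.deriv {f : ℝ → ℝ} (h : BddSmooth f) : BddSmooth (deriv f) := by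
  refine ⟨(contDiff_infty_iff_deriv.1 h.1).2, fun i => ?_⟩
  obtain ⟨C, hC⟩ := h.2 (i + 1)
  exact ⟨C, fun x => by rw [← iteratedDeriv_succ']; exact hC x⟩

theorem BddSmooth.hasDerivAt {f : ℝ → ℝ} (h : BddSmooth f) (x : ℝ) :
    HasDerivAt f (_root_.deriv f x) x := (h.1.differentiable (by simp) x).hasDerivAt

theorem BddSmooth.bdd {f : ℝ → ℝ} (h : BddSmooth f) : ∃ C, ∀ x, |f x| ≤ C := by
  simpa using h.2 0

theorem BddSmooth.of_hasCompactSupport {f : ℝ → ℝ} (h : ContDiff ℝ ∞ f)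
    (hs : HasCompactSupport f) : BddSmooth f := by
  refine ⟨h, fun i => ?_⟩
  have hsi : HasCompactSupport (iteratedDeriv i f) := by
    induction i with
    | zero => simpa using hs
    | succ i ih => rw [iteratedDeriv_succ]; exact ih.deriv
  exact hsi.exists_bound_of_continuous
    (h.continuous_iteratedDeriv i (WithTop.coe_le_coe.2 (by exact_mod_cast le_top)))

namespace Rap

theorem rapidBound {j : ℕ} (h : Rap j a) : RapidBound a := by
  cases j with
  | zero => exact h
  | succ j => exact h.1

theorem pred {j : ℕ} (h : Rap (j + 1) a) : Rap j a := by
  induction j generalizing a with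
  | zero => exact h.1
  | succ j ih =>
    obtain ⟨h0, b, hb, hr⟩ := h
    exact ⟨h0, b, hb, ih hr⟩

theorem add {j : ℕ} (ha : Rap j a) (hb : Rap j b) : Rap j fun n t => a n t + b n t := by
  induction j generalizing a b with
  | zero => exact RapidBound.add ha hb
  | succ j ih =>
    obtain ⟨h0, a', ha', hr⟩ := ha
    obtain ⟨h0', b', hb', hr'⟩ := hb
    exact ⟨h0.add h0', fun n t => a' n t + b' n t, fun n t => (ha' n t).add (hb' n t), ih hr hr'⟩

theorem coef_mul {j : ℕ} {m : ℤ → ℂ} {C : ℝ} {l : ℕ} (hm : ∀ n, ‖m n‖ ≤ C * wt l n)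
    (ha : Rap j a) : Rap j fun n t => m n * a n t := by
  induction j generalizing a with
  | zero => exact RapidBound.coef_mul hm ha
  | succ j ih =>
    obtain ⟨h0, a', ha', hr⟩ := ha
    exact ⟨h0.coef_mul hm, fun n t => m n * a' n t, fun n t => (ha' n t).const_mul _, ih hr⟩

theorem fun_mul {j : ℕ} {χ : ℝ → ℝ} (hχ : BddSmooth χ) (ha : Rap j a) :
    Rap j fun n t => (χ t : ℂ) * a n t := by
  induction j generalizing a χ with
  | zero =>
    obtain ⟨C, hC⟩ := hχ.bdd
    exact RapidBound.fun_mul hχ.1.continuous hC ha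
  | succ j ih =>
    have hr0 := ha.pred
    obtain ⟨h0, a', ha', hr⟩ := ha
    obtain ⟨C, hC⟩ := hχ.bdd
    exact ⟨h0.fun_mul hχ.1.continuous hC, fun n t => ((deriv χ t : ℝ) : ℂ) * a n t + χ t * a' n t,
      fun n t => (hχ.hasDerivAt t).ofReal_comp.mul (ha' n t), (ih hχ.deriv hr0).add (ih hχ hr)⟩

theorem star {j : ℕ} (ha : Rap j a) : Rap j (tstar a) := by
  induction j generalizing a with
  | zero => exact RapidBound.star ha
  | succ j ih =>
    obtain ⟨h0, a', ha', hr⟩ := ha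
    exact ⟨h0.star, tstar a', fun n t => (ha' (-n) t).star, ih hr⟩

theorem conv {j : ℕ} (ha : Rap j a) (hb : Rap j b) : Rap j (tconv a b) := by
  induction j generalizing a b with
  | zero => exact RapidBound.conv ha hb
  | succ j ih =>
    have ha0 := ha.pred
    have hb0 := hb.pred
    obtain ⟨h0, a', ha', hr⟩ := ha
    obtain ⟨h0', b', hb', hr'⟩ := hb
    exact ⟨h0.conv h0', fun n t => tconv a' b n t + tconv a b' n t,
      RapidBound.hasDerivAt_conv h0 h0' hr.rapidBound hr'.rapidBound ha' hb',
      (ih hr hb0).add (ih ha0 hr')⟩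

end Rap

/-- The modified Duhamel operator. -/
noncomputable def duhamel (F χ : ℝ → ℝ) (h : ℤ → ℝ → ℂ) (n : ℤ) (t : ℝ) : ℂ :=
  ∫ σ in (0:ℝ)..t, (F (n ^ 2 * (t - σ)) * χ σ : ℝ) * h n σ

theorem continuous_duhamel {F χ : ℝ → ℝ} {h : ℤ → ℝ → ℂ} {n : ℤ} (hF : Continuous F)
    (hχ : Continuous χ) (hh : Continuous (h n)) : Continuous (duhamel F χ h n) := by
  refine intervalIntegral.continuous_parametric_intervalIntegral_of_continuous
    (f := fun t σ => ((F (n ^ 2 * (t - σ)) * χ σ : ℝ) : ℂ) * h n σ) ?_ continuous_id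
  simp only [Function.uncurry_def]
  fun_prop

theorem norm_integral_cutoff_le {g : ℝ → ℂ} {B δ : ℝ} (hg0 : ∀ σ, δ ≤ |σ| → g σ = 0)
    (hg : ∀ σ, ‖g σ‖ ≤ B) (hδ : 0 ≤ δ) (hc : Continuous g) (t : ℝ) :
    ‖∫ σ in (0:ℝ)..t, g σ‖ ≤ B * (2 * δ) := by
  have hs : Function.support g ⊆ Icc (-δ) δ := fun σ h => by
    by_contra hn
    exact h (hg0 σ (by
      by_contra! h2
      exact hn (abs_le.1 h2.le)))
  have hi : Integrable g := hc.integrable_of_hasCompactSupport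
    (HasCompactSupport.of_support_subset_isCompact isCompact_Icc hs)
  rw [intervalIntegral.norm_intervalIntegral_eq]
  calc ‖∫ σ in uIoc 0 t, g σ‖ ≤ ∫ σ in uIoc 0 t, ‖g σ‖ := norm_integral_le_integral_norm _
    _ ≤ ∫ σ, ‖g σ‖ := setIntegral_le_integral hi.norm (Eventually.of_forall fun _ => norm_nonneg _)
    _ = ∫ σ in Icc (-δ) δ, ‖g σ‖ := by
      rw [setIntegral_eq_integral_of_forall_compl_eq_zero]
      intro x hx
      by_contra hn
      exact hx (hs fun h => hn (by rw [h, norm_zero]))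
    _ ≤ ∫ σ in Icc (-δ) δ, B := by
      refine setIntegral_mono hi.norm.integrableOn ?_ hg
      exact integrableOn_const (by simp)
    _ = B * (2 * δ) := by
      rw [setIntegral_const]
      simp [Measure.real, hδ]
      ring

theorem hasDerivAt_duhamel {F χ : ℝ → ℝ} {h : ℤ → ℝ → ℂ} {n : ℤ} (hF : ContDiff ℝ ∞ F)
    (hχ : Continuous χ) (hh : Continuous (h n)) (t : ℝ) :
    HasDerivAt (duhamel F χ h n)
      ((F 0 : ℂ) * (χ t * h n t) + n ^ 2 * duhamel (deriv F) χ h n t) t := by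
  have hF' : Continuous (deriv F) := hF.continuous_deriv (by simp)
  have hFc := hF.continuous
  have hdF : ∀ x, HasDerivAt F (deriv F x) x := fun x => (hF.differentiable (by simp) x).hasDerivAt
  let I : ℝ → ℝ → ℂ := fun s y => ∫ σ in (0:ℝ)..y, (F (n ^ 2 * (s - σ)) * χ σ : ℝ) * h n σ
  let I₁ : ℝ → ℝ → ℂ := fun s y =>
    ∫ σ in (0:ℝ)..y, n ^ 2 * ((deriv F (n ^ 2 * (s - σ)) * χ σ : ℝ) * h n σ)
  let I₂ : ℝ → ℝ → ℂ := fun s y => (F (n ^ 2 * (s - y)) * χ y : ℝ) * h n y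
  have c1 : Continuous fun p : ℝ × ℝ => I₁ p.1 p.2 := by
    refine intervalIntegral.continuous_parametric_intervalIntegral_of_continuous
      (f := fun (p : ℝ × ℝ) σ => (n : ℂ) ^ 2 * (((deriv F (n ^ 2 * (p.1 - σ)) * χ σ : ℝ) : ℂ) * h n σ))
      ?_ continuous_snd
    simp only [Function.uncurry_def]
    fun_prop
  have c2 : Continuous fun p : ℝ × ℝ => I₂ p.1 p.2 := by
    simp only [I₂]
    fun_prop
  have d2 : ∀ s y, HasDerivAt (fun y => I s y) (I₂ s y) y := fun s y => by
    have hc : Continuous fun σ => ((F (n ^ 2 * (s - σ)) * χ σ : ℝ) : ℂ) * h n σ := by fun_prop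
    exact intervalIntegral.integral_hasDerivAt_right (hc.intervalIntegrable _ _)
      (hc.stronglyMeasurableAtFilter _ _) hc.continuousAt
  have d1 : ∀ s y, HasDerivAt (fun s => I s y) (I₁ s y) s := fun s y => by
    have hcb : Continuous fun p : ℝ × ℝ =>
        (n : ℂ) ^ 2 * (((deriv F (n ^ 2 * (p.1 - p.2)) * χ p.2 : ℝ) : ℂ) * h n p.2) := by fun_prop
    obtain ⟨C, hC⟩ := ((isCompact_Icc (a := s - 1) (b := s + 1)).prod
      (isCompact_uIcc (a := 0) (b := y))).exists_bound_of_continuousOn hcb.continuousOn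
    refine (intervalIntegral.hasDerivAt_integral_of_dominated_loc_of_deriv_le
      (F := fun s σ => ((F (n ^ 2 * (s - σ)) * χ σ : ℝ) : ℂ) * h n σ)
      (F' := fun s σ => (n : ℂ) ^ 2 * (((deriv F (n ^ 2 * (s - σ)) * χ σ : ℝ) : ℂ) * h n σ))
      (bound := fun _ => C)
      (s := Icc (s - 1) (s + 1)) (Icc_mem_nhds (by linarith) (by linarith))
      (Eventually.of_forall fun s => Continuous.aestronglyMeasurable (by fun_prop))
      (Continuous.intervalIntegrable (by fun_prop) _ _)
      (Continuous.aestronglyMeasurable (by fun_prop))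
      (Eventually.of_forall fun x hx s hs => ?_) (by simp)
      (Eventually.of_forall fun x _ s _ => ?_)).2
    · exact hC (s, x) ⟨hs, uIoc_subset_uIcc hx⟩
    · have e1 : HasDerivAt (fun s : ℝ => (n : ℝ) ^ 2 * (s - x)) ((n : ℝ) ^ 2) s := by
        simpa using ((hasDerivAt_id s).sub_const x).const_mul ((n : ℝ) ^ 2)
      have e2 := (((hdF _).comp s e1).mul_const (χ x)).ofReal_comp.mul_const (h n x)
      refine e2.congr_deriv ?_
      push_cast
      ring
  have key : HasDerivAt (fun s => I s s) (I₁ t t + I₂ t t) t := by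
    have := HasFDerivAt.comp_hasDerivAt (f := fun s : ℝ => (s, s)) t
      (hasFDerivAt_of_partials d1 d2 c1 c2 (t, t))
      ((hasDerivAt_id t).prodMk (hasDerivAt_id t))
    simpa [Function.comp_def] using this
  refine key.congr_deriv ?_
  simp only [I₁, I₂, duhamel]
  rw [intervalIntegral.integral_const_mul, sub_self, mul_zero]
  push_cast
  ring

theorem norm_int_sq_le (n : ℤ) : ‖(n : ℂ) ^ 2‖ ≤ 1 * wt 2 n := by
  rw [norm_pow, Complex.norm_intCast, one_mul, wt]
  exact pow_le_pow_left₀ (abs_nonneg _) (by linarith) 2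

theorem norm_I_mul_int_le (n : ℤ) : ‖Complex.I * n‖ ≤ 1 * wt 1 n := by
  rw [norm_mul, Complex.norm_I, Complex.norm_intCast, wt]
  linarith

/-- A cutoff in time at scale `δ`. -/
structure Cutoff (δ : ℝ) (χ : ℝ → ℝ) : Prop where
  bdd : BddSmooth χ
  le_one : ∀ x, |χ x| ≤ 1
  zero : ∀ x, δ ≤ |x| → χ x = 0

section Duhamel

variable {F χ : ℝ → ℝ} {h : ℤ → ℝ → ℂ} {δ : ℝ}

theorem norm_duhamel_le {C B : ℝ} (hF : Continuous F) (hC : ∀ x, |F x| ≤ C) (hχ : Cutoff δ χ)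
    (hδ : 0 ≤ δ) {n : ℤ} (hc : Continuous (h n)) (hB : ∀ t, ‖h n t‖ ≤ B) (t : ℝ) :
    ‖duhamel F χ h n t‖ ≤ C * B * (2 * δ) := by
  have cχ := hχ.bdd.1.continuous
  refine norm_integral_cutoff_le (fun σ hσ => by simp [hχ.zero σ hσ]) (fun σ => ?_) hδ
    (by fun_prop) t
  rw [norm_mul, Complex.norm_real, Real.norm_eq_abs, abs_mul]
  have h0 : 0 ≤ C := (abs_nonneg _).trans (hC 0)
  calc |F (n ^ 2 * (t - σ))| * |χ σ| * ‖h n σ‖ ≤ C * 1 * B := by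
        gcongr
        exacts [hC _, hχ.le_one σ, hB σ]
    _ = C * B := by ring

theorem RapidBound.duhamel (hF : BddSmooth F) (hχ : Cutoff δ χ) (hδ : 0 ≤ δ) (hh : RapidBound h) :
    RapidBound (duhamel F χ h) := by
  obtain ⟨B, hB, h1⟩ := hh.bound
  obtain ⟨C, hC⟩ := hF.bdd
  refine ⟨fun n => continuous_duhamel hF.1.continuous hχ.bdd.1.continuous (hh.cont n),
    fun n => C * B n * (2 * δ), fun k => ?_,
    fun n => norm_duhamel_le hF.1.continuous hC hχ hδ (hh.cont n) (h1 n)⟩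
  refine ((hB k).mul_left (C * (2 * δ))).congr fun n => ?_
  ring

theorem Rap.duhamel {j : ℕ} (hF : BddSmooth F) (hχ : Cutoff δ χ) (hδ : 0 ≤ δ) (hh : Rap j h) :
    Rap j (duhamel F χ h) := by
  induction j generalizing F with
  | zero => exact RapidBound.duhamel hF hχ hδ hh
  | succ j ih =>
    refine ⟨hh.rapidBound.duhamel hF hχ hδ, _, fun n t => hasDerivAt_duhamel hF.1
      hχ.bdd.1.continuous (hh.rapidBound.cont n) t, Rap.add ?_ ?_⟩
    · refine Rap.coef_mul (m := fun _ => (F 0 : ℂ)) (C := ‖(F 0 : ℂ)‖) (l := 0)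
        (fun n => by simp [wt]) (Rap.fun_mul hχ.bdd hh.pred)
    · exact Rap.coef_mul norm_int_sq_le (ih hF.deriv hh.pred)

theorem Rap.duhamel_succ {j : ℕ} (hF : BddSmooth F) (hχ : Cutoff δ χ) (hδ : 0 ≤ δ)
    (hh : Rap j h) : Rap (j + 1) (YamabeFlow.duhamel F χ h) := by
  refine ⟨hh.rapidBound.duhamel hF hχ hδ, _, fun n t => hasDerivAt_duhamel hF.1
    hχ.bdd.1.continuous (hh.rapidBound.cont n) t, Rap.add ?_ ?_⟩
  · refine Rap.coef_mul (m := fun _ => (F 0 : ℂ)) (C := ‖(F 0 : ℂ)‖) (l := 0)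
      (fun n => by simp [wt]) (Rap.fun_mul hχ.bdd hh)
  · exact Rap.coef_mul norm_int_sq_le (Rap.duhamel hF.deriv hχ hδ hh)

theorem Rap.heat {F : ℝ → ℝ} (hF : BddSmooth F) {c : ℤ → ℂ}
    (hc : ∀ k, Summable fun n => wt k n * ‖c n‖) (j : ℕ) :
    Rap j fun n t => (F (n ^ 2 * t) : ℂ) * c n := by
  have h0 : ∀ {F : ℝ → ℝ}, BddSmooth F → RapidBound fun n t => (F (n ^ 2 * t) : ℂ) * c n := by
    intro F hF
    obtain ⟨C, hC⟩ := hF.bdd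
    have := hF.1.continuous
    refine ⟨fun n => by fun_prop, fun n => C * ‖c n‖, fun k => ?_, fun n t => ?_⟩
    · refine ((hc k).mul_left C).congr fun n => ?_
      ring
    · rw [norm_mul, Complex.norm_real]
      exact mul_le_mul_of_nonneg_right (hC _) (norm_nonneg _)
  induction j generalizing F with
  | zero => exact h0 hF
  | succ j ih =>
    refine ⟨h0 hF, fun n t => (n : ℂ) ^ 2 * (((deriv F (n ^ 2 * t) : ℝ) : ℂ) * c n), fun n t => ?_,
      Rap.coef_mul norm_int_sq_le (ih hF.deriv)⟩
    have e1 : HasDerivAt (fun s : ℝ => (n : ℝ) ^ 2 * s) ((n : ℝ) ^ 2) t := by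
      simpa using (hasDerivAt_id t).const_mul ((n : ℝ) ^ 2)
    refine (((hF.hasDerivAt _).comp t e1).ofReal_comp.mul_const (c n)).congr_deriv ?_
    push_cast
    ring

end Duhamel

/-- The function with given time-dependent Fourier coefficients. -/
noncomputable def synth (a : ℤ → ℝ → ℂ) (x t : ℝ) : ℂ := ∑' n, a n t * expI n x

/-- Infinitely many rapidly decaying time derivatives. -/
def RapAll (a : ℤ → ℝ → ℂ) : Prop := ∀ j, Rap j a

section Synth

variable {a b : ℤ → ℝ → ℂ}

theorem RapidBound.summable (ha : RapidBound a) (t : ℝ) : Summable fun n => ‖a n t‖ := by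
  obtain ⟨B, hB, h1⟩ := ha.bound
  exact Summable.of_nonneg_of_le (fun _ => norm_nonneg _) (fun n => h1 n t) (summable_of_wt_all hB)

theorem RapidBound.summable_synth (ha : RapidBound a) (x t : ℝ) :
    Summable fun n => a n t * expI n x :=
  Summable.of_norm (by simpa [norm_expI] using ha.summable t)

theorem RapidBound.continuous_synth (ha : RapidBound a) :
    Continuous fun p : ℝ × ℝ => synth a p.1 p.2 := by
  obtain ⟨B, hB, h1⟩ := ha.bound
  refine continuous_tsum (fun n => ?_) (summable_of_wt_all hB) fun n p => ?_
  · have := ha.cont n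
    have := continuous_expI n
    fun_prop
  · rw [norm_mul, norm_expI, mul_one]
    exact h1 n _

theorem RapidBound.hasDerivAt_synth_x (ha : RapidBound a) (x t : ℝ) :
    HasDerivAt (fun y => synth a y t) (synth (fun n t => Complex.I * n * a n t) x t) x := by
  obtain ⟨B, hB, h1⟩ := ha.bound
  refine hasDerivAt_tsum (u := fun n => wt 1 n * B n)
    (g' := fun n y => Complex.I * n * a n t * expI n y) (hB 1)
    (fun n y => ((hasDerivAt_expI n y).const_mul (a n t)).congr_deriv (by ring))
    (fun n y => ?_) (y₀ := x) (ha.summable_synth x t) x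
  rw [norm_mul, norm_mul, norm_expI, mul_one]
  have := norm_I_mul_int_le n
  rw [one_mul] at this
  exact mul_le_mul this (h1 n t) (norm_nonneg _) (wt_pos 1 n).le

theorem RapidBound.hasDerivAt_synth_t (ha : RapidBound a) (hb : RapidBound b)
    (h : ∀ n t, HasDerivAt (a n) (b n t) t) (x t : ℝ) :
    HasDerivAt (fun s => synth a x s) (synth b x t) t := by
  obtain ⟨B, hB, h1⟩ := hb.bound
  refine hasDerivAt_tsum (summable_of_wt_all hB) (fun n y => (h n y).mul_const (expI n x))
    (fun n y => ?_) (y₀ := t) (ha.summable_synth x t) t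
  rw [norm_mul, norm_expI, mul_one]
  exact h1 n y

theorem Rap.dx {j : ℕ} (ha : Rap j a) : Rap j fun n t => Complex.I * n * a n t :=
  Rap.coef_mul norm_I_mul_int_le ha

theorem Rap.contDiff_synth {j : ℕ} (ha : Rap j a) :
    ContDiff ℝ j fun p : ℝ × ℝ => synth a p.1 p.2 := by
  induction j generalizing a with
  | zero => exact contDiff_zero.2 ha.rapidBound.continuous_synth
  | succ j ih =>
    have hdx := ha.pred.dx
    obtain ⟨h0, b, hb, hr⟩ := ha
    push_cast
    rw [contDiff_succ_iff_hasFDerivAt]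
    refine ⟨_, ?_, hasFDerivAt_of_partials h0.hasDerivAt_synth_x
      (h0.hasDerivAt_synth_t hr.rapidBound hb)
      hdx.rapidBound.continuous_synth hr.rapidBound.continuous_synth⟩
    exact (contDiff_const.smulRight (ih hdx)).add (contDiff_const.smulRight (ih hr))

theorem RapAll.smooth (ha : RapAll a) : Smooth2 (synth a) :=
  contDiff_infty.2 fun n => (ha n).contDiff_synth

theorem RapAll.rapidBound (ha : RapAll a) : RapidBound a := ha 0

theorem synth_periodic (a : ℤ → ℝ → ℂ) (x t : ℝ) : synth a (x + 2 * π) t = synth a x t := by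
  simp only [synth, expI_periodic]

theorem RapidBound.synth_add (ha : RapidBound a) (hb : RapidBound b) (x t : ℝ) :
    synth (fun n t => a n t + b n t) x t = synth a x t + synth b x t := by
  simp only [synth, add_mul]
  exact (ha.summable_synth x t).tsum_add (hb.summable_synth x t)

theorem synth_const_mul (c : ℂ) (a : ℤ → ℝ → ℂ) (x t : ℝ) :
    synth (fun n t => c * a n t) x t = c * synth a x t := by
  simp only [synth, mul_assoc]
  exact tsum_mul_left

theorem synth_star (a : ℤ → ℝ → ℂ) (x t : ℝ) :
    synth (tstar a) x t = (starRingEnd ℂ) (synth a x t) := by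
  rw [synth, synth, Complex.conj_tsum, ← (Equiv.neg ℤ).tsum_eq]
  congr 1
  ext n
  simp [tstar, star_expI]

theorem RapidBound.synth_conv (ha : RapidBound a) (hb : RapidBound b) (x t : ℝ) :
    synth (tconv a b) x t = synth a x t * synth b x t := by
  obtain ⟨A, hA, h1⟩ := ha.bound
  obtain ⟨B, hB, h2⟩ := hb.bound
  have s1 := ha.summable t
  have s2 := hb.summable t
  have hp : Summable fun p : ℤ × ℤ => ‖(a p.2 t * expI p.2 x) * (b (p.1 - p.2) t * expI (p.1 - p.2) x)‖ := by
    simpa [norm_expI] using summable_conv_prod s1 s2 (fun _ => norm_nonneg _) fun _ => norm_nonneg _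
  have hq : Summable fun p : ℤ × ℤ => (a p.1 t * expI p.1 x) * (b p.2 t * expI p.2 x) :=
    Summable.of_norm (by
      simpa [norm_expI] using s1.mul_of_nonneg s2 (fun _ => norm_nonneg _) fun _ => norm_nonneg _)
  rw [synth, synth, synth, (ha.summable_synth x t).tsum_mul_tsum (hb.summable_synth x t) hq]
  let e : ℤ × ℤ ≃ ℤ × ℤ :=
    { toFun := fun p => (p.2, p.1 - p.2)
      invFun := fun p => (p.1 + p.2, p.1)
      left_inv := fun p => by ext <;> simp
      right_inv := fun p => by ext <;> simp }
  rw [← e.tsum_eq (fun p : ℤ × ℤ => (a p.1 t * expI p.1 x) * (b p.2 t * expI p.2 x))]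
  simp only [e, Equiv.coe_fn_mk]
  rw [hp.of_norm.tsum_prod]
  congr 1
  ext n
  rw [tconv, YamabeFlow.conv, ← tsum_mul_right]
  congr 1
  ext m
  rw [show expI n x = expI m x * expI (n - m) x by rw [← expI_add, add_sub_cancel]]
  ring

theorem integral_expI {n : ℤ} (hn : n ≠ 0) : ∫ x in (0:ℝ)..(2 * π), expI n x = 0 := by
  have h := integral_deriv_eq_zero_of_periodic (T := 2 * π) (fun x => hasDerivAt_expI n x)
    (continuous_const.mul (continuous_expI n)) (by rw [← zero_add (2 * π), expI_periodic])
  rw [intervalIntegral.integral_const_mul] at h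
  exact (mul_eq_zero.1 h).resolve_left (mul_ne_zero Complex.I_ne_zero (Int.cast_ne_zero.2 hn))

theorem RapidBound.integral_synth (ha : RapidBound a) (t : ℝ) :
    ∫ x in (0:ℝ)..(2 * π), synth a x t = 2 * π * a 0 t := by
  obtain ⟨B, hB, h1⟩ := ha.bound
  have h := intervalIntegral.hasSum_integral_of_dominated_convergence (a := 0) (b := 2 * π)
    (μ := volume)
    (F := fun n x => a n t * expI n x) (f := fun x => synth a x t) (fun n _ => B n)
    (fun n => (continuous_const.mul (continuous_expI n)).aestronglyMeasurable)
    (fun n => Eventually.of_forall fun x _ => by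
      rw [norm_mul, norm_expI, mul_one]; exact h1 n t)
    (Eventually.of_forall fun x _ => summable_of_wt_all hB) (by simp)
    (Eventually.of_forall fun x _ => (ha.summable_synth x t).hasSum)
  rw [← h.tsum_eq, tsum_eq_single 0]
  · simp [expI_zero, mul_comm]
  · intro n hn
    rw [intervalIntegral.integral_const_mul, integral_expI hn, mul_zero]

end Synth

/-- A bounded smooth function on the line that agrees with `exp (-x)` for `x ≥ 0`. -/
noncomputable def decay (x : ℝ) : ℝ := exp (-x) * Real.smoothTransition (x + 1)

theorem decay_of_nonneg {x : ℝ} (hx : 0 ≤ x) : decay x = exp (-x) := by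
  rw [decay, Real.smoothTransition.one_of_one_le (by linarith), mul_one]

theorem contDiff_decay : ContDiff ℝ ∞ decay := by
  unfold decay
  exact (Real.contDiff_exp.comp contDiff_neg).mul
    (Real.smoothTransition.contDiff.comp (contDiff_id.add contDiff_const))

theorem abs_decay_le (x : ℝ) : |decay x| ≤ 6 * (1 + x ^ 2)⁻¹ := by
  have h0 : 0 ≤ decay x := mul_nonneg (exp_pos _).le (Real.smoothTransition.nonneg _)
  rw [abs_of_nonneg h0, ← div_eq_mul_inv, le_div_iff₀ (by positivity)]
  rcases le_or_gt 0 x with hx | hx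
  · rw [decay_of_nonneg hx, exp_neg, inv_mul_le_iff₀ (exp_pos x)]
    nlinarith [Real.quadratic_le_exp_of_nonneg hx]
  · rcases le_or_gt x (-1) with h1 | h1
    · rw [decay, Real.smoothTransition.zero_of_nonpos (by linarith)]
      simp
    · have e1 : decay x ≤ 3 := by
        calc decay x ≤ exp (-x) * 1 :=
              mul_le_mul_of_nonneg_left (Real.smoothTransition.le_one _) (exp_pos _).le
          _ ≤ exp 1 := by rw [mul_one]; exact exp_le_exp.2 (by linarith)
          _ ≤ 3 := by linarith [Real.exp_one_lt_d9]
      have e2 : 1 + x ^ 2 ≤ 2 := by nlinarith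
      nlinarith

theorem bddSmooth_decay : BddSmooth decay := by
  have hs : ContDiff ℝ ∞ Real.smoothTransition := Real.smoothTransition.contDiff
  let β : ℝ → ℝ := fun x => exp (-x) * deriv Real.smoothTransition (x + 1)
  have hβ : ContDiff ℝ ∞ β := (Real.contDiff_exp.comp contDiff_neg).mul
    ((contDiff_infty_iff_deriv.1 hs).2.comp (contDiff_id.add contDiff_const))
  have hβs : HasCompactSupport β := by
    refine HasCompactSupport.intro (isCompact_Icc (a := -1) (b := 0)) fun x hx => ?_
    have : deriv Real.smoothTransition (x + 1) = 0 := by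
      rw [mem_Icc, not_and_or, not_le, not_le] at hx
      rcases hx with hx | hx
      · have : Real.smoothTransition =ᶠ[𝓝 (x + 1)] fun _ => 0 := by
          filter_upwards [gt_mem_nhds (show x + 1 < 0 by linarith)] with y hy
          exact Real.smoothTransition.zero_of_nonpos hy.le
        rw [this.deriv_eq, deriv_const]
      · have : Real.smoothTransition =ᶠ[𝓝 (x + 1)] fun _ => 1 := by
          filter_upwards [lt_mem_nhds (show 1 < x + 1 by linarith)] with y hy
          exact Real.smoothTransition.one_of_one_le hy.le
        rw [this.deriv_eq, deriv_const]
    simp only [β, this, mul_zero]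
  have hd : deriv decay = -decay + β := by
    ext x
    have e1 : HasDerivAt (fun x : ℝ => exp (-x)) (exp (-x) * (-1)) x := (hasDerivAt_neg x).exp
    have e2 : HasDerivAt (fun x : ℝ => Real.smoothTransition (x + 1))
        (deriv Real.smoothTransition (x + 1)) x :=
      (hs.differentiable (by simp) (x + 1)).hasDerivAt.comp_add_const x 1
    refine (e1.mul e2).deriv.trans ?_
    simp only [Pi.add_apply, Pi.neg_apply, β, decay]
    ring
  refine ⟨contDiff_decay, fun i => ?_⟩
  induction i with
  | zero =>
    refine ⟨6, fun x => ?_⟩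
    rw [iteratedDeriv_zero]
    refine (abs_decay_le x).trans ?_
    have : (1 + x ^ 2)⁻¹ ≤ 1 := inv_le_one_of_one_le₀ (by nlinarith [sq_nonneg x])
    linarith
  | succ i ih =>
    obtain ⟨C, hC⟩ := ih
    obtain ⟨C', hC'⟩ := (BddSmooth.of_hasCompactSupport hβ hβs).2 i
    refine ⟨C + C', fun x => ?_⟩
    have hi : ((i : ℕ∞) : WithTop ℕ∞) ≤ ∞ := WithTop.coe_le_coe.2 le_top
    rw [iteratedDeriv_succ', hd, iteratedDeriv_add, iteratedDeriv_neg]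
    · refine (abs_add_le _ _).trans (add_le_add ?_ (hC' x))
      rw [abs_neg]
      exact hC x
    · exact (contDiff_decay.neg.of_le hi).contDiffAt
    · exact (hβ.of_le hi).contDiffAt

theorem norm_duhamel_decay_le {χ : ℝ → ℝ} {h : ℤ → ℝ → ℂ} {δ B : ℝ} {n : ℤ} (hχ : Cutoff δ χ)
    (hB : ∀ t, ‖h n t‖ ≤ B) (hn : n ≠ 0) (t : ℝ) :
    ‖duhamel decay χ h n t‖ ≤ 6 * π * B * ((n : ℝ) ^ 2)⁻¹ := by
  have hn2 : (0 : ℝ) < (n : ℝ) ^ 2 := by positivity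
  have hi : Integrable fun σ : ℝ => (6 * B) * (1 + ((n : ℝ) ^ 2 * (t - σ)) ^ 2)⁻¹ := by
    have h1 := (integrable_inv_one_add_sq.comp_mul_left' hn2.ne').comp_sub_left t
    exact h1.const_mul _
  have hB0 : 0 ≤ B := (norm_nonneg _).trans (hB 0)
  rw [duhamel, intervalIntegral.norm_intervalIntegral_eq]
  calc _ ≤ ∫ σ in uIoc 0 t, (6 * B) * (1 + ((n : ℝ) ^ 2 * (t - σ)) ^ 2)⁻¹ := by
        refine norm_integral_le_of_norm_le hi.integrableOn (Eventually.of_forall fun σ => ?_)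
        rw [norm_mul, Complex.norm_real, Real.norm_eq_abs, abs_mul]
        calc |decay (n ^ 2 * (t - σ))| * |χ σ| * ‖h n σ‖
            ≤ (6 * (1 + ((n : ℝ) ^ 2 * (t - σ)) ^ 2)⁻¹) * 1 * B := by
              gcongr
              exacts [abs_decay_le _, hχ.le_one σ, hB σ]
          _ = _ := by ring
    _ ≤ ∫ σ, (6 * B) * (1 + ((n : ℝ) ^ 2 * (t - σ)) ^ 2)⁻¹ :=
        setIntegral_le_integral hi (Eventually.of_forall fun σ => by
          simp only [Pi.zero_apply]
          positivity)
    _ = 6 * π * B * ((n : ℝ) ^ 2)⁻¹ := by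
        rw [integral_const_mul, integral_sub_left_eq_self
          (fun x : ℝ => (1 + ((n : ℝ) ^ 2 * x) ^ 2)⁻¹) volume t,
          Measure.integral_comp_mul_left (fun x : ℝ => (1 + x ^ 2)⁻¹),
          integral_univ_inv_one_add_sq, smul_eq_mul, abs_of_pos (inv_pos.2 hn2)]
        ring

theorem norm_I_mul_duhamel_le_wt {χ : ℝ → ℝ} {h : ℤ → ℝ → ℂ} {δ B : ℝ} {n : ℤ} (hχ : Cutoff δ χ)
    (hB : ∀ t, ‖h n t‖ ≤ B) (t : ℝ) :
    ‖Complex.I * n * duhamel decay χ h n t‖ ≤ 12 * π * B * (wt 1 n)⁻¹ := by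
  have hB0 : 0 ≤ B := (norm_nonneg _).trans (hB 0)
  rcases eq_or_ne n 0 with rfl | hn
  · have := wt_pos 1 0
    simp only [Int.cast_zero, mul_zero, zero_mul, norm_zero]
    positivity
  rw [norm_mul, norm_mul, Complex.norm_I, one_mul, Complex.norm_intCast]
  have h1 : (1:ℝ) ≤ |(n : ℝ)| := by exact_mod_cast Int.one_le_abs hn
  have h2 := norm_duhamel_decay_le hχ hB hn t
  have h3 : |(n : ℝ)| * ((n : ℝ) ^ 2)⁻¹ ≤ 2 * (wt 1 n)⁻¹ := by
    rw [wt, pow_one, ← div_eq_mul_inv, ← div_eq_mul_inv, div_le_div_iff₀ (by positivity)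
      (by positivity), ← sq_abs]
    nlinarith
  calc _ ≤ |(n : ℝ)| * (6 * π * B * ((n : ℝ) ^ 2)⁻¹) := by gcongr
    _ = 6 * π * B * (|(n : ℝ)| * ((n : ℝ) ^ 2)⁻¹) := by ring
    _ ≤ 6 * π * B * (2 * (wt 1 n)⁻¹) := by gcongr
    _ = _ := by ring

theorem norm_I_mul_duhamel_le_sqrt {χ : ℝ → ℝ} {h : ℤ → ℝ → ℂ} {δ B : ℝ} {n : ℤ} (hδ : 0 ≤ δ)
    (hχ : Cutoff δ χ) (hc : Continuous (h n)) (hB : ∀ t, ‖h n t‖ ≤ B) (t : ℝ) :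
    ‖Complex.I * n * duhamel decay χ h n t‖ ≤ √(72 * π * δ) * B := by
  have hB0 : 0 ≤ B := (norm_nonneg _).trans (hB 0)
  rcases eq_or_ne n 0 with rfl | hn
  · simp only [Int.cast_zero, mul_zero, zero_mul, norm_zero]
    positivity
  rw [norm_mul, norm_mul, Complex.norm_I, one_mul, Complex.norm_intCast]
  have hn2 : (0 : ℝ) < (n : ℝ) ^ 2 := by positivity
  have h1 := norm_duhamel_decay_le hχ hB hn t
  have h2 := norm_duhamel_le contDiff_decay.continuous (C := 6) (fun x => (abs_decay_le x).trans (by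
    have : (1 + x ^ 2)⁻¹ ≤ 1 := inv_le_one_of_one_le₀ (by nlinarith [sq_nonneg x])
    linarith)) hχ hδ hc hB t
  refine abs_le_of_sq_le_sq' ?_ (by positivity) |>.2
  rw [mul_pow, sq_abs, mul_pow, sq_sqrt (by positivity)]
  calc (n : ℝ) ^ 2 * ‖duhamel decay χ h n t‖ ^ 2
      = (n : ℝ) ^ 2 * (‖duhamel decay χ h n t‖ * ‖duhamel decay χ h n t‖) := by ring
    _ ≤ (n : ℝ) ^ 2 * ((6 * π * B * ((n : ℝ) ^ 2)⁻¹) * (6 * B * (2 * δ))) := by gcongr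
    _ = ((n : ℝ) ^ 2 * ((n : ℝ) ^ 2)⁻¹) * (72 * π * δ * B ^ 2) := by ring
    _ = _ := by rw [mul_inv_cancel₀ hn2.ne', one_mul]

theorem exists_cutoff {τ : ℝ} (hτ : 0 < τ) :
    ∃ χ, Cutoff (2 * τ) χ ∧ ∀ x, |x| ≤ τ → χ x = 1 := by
  let f : ContDiffBump (0 : ℝ) := ⟨τ, 2 * τ, hτ, by linarith⟩
  refine ⟨f, ⟨BddSmooth.of_hasCompactSupport f.contDiff f.hasCompactSupport, fun x => ?_,
    fun x hx => ?_⟩, fun x hx => ?_⟩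
  · rw [abs_of_nonneg f.nonneg]
    exact f.le_one
  · exact f.zero_of_le_dist (by simpa using hx)
  · exact f.one_of_mem_closedBall (by simpa using hx)

/-- The symbol of `-½ ∂⁻¹` on mean-zero functions. -/
noncomputable def halfInv (n : ℤ) : ℂ := -(2 * Complex.I * n)⁻¹

theorem norm_halfInv_le (n : ℤ) : ‖halfInv n‖ ≤ 1 := by
  rcases eq_or_ne n 0 with rfl | hn
  · simp [halfInv]
  · have : (1:ℝ) ≤ |(n : ℝ)| := by exact_mod_cast Int.one_le_abs hn
    rw [halfInv, norm_neg, norm_inv, norm_mul, norm_mul, Complex.norm_I, Complex.norm_intCast]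
    refine inv_le_one_of_one_le₀ ?_
    norm_num
    linarith

/-- Coefficients of the complex velocity potential. -/
noncomputable def tpot (a : ℤ → ℝ → ℂ) (n : ℤ) (t : ℝ) : ℂ := halfInv n * tconv a a n t

/-- Coefficients of the gauge drift. -/
noncomputable def tdrift (a : ℤ → ℝ → ℂ) (n : ℤ) (t : ℝ) : ℂ :=
  (1 / 2) * (tpot a n t + tstar (tpot a) n t)

/-- Coefficients of the flux nonlinearity. -/
noncomputable def tnl (a : ℤ → ℝ → ℂ) (n : ℤ) (t : ℝ) : ℂ :=
  (1 / 2) * tconv a (tstar a) n t + tconv (tdrift a) a n t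

theorem Rap.const_mul {j : ℕ} {a : ℤ → ℝ → ℂ} (c : ℂ) (ha : Rap j a) :
    Rap j fun n t => c * a n t :=
  Rap.coef_mul (m := fun _ => c) (C := ‖c‖) (l := 0) (fun n => by simp [wt]) ha

theorem Rap.tpot {j : ℕ} {a : ℤ → ℝ → ℂ} (ha : Rap j a) : Rap j (tpot a) :=
  Rap.coef_mul (C := 1) (l := 0) (fun n => by simpa [wt] using norm_halfInv_le n) (ha.conv ha)

theorem Rap.tdrift {j : ℕ} {a : ℤ → ℝ → ℂ} (ha : Rap j a) : Rap j (tdrift a) :=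
  Rap.const_mul _ (ha.tpot.add ha.tpot.star)

theorem Rap.tnl {j : ℕ} {a : ℤ → ℝ → ℂ} (ha : Rap j a) : Rap j (tnl a) :=
  (Rap.const_mul _ (ha.conv ha.star)).add (ha.tdrift.conv ha)

/-- Domination by a sequence summable against the weight of order `k`. -/
def Dom (k : ℕ) (a : ℤ → ℝ → ℂ) : Prop :=
  ∃ B : ℤ → ℝ, (Summable fun n => wt k n * B n) ∧ ∀ n t, ‖a n t‖ ≤ B n

section Dom

variable {k : ℕ} {a b : ℤ → ℝ → ℂ}

theorem Dom.add (ha : Dom k a) (hb : Dom k b) : Dom k fun n t => a n t + b n t := by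
  obtain ⟨B, hB, h1⟩ := ha
  obtain ⟨B', hB', h1'⟩ := hb
  refine ⟨fun n => B n + B' n, ?_, fun n t => norm_add_le_of_le (h1 n t) (h1' n t)⟩
  simp only [mul_add]
  exact hB.add hB'

theorem Dom.coef_mul {m : ℤ → ℂ} {C : ℝ} (hm : ∀ n, ‖m n‖ ≤ C) (ha : Dom k a) :
    Dom k fun n t => m n * a n t := by
  obtain ⟨B, hB, h1⟩ := ha
  refine ⟨fun n => C * B n, (hB.mul_left C).congr fun n => by ring, fun n t => ?_⟩
  rw [norm_mul]
  exact mul_le_mul (hm n) (h1 n t) (norm_nonneg _) ((norm_nonneg _).trans (hm n))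

theorem Dom.star (ha : Dom k a) : Dom k (tstar a) := by
  obtain ⟨B, hB, h1⟩ := ha
  refine ⟨fun n => B (-n), ((Equiv.neg ℤ).summable_iff.2 hB).congr fun n => by simp [wt],
    fun n t => ?_⟩
  rw [tstar, RCLike.norm_conj]
  exact h1 _ _

theorem Dom.conv (ha : Dom k a) (hb : Dom k b) : Dom k (tconv a b) := by
  obtain ⟨B, hB, h1⟩ := ha
  obtain ⟨B', hB', h1'⟩ := hb
  have p := RapidBound.nonneg h1
  have p' := RapidBound.nonneg h1'
  exact ⟨YamabeFlow.conv B B', summable_wt_conv hB hB' p p', fun n t =>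
    norm_conv_le (summable_of_wt p hB) (summable_of_wt p' hB') (fun m => h1 m t)
      (fun m => h1' m t) n⟩

theorem Dom.tnl (ha : Dom k a) : Dom k (tnl a) := by
  have h1 : Dom k (tpot a) := Dom.coef_mul norm_halfInv_le (ha.conv ha)
  have h2 : Dom k (tdrift a) := Dom.coef_mul (m := fun _ => 1 / 2) (fun _ => le_rfl)
    (h1.add h1.star)
  exact (Dom.coef_mul (m := fun _ => 1 / 2) (fun _ => le_rfl) (ha.conv ha.star)).add (h2.conv ha)

theorem rapidBound_of_dom (hc : ∀ n, Continuous (a n)) (h : ∀ k, Dom k a) : RapidBound a := by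
  refine ⟨hc, fun n => ⨆ t, ‖a n t‖, fun k => ?_, fun n t => ?_⟩
  · obtain ⟨B, hB, h1⟩ := h k
    exact Summable.of_nonneg_of_le
      (fun n => mul_nonneg (wt_pos k n).le (Real.iSup_nonneg fun _ => norm_nonneg _))
      (fun n => mul_le_mul_of_nonneg_left (ciSup_le fun t => h1 n t) (wt_pos k n).le) hB
  · obtain ⟨B, _, h1⟩ := h 0
    exact le_ciSup (f := fun t => ‖a n t‖) ⟨B n, by rintro _ ⟨t, rfl⟩; exact h1 n t⟩ t

end Dom

/-- Solutions of the integral equation have coefficients decaying rapidly in all derivatives. -/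
theorem rapAll_of_fixed {χ : ℝ → ℝ} {δ : ℝ} (hδ : 0 ≤ δ) (hχ : Cutoff δ χ) {c : ℤ → ℂ}
    (hc : ∀ k, Summable fun n => wt k n * ‖c n‖) {a : ℤ → ℝ → ℂ} (ha : ∀ n, Continuous (a n))
    (h0 : Dom 0 a)
    (hfix : ∀ (n : ℤ) t, a n t
      = (decay (n ^ 2 * t) : ℂ) * c n + Complex.I * n * duhamel decay χ (tnl a) n t) :
    RapAll a := by
  have hd : ∀ k, Dom k a := by
    intro k
    induction k with
    | zero => exact h0
    | succ k ih =>
      obtain ⟨B, hB, h1⟩ := ih.tnl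
      obtain ⟨C, hC⟩ := bddSmooth_decay.bdd
      refine ⟨fun n => C * ‖c n‖ + 12 * π * B n * (wt 1 n)⁻¹, ?_, fun n t => ?_⟩
      · refine (((hc (k + 1)).mul_left C).add (hB.mul_left (12 * π))).congr fun n => ?_
        rw [wt_add]
        have := wt_pos 1 n
        field_simp
      · rw [hfix]
        refine norm_add_le_of_le ?_ (norm_I_mul_duhamel_le_wt hχ (h1 n) t)
        rw [norm_mul, Complex.norm_real]
        exact mul_le_mul_of_nonneg_right (hC _) (norm_nonneg _)
  intro j
  induction j with
  | zero => exact rapidBound_of_dom ha hd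
  | succ j ih =>
    rw [show a = fun (n : ℤ) t => (decay (n ^ 2 * t) : ℂ) * c n +
      Complex.I * n * duhamel decay χ (tnl a) n t from funext fun n => funext fun t => hfix n t]
    exact (Rap.heat bddSmooth_decay hc _).add (Rap.dx (Rap.duhamel_succ bddSmooth_decay hχ hδ ih.tnl))

open scoped ContDiff BoundedContinuousFunction

section FixedPoint

/-- Pointwise values of a sequence of bounded continuous functions. -/
noncomputable def ellVal (a : Ell (ℝ →ᵇ ℂ)) (n : ℤ) (t : ℝ) : ℂ := a n t

theorem ellVal_sub (a b : Ell (ℝ →ᵇ ℂ)) (n : ℤ) (t : ℝ) :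
    ellVal (a - b) n t = ellVal a n t - ellVal b n t := rfl

theorem ellVal_add (a b : Ell (ℝ →ᵇ ℂ)) (n : ℤ) (t : ℝ) :
    ellVal (a + b) n t = ellVal a n t + ellVal b n t := rfl

theorem continuous_ellVal (a : Ell (ℝ →ᵇ ℂ)) (n : ℤ) : Continuous (ellVal a n) :=
  (a n).continuous

theorem dom_ellVal (a : Ell (ℝ →ᵇ ℂ)) : Dom 0 (ellVal a) :=
  ⟨fun n => ‖a n‖, by simpa [wt] using ell_summable a, fun n t => (a n).norm_coe_le_norm t⟩

theorem ellVal_ext {a b : Ell (ℝ →ᵇ ℂ)} (h : ∀ n t, ellVal a n t = ellVal b n t) : a = b := by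
  ext n t
  exact h n t

theorem ellVal_conv (a b : Ell (ℝ →ᵇ ℂ)) (n : ℤ) (t : ℝ) :
    ellVal (ellConv a b) n t = tconv (ellVal a) (ellVal b) n t := by
  have := (BoundedContinuousFunction.evalCLM ℂ t : (ℝ →ᵇ ℂ) →L[ℂ] ℂ).map_tsum
    (ellConv_term_summable a b n)
  exact this

/-- Conjugation of the function with given coefficients. -/
noncomputable def ellStar (a : Ell (ℝ →ᵇ ℂ)) : Ell (ℝ →ᵇ ℂ) :=
  ellMk (fun n => star (a (-n))) (by
    simp only [norm_star]
    exact (Equiv.neg ℤ).summable_iff.2 (ell_summable a))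

theorem ellVal_star (a : Ell (ℝ →ᵇ ℂ)) : ellVal (ellStar a) = tstar (ellVal a) := rfl

theorem norm_ellStar (a : Ell (ℝ →ᵇ ℂ)) : ‖ellStar a‖ = ‖a‖ := by
  rw [ell_norm_eq, ell_norm_eq, ← (Equiv.neg ℤ).tsum_eq fun n => ‖a n‖]
  exact tsum_congr fun n => norm_star _

/-- Multiplication of coefficients by a bounded symbol. -/
noncomputable def ellMul (m : ℤ → ℂ) (hm : ∀ n, ‖m n‖ ≤ 1) (a : Ell (ℝ →ᵇ ℂ)) : Ell (ℝ →ᵇ ℂ) :=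
  ellMk (fun n => m n • a n) (Summable.of_nonneg_of_le (fun _ => norm_nonneg _)
    (fun n => by rw [norm_smul]; exact mul_le_of_le_one_left (norm_nonneg _) (hm n))
    (ell_summable a))

theorem ellVal_mul {m : ℤ → ℂ} (hm : ∀ n, ‖m n‖ ≤ 1) (a : Ell (ℝ →ᵇ ℂ)) (n : ℤ) (t : ℝ) :
    ellVal (ellMul m hm a) n t = m n * ellVal a n t := rfl

theorem locLip_ellMul {m : ℤ → ℂ} (hm : ∀ n, ‖m n‖ ≤ 1) : LocLip (ellMul m hm) := by
  refine LocLip.of_additive 1 (fun a b => ellVal_ext fun n t => ?_) fun a => ?_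
  · simp only [ellVal_mul, ellVal_sub]
    ring
  · refine ell_norm_le _ _ _ fun n => ?_
    change ‖m n • a n‖ ≤ _
    rw [norm_smul]
    exact mul_le_mul_of_nonneg_right (hm n) (norm_nonneg _)

theorem locLip_ellStar : LocLip ellStar := by
  refine LocLip.of_additive 1 (fun a b => ellVal_ext fun n t => ?_) fun a => ?_
  · simp only [ellVal_star, ellVal_sub, tstar, map_sub]
  · rw [norm_ellStar, one_mul]

theorem norm_half_le : ∀ _ : ℤ, ‖(1 / 2 : ℂ)‖ ≤ 1 := fun _ => by norm_num

/-- The gauge drift on sequences of bounded continuous functions. -/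
noncomputable def ellDrift (a : Ell (ℝ →ᵇ ℂ)) : Ell (ℝ →ᵇ ℂ) :=
  ellMul (fun _ => 1 / 2) norm_half_le
    (ellMul halfInv norm_halfInv_le (ellConv a a) +
      ellStar (ellMul halfInv norm_halfInv_le (ellConv a a)))

/-- The flux nonlinearity on sequences of bounded continuous functions. -/
noncomputable def ellNl (a : Ell (ℝ →ᵇ ℂ)) : Ell (ℝ →ᵇ ℂ) :=
  ellMul (fun _ => 1 / 2) norm_half_le (ellConv a (ellStar a)) + ellConv (ellDrift a) a

theorem ellVal_drift (a : Ell (ℝ →ᵇ ℂ)) : ellVal (ellDrift a) = tdrift (ellVal a) := by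
  ext n t
  simp only [ellDrift, ellVal_mul, ellVal_add, ellVal_star, tdrift, tstar, tpot, ellVal_conv]

theorem ellVal_nl (a : Ell (ℝ →ᵇ ℂ)) : ellVal (ellNl a) = tnl (ellVal a) := by
  ext n t
  simp only [ellNl, ellVal_mul, ellVal_add, ellVal_conv, tnl, ellVal_star, ellVal_drift]

theorem locLip_id {X : Type*} [NormedAddCommGroup X] : LocLip fun a : X => a :=
  LocLip.of_additive 1 (fun _ _ => rfl) fun a => (one_mul ‖a‖).ge

theorem locLip_ellNl : LocLip ellNl := by
  have h1 : LocLip fun a : Ell (ℝ →ᵇ ℂ) => ellMul halfInv norm_halfInv_le (ellConv a a) :=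
    (locLip_ellMul norm_halfInv_le).comp (locLip_id.conv locLip_id)
  have h2 : LocLip ellDrift := (locLip_ellMul norm_half_le).comp (h1.add (locLip_ellStar.comp h1))
  exact ((locLip_ellMul norm_half_le).comp (locLip_id.conv locLip_ellStar)).add
    (h2.conv locLip_id)

variable {χ : ℝ → ℝ} {δ : ℝ}

/-- The Duhamel operator on sequences of bounded continuous functions. -/
noncomputable def ellDuhamel (hδ : 0 ≤ δ) (hχ : Cutoff δ χ) (h : Ell (ℝ →ᵇ ℂ)) : Ell (ℝ →ᵇ ℂ) :=
  ellMk (fun n => BoundedContinuousFunction.ofNormedAddCommGroup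
      (fun t => Complex.I * n * duhamel decay χ (ellVal h) n t)
      (continuous_const.mul (continuous_duhamel contDiff_decay.continuous
        hχ.bdd.1.continuous (continuous_ellVal h n))) (√(72 * π * δ) * ‖h n‖)
      (norm_I_mul_duhamel_le_sqrt hδ hχ (continuous_ellVal h n) (h n).norm_coe_le_norm))
    (Summable.of_nonneg_of_le (fun _ => norm_nonneg _)
      (fun n => BoundedContinuousFunction.norm_ofNormedAddCommGroup_le _ (by positivity) _)
      ((ell_summable h).mul_left _))

theorem ellVal_duhamel (hδ : 0 ≤ δ) (hχ : Cutoff δ χ) (h : Ell (ℝ →ᵇ ℂ)) (n : ℤ) (t : ℝ) :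
    ellVal (ellDuhamel hδ hχ h) n t = Complex.I * n * duhamel decay χ (ellVal h) n t := rfl

theorem norm_ellDuhamel_le (hδ : 0 ≤ δ) (hχ : Cutoff δ χ) (h : Ell (ℝ →ᵇ ℂ)) :
    ‖ellDuhamel hδ hχ h‖ ≤ √(72 * π * δ) * ‖h‖ :=
  ell_norm_le _ _ _ fun n =>
    BoundedContinuousFunction.norm_ofNormedAddCommGroup_le _ (by positivity)
      (norm_I_mul_duhamel_le_sqrt hδ hχ (continuous_ellVal h n) (h n).norm_coe_le_norm)

theorem ellDuhamel_sub (hδ : 0 ≤ δ) (hχ : Cutoff δ χ) (h h' : Ell (ℝ →ᵇ ℂ)) :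
    ellDuhamel hδ hχ (h - h') = ellDuhamel hδ hχ h - ellDuhamel hδ hχ h' := by
  refine ellVal_ext fun n t => ?_
  have hc : ∀ h : Ell (ℝ →ᵇ ℂ), IntervalIntegrable (fun σ =>
      ((decay (n ^ 2 * (t - σ)) * χ σ : ℝ) : ℂ) * ellVal h n σ) volume 0 t := fun h => by
    refine Continuous.intervalIntegrable ?_ _ _
    have := contDiff_decay.continuous
    have := hχ.bdd.1.continuous
    have := continuous_ellVal h n
    fun_prop
  rw [ellVal_sub, ellVal_duhamel, ellVal_duhamel, ellVal_duhamel, ← mul_sub, duhamel, duhamel,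
    duhamel, ← intervalIntegral.integral_sub (hc h) (hc h')]
  simp only [ellVal_sub, mul_sub]

theorem abs_decay_le_six (x : ℝ) : |decay x| ≤ 6 :=
  (abs_decay_le x).trans (by
    have : (1 + x ^ 2)⁻¹ ≤ 1 := inv_le_one_of_one_le₀ (by nlinarith [sq_nonneg x])
    linarith)

/-- The free heat evolution. -/
noncomputable def ellHeat (c : ℤ → ℂ) (hc : Summable fun n => ‖c n‖) : Ell (ℝ →ᵇ ℂ) :=
  ellMk (fun n => BoundedContinuousFunction.ofNormedAddCommGroup
      (fun t : ℝ => (decay ((n : ℝ) ^ 2 * t) : ℂ) * c n)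
      (by have := contDiff_decay.continuous; fun_prop) (6 * ‖c n‖)
      (fun t => by
        rw [norm_mul, Complex.norm_real]
        exact mul_le_mul_of_nonneg_right (abs_decay_le_six _) (norm_nonneg _)))
    (Summable.of_nonneg_of_le (fun _ => norm_nonneg _)
      (fun n => BoundedContinuousFunction.norm_ofNormedAddCommGroup_le _ (by positivity) _)
      (hc.mul_left 6))

theorem ellVal_heat (c : ℤ → ℂ) (hc : Summable fun n => ‖c n‖) (n : ℤ) (t : ℝ) :
    ellVal (ellHeat c hc) n t = (decay ((n : ℝ) ^ 2 * t) : ℂ) * c n := rfl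

theorem norm_ellHeat_le (c : ℤ → ℂ) (hc : Summable fun n => ‖c n‖) :
    ‖ellHeat c hc‖ ≤ 6 * ∑' n, ‖c n‖ := by
  rw [ell_norm_eq, ← tsum_mul_left]
  exact (ell_summable _).tsum_le_tsum (fun n =>
    BoundedContinuousFunction.norm_ofNormedAddCommGroup_le _ (by positivity) fun t => by
        rw [norm_mul, Complex.norm_real]
        exact mul_le_mul_of_nonneg_right (abs_decay_le_six _) (norm_nonneg _)) (hc.mul_left 6)

/-- Local solvability of the integral equation, uniformly for bounded data. -/
theorem exists_mild_solution (M : ℝ) : ∃ τ, 0 < τ ∧ ∃ χ, Cutoff (2 * τ) χ ∧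
    (∀ x, |x| ≤ τ → χ x = 1) ∧ ∀ c : ℤ → ℂ, (∀ k, Summable fun n => wt k n * ‖c n‖) →
      ∑' n, ‖c n‖ ≤ M → ∃ a : ℤ → ℝ → ℂ, RapAll a ∧ ∀ (n : ℤ) t, a n t
        = (decay (n ^ 2 * t) : ℂ) * c n + Complex.I * n * duhamel decay χ (tnl a) n t := by
  obtain ⟨L, hL, h1, h2⟩ := locLip_ellNl (6 * M + 1)
  let τ : ℝ := (144 * π * 4 * (L + 1) ^ 2)⁻¹
  have hτ : 0 < τ := by positivity
  obtain ⟨χ, hχ, hχ1⟩ := exists_cutoff hτ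
  have hδ : 0 ≤ 2 * τ := by positivity
  have hε : √(72 * π * (2 * τ)) * L ≤ 1 / 2 := by
    have : 72 * π * (2 * τ) = (1 / (2 * (L + 1))) ^ 2 := by
      simp only [τ]
      field_simp
      norm_num
    rw [this, sqrt_sq (by positivity), div_mul_eq_mul_div, div_le_div_iff₀ (by positivity)
      (by positivity)]
    linarith
  refine ⟨τ, hτ, χ, hχ, hχ1, fun c hc hM => ?_⟩
  have hc0 : Summable fun n => ‖c n‖ := by simpa [wt] using hc 0
  obtain ⟨a, ha⟩ := exists_fixedPoint_of_small (M := 6 * M) (L := L) (c := ellHeat c hc0)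
    (Φ := fun a => ellHeat c hc0 + ellDuhamel hδ hχ (ellNl a)) ((norm_ellHeat_le c hc0).trans
      (by linarith)) hε
    (fun a ha => by
      rw [add_sub_cancel_left]
      exact (norm_ellDuhamel_le hδ hχ _).trans (by gcongr; exact h1 a ha))
    (fun a b ha hb => by
      rw [add_sub_add_left_eq_sub, ← ellDuhamel_sub]
      exact (norm_ellDuhamel_le hδ hχ _).trans (by gcongr; exact h2 a b ha hb))
  have hfix : ∀ (n : ℤ) t, ellVal a n t = (decay (n ^ 2 * t) : ℂ) * c n +
      Complex.I * n * duhamel decay χ (tnl (ellVal a)) n t := fun n t => by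
    have := congrArg (fun b => ellVal b n t) ha
    simp only [ellVal_add, ellVal_heat, ellVal_duhamel, ellVal_nl] at this
    exact this.symm
  exact ⟨ellVal a, rapAll_of_fixed hδ hχ hc (continuous_ellVal a) (dom_ellVal a) hfix, hfix⟩

end FixedPoint

section Components

variable {f : ℝ → ℝ → ℂ}

theorem Smooth2.re (hf : Smooth2 f) : Smooth2 fun x t => (f x t).re :=
  Complex.reCLM.contDiff.comp (ContDiff.of_le hf le_rfl)

theorem Smooth2.im (hf : Smooth2 f) : Smooth2 fun x t => (f x t).im :=
  Complex.imCLM.contDiff.comp (ContDiff.of_le hf le_rfl)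

theorem Smooth2.dx_re (hf : Smooth2 f) (x t : ℝ) :
    YamabeFlow.dx (fun x t => (f x t).re) x t = (YamabeFlow.dx f x t).re :=
  (Complex.reCLM.hasFDerivAt.comp_hasDerivAt x (hf.hasDerivAt_x x t)).deriv

theorem Smooth2.dx_im (hf : Smooth2 f) (x t : ℝ) :
    YamabeFlow.dx (fun x t => (f x t).im) x t = (YamabeFlow.dx f x t).im :=
  (Complex.imCLM.hasFDerivAt.comp_hasDerivAt x (hf.hasDerivAt_x x t)).deriv

theorem Smooth2.dt_re (hf : Smooth2 f) (x t : ℝ) :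
    YamabeFlow.dt (fun x t => (f x t).re) x t = (YamabeFlow.dt f x t).re :=
  (Complex.reCLM.hasFDerivAt.comp_hasDerivAt t (hf.hasDerivAt_t x t)).deriv

theorem Smooth2.dt_im (hf : Smooth2 f) (x t : ℝ) :
    YamabeFlow.dt (fun x t => (f x t).im) x t = (YamabeFlow.dt f x t).im :=
  (Complex.imCLM.hasFDerivAt.comp_hasDerivAt t (hf.hasDerivAt_t x t)).deriv

end Components

theorem deriv_decay_of_nonneg {x : ℝ} (hx : 0 ≤ x) : deriv decay x = -decay x := by
  have h1 : HasDerivAt decay (deriv decay x) x :=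
    (contDiff_decay.differentiable (by simp) x).hasDerivAt
  have h2 : HasDerivAt (fun x : ℝ => exp (-x)) (exp (-x) * (-1)) x := (hasDerivAt_neg x).exp
  have h3 : HasDerivWithinAt decay (exp (-x) * (-1)) (Ici x) x :=
    h2.hasDerivWithinAt.congr (fun y hy => decay_of_nonneg (hx.trans hy)) (decay_of_nonneg hx)
  rw [(uniqueDiffWithinAt_Ici x).eq_deriv _ h1.hasDerivWithinAt h3, decay_of_nonneg hx]
  ring

section MildSolution

variable {χ : ℝ → ℝ} {δ τ : ℝ} {c : ℤ → ℂ} {a : ℤ → ℝ → ℂ}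

theorem hasDerivAt_mild (hχ : Cutoff δ χ) (hχ1 : ∀ x, |x| ≤ τ → χ x = 1) (ha : RapAll a)
    (hfix : ∀ (n : ℤ) t, a n t
        = (decay (n ^ 2 * t) : ℂ) * c n + Complex.I * n * duhamel decay χ (tnl a) n t)
    (n : ℤ) {t : ℝ} (h0 : 0 ≤ t) (ht : t ≤ τ) :
    HasDerivAt (a n) (Complex.I * n * (Complex.I * n * a n t) + Complex.I * n * tnl a n t) t := by
  have h1 : HasDerivAt (fun t : ℝ => (decay (n ^ 2 * t) : ℂ))
      ((deriv decay (n ^ 2 * t) * (n ^ 2 * 1) : ℝ) : ℂ) t := by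
    refine HasDerivAt.ofReal_comp ?_
    exact ((contDiff_decay.differentiable (by simp) (n ^ 2 * t)).hasDerivAt).comp t
      ((hasDerivAt_id t).const_mul _)
  have h2 := hasDerivAt_duhamel (F := decay) (χ := χ) (h := tnl a) (n := n) contDiff_decay
    hχ.bdd.1.continuous ((ha 0).tnl.rapidBound.cont n) t
  have h3 := (h1.mul_const (c n)).add (h2.const_mul (Complex.I * n))
  have h4 : duhamel (deriv decay) χ (tnl a) n t = -duhamel decay χ (tnl a) n t := by
    rw [duhamel, duhamel, ← intervalIntegral.integral_neg]
    refine intervalIntegral.integral_congr fun σ hσ => ?_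
    rw [uIcc_of_le h0] at hσ
    rw [deriv_decay_of_nonneg (mul_nonneg (sq_nonneg _) (sub_nonneg.2 hσ.2))]
    push_cast
    ring
  have hd0 : decay 0 = 1 := by rw [decay_of_nonneg le_rfl]; simp
  rw [h4, hd0, hχ1 t (by rwa [abs_of_nonneg h0]),
    deriv_decay_of_nonneg (mul_nonneg (sq_nonneg _) h0)] at h3
  refine (h3.congr_deriv ?_).congr_of_eventuallyEq (Eventually.of_forall fun s => hfix n s)
  rw [hfix n t]
  push_cast
  linear_combination (-((n : ℂ) ^ 2 * decay (n ^ 2 * t) * c n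
    + Complex.I * n ^ 3 * duhamel decay χ (tnl a) n t)) * Complex.I_mul_I

theorem RapAll.tpot (ha : RapAll a) : RapAll (tpot a) := fun j => (ha j).tpot
theorem RapAll.tdrift (ha : RapAll a) : RapAll (tdrift a) := fun j => (ha j).tdrift
theorem RapAll.tnl (ha : RapAll a) : RapAll (tnl a) := fun j => (ha j).tnl
theorem RapAll.dx (ha : RapAll a) : RapAll fun n t => Complex.I * n * a n t := fun j => (ha j).dx

theorem RapAll.dx_synth (ha : RapAll a) :
    YamabeFlow.dx (synth a) = synth fun n t => Complex.I * n * a n t := by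
  ext x t
  exact (ha.rapidBound.hasDerivAt_synth_x x t).deriv

theorem dt_synth_mild (ha : RapAll a) {t : ℝ}
    (h : ∀ n, HasDerivAt (a n)
      (Complex.I * n * (Complex.I * n * a n t) + Complex.I * n * tnl a n t) t) (x : ℝ) :
    dt (synth a) x t = dx (dx (synth a)) x t + dx (synth (tnl a)) x t := by
  obtain ⟨-, b, hb, hb0⟩ := ha 1
  have hb0 : RapidBound b := hb0
  have h1 := (ha.rapidBound.hasDerivAt_synth_t hb0 hb x t).deriv
  rw [ha.dx_synth, ha.dx.dx_synth, ha.tnl.dx_synth, ← ha.dx.dx.rapidBound.synth_add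
    ha.tnl.dx.rapidBound]
  refine h1.trans ?_
  simp only [synth]
  exact tsum_congr fun n => by rw [(hb n t).unique (h n)]

theorem synth_tdrift (ha : RapAll a) (x t : ℝ) :
    synth (tdrift a) x t = ((synth (tpot a) x t).re : ℂ) := by
  have h := ha.tpot.rapidBound
  have h1 : synth (tdrift a) x t = (1 / 2) * (synth (tpot a) x t + synth (tstar (tpot a)) x t) := by
    rw [← h.synth_add h.star, ← synth_const_mul]
    rfl
  rw [h1, synth_star, Complex.add_conj]
  push_cast
  ring

theorem synth_tnl (ha : RapAll a) (x t : ℝ) :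
    synth (tnl a) x t = (1 / 2) * (synth a x t * (starRingEnd ℂ) (synth a x t)) +
      ((synth (tpot a) x t).re : ℂ) * synth a x t := by
  have h := ha.rapidBound
  have h1 : synth (tnl a) x t = (1 / 2) * synth (tconv a (tstar a)) x t
      + synth (tconv (tdrift a) a) x t := by
    rw [← synth_const_mul, ← RapidBound.synth_add (Rap.const_mul _ ((ha 0).conv (ha 0).star)
      |>.rapidBound) (ha.tdrift.rapidBound.conv h)]
    rfl
  rw [h1, h.synth_conv h.star, ha.tdrift.rapidBound.synth_conv h, synth_star, synth_tdrift ha]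

theorem dx_synth_tpot (ha : RapAll a) (x t : ℝ) :
    dx (synth (tpot a)) x t = -(1 / 2) * (synth a x t ^ 2 -
      (2 * π)⁻¹ * ∫ y in (0:ℝ)..(2 * π), synth a y t ^ 2) := by
  have h := ha.rapidBound
  have hc := h.conv h
  have h1 : ∀ y, synth a y t ^ 2 = synth (tconv a a) y t := fun y => by
    rw [h.synth_conv h, sq]
  simp only [h1]
  have h3 : (((2 * π)⁻¹ : ℝ) : ℂ) * (2 * π) = 1 := by
    have := inv_mul_cancel₀ two_pi_pos.ne'
    exact_mod_cast this
  rw [hc.integral_synth, ha.tpot.dx_synth, ← mul_assoc, h3, one_mul]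
  have h2 : HasSum (fun n => -(1 / 2 : ℂ) * (tconv a a n t * expI n x -
      if n = 0 then tconv a a 0 t else 0))
      (-(1 / 2) * (synth (tconv a a) x t - tconv a a 0 t)) :=
    ((hc.summable_synth x t).hasSum.sub (hasSum_ite_eq 0 _)).mul_left _
  rw [← h2.tsum_eq, synth]
  refine tsum_congr fun n => ?_
  rcases eq_or_ne n 0 with rfl | hn
  · simp [expI_zero]
  · have : (n : ℂ) ≠ 0 := by exact_mod_cast hn
    rw [if_neg hn, sub_zero, tpot, halfInv]
    field_simp

end MildSolution

/-- The flow in arc-length gauge, for `p + i q = 2 u u_θ + i u²` and gauge drift `g`. -/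
structure GaugeFlow (τ : ℝ) (p q g : ℝ → ℝ → ℝ) : Prop where
  smooth_p : Smooth2 p
  smooth_q : Smooth2 q
  smooth_g : Smooth2 g
  per_p : ∀ s t, p (s + 2 * π) t = p s t
  per_q : ∀ s t, q (s + 2 * π) t = q s t
  per_g : ∀ s t, g (s + 2 * π) t = g s t
  mean_p : ∀ t, ∫ s in (0:ℝ)..(2 * π), p s t = 0
  mean_q : ∀ t, ∫ s in (0:ℝ)..(2 * π), q s t = 2 * π
  drift : ∀ s t, dx g s t = (1 / 2) * (q s t ^ 2 - p s t ^ 2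
    - (2 * π)⁻¹ * ∫ y in (0:ℝ)..(2 * π), (q y t ^ 2 - p y t ^ 2))
  flow_p : ∀ s t, 0 ≤ t → t ≤ τ → dt p s t = dx (dx p) s t + p s t * dx p s t + q s t * dx q s t
    + dx g s t * p s t + g s t * dx p s t
  flow_q : ∀ s t, 0 ≤ t → t ≤ τ → dt q s t = dx (dx q) s t + dx g s t * q s t + g s t * dx q s t

theorem re_intervalIntegral {f : ℝ → ℂ} (hf : Continuous f) (a b : ℝ) :
    (∫ x in a..b, f x).re = ∫ x in a..b, (f x).re :=
  (Complex.reCLM.intervalIntegral_comp_comm (hf.intervalIntegrable a b)).symm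

theorem im_intervalIntegral {f : ℝ → ℂ} (hf : Continuous f) (a b : ℝ) :
    (∫ x in a..b, f x).im = ∫ x in a..b, (f x).im :=
  (Complex.imCLM.intervalIntegral_comp_comm (hf.intervalIntegrable a b)).symm

/-- Local existence for the flow in arc-length gauge. -/
theorem exists_gaugeFlow (M : ℝ) : ∃ τ, 0 < τ ∧ ∀ c : ℤ → ℂ,
    (∀ k, Summable fun n => wt k n * ‖c n‖) → ∑' n, ‖c n‖ ≤ M → c 0 = Complex.I →
    ∃ p q g, GaugeFlow τ p q g ∧
      ∀ s, (p s 0 : ℂ) + q s 0 * Complex.I = ∑' n, c n * expI n s := by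
  obtain ⟨τ, hτ, χ, hχ, hχ1, H⟩ := exists_mild_solution M
  refine ⟨τ, hτ, fun c hc hM hc0 => ?_⟩
  obtain ⟨a, ha, hfix⟩ := H c hc hM
  have hd0 : decay 0 = 1 := by rw [decay_of_nonneg le_rfl]; simp
  have ha0 : ∀ t, a 0 t = Complex.I := fun t => by simp [hfix 0 t, hd0, hc0]
  have hW := ha.smooth
  have hP := ha.tpot.smooth
  have hN := ha.tnl.smooth
  have hmean : ∀ t, ∫ s in (0:ℝ)..(2 * π), synth a s t = 2 * π * Complex.I := fun t => by
    rw [ha.rapidBound.integral_synth, ha0]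
  have hre : (fun x t => (synth (tnl a) x t).re) = fun x t =>
      (1 / 2) * ((synth a x t).re ^ 2 + (synth a x t).im ^ 2)
        + (synth (tpot a) x t).re * (synth a x t).re := by
    ext x t
    rw [synth_tnl ha, Complex.mul_conj, Complex.normSq_apply]
    simp
    ring
  have him : (fun x t => (synth (tnl a) x t).im) = fun x t =>
      (synth (tpot a) x t).re * (synth a x t).im := by
    ext x t
    rw [synth_tnl ha, Complex.mul_conj, Complex.normSq_apply]
    simp
  have hflow : ∀ s t, 0 ≤ t → t ≤ τ →
      dt (synth a) s t = dx (dx (synth a)) s t + dx (synth (tnl a)) s t := fun s t h0 h1 =>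
    dt_synth_mild ha (fun n => hasDerivAt_mild hχ hχ1 ha hfix n h0 h1) s
  have hdxp : dx (fun x t => (synth a x t).re) = fun x t => (dx (synth a) x t).re := by
    ext x t; exact hW.dx_re x t
  have hdxq : dx (fun x t => (synth a x t).im) = fun x t => (dx (synth a) x t).im := by
    ext x t; exact hW.dx_im x t
  refine ⟨fun x t => (synth a x t).re, fun x t => (synth a x t).im,
    fun x t => (synth (tpot a) x t).re, ⟨hW.re, hW.im, hP.re, fun s t => by rw [synth_periodic],
    fun s t => by rw [synth_periodic], fun s t => by rw [synth_periodic], fun t => ?_, fun t => ?_,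
    fun s t => ?_, fun s t h0 h1 => ?_, fun s t h0 h1 => ?_⟩, fun s => ?_⟩
  · rw [← re_intervalIntegral (hW.cont_x t), hmean]
    simp
  · rw [← im_intervalIntegral (hW.cont_x t), hmean]
    simp
  · rw [hP.dx_re, dx_synth_tpot ha]
    have h1 : (∫ y in (0:ℝ)..(2 * π), synth a y t ^ 2).re =
        -∫ y in (0:ℝ)..(2 * π), ((synth a y t).im ^ 2 - (synth a y t).re ^ 2) := by
      rw [re_intervalIntegral (f := fun y => synth a y t ^ 2) ((hW.cont_x t).pow 2), ← intervalIntegral.integral_neg]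
      refine intervalIntegral.integral_congr fun y _ => ?_
      simp only [sq, Complex.mul_re]
      ring
    have h3 : ∀ z : ℂ, (-(1 / 2) * z).re = -(1 / 2) * z.re := fun z => by
      rw [← Complex.re_ofReal_mul]
      push_cast
      rfl
    rw [h3, Complex.sub_re, Complex.re_ofReal_mul, h1, sq, Complex.mul_re]
    ring
  · have h2 := congrArg Complex.re (hflow s t h0 h1)
    rw [Complex.add_re, ← hW.dt_re, ← hN.dx_re, hre, ← hW.dx.dx_re, ← hdxp] at h2
    rw [h2]
    have h3 := ((((hW.re.hasDerivAt_x s t).pow 2).add ((hW.im.hasDerivAt_x s t).pow 2)).const_mul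
      (1 / 2)).add ((hP.re.hasDerivAt_x s t).mul (hW.re.hasDerivAt_x s t))
    have h4 := h3.deriv
    unfold YamabeFlow.dx at h4 ⊢
    rw [add_assoc, add_assoc, add_assoc]
    congr 1
    refine Eq.trans ?_ (h4.trans ?_)
    · rfl
    · simp
      ring
  · have h2 := congrArg Complex.im (hflow s t h0 h1)
    rw [Complex.add_im, ← hW.dt_im, ← hN.dx_im, him, ← hW.dx.dx_im, ← hdxq] at h2
    rw [h2]
    have h4 := ((hP.re.hasDerivAt_x s t).mul (hW.im.hasDerivAt_x s t)).deriv
    rw [add_assoc]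
    congr 1
  · rw [Complex.re_add_im]
    simp only [synth]
    refine tsum_congr fun n => ?_
    rw [hfix]
    simp [hd0, duhamel]

section FourierDecay

variable {h : ℝ → ℂ}

theorem summable_wt_fc (k : ℕ) (hh : ContDiff ℝ ∞ h) (hp : ∀ x, h (x + 2 * π) = h x) :
    Summable fun n => wt k n * ‖fc h n‖ := by
  have hder : ∀ {h : ℝ → ℂ}, ContDiff ℝ ∞ h → ContDiff ℝ ∞ (deriv h) ∧
      ∀ x, HasDerivAt h (deriv h x) x := fun hh =>
    ⟨(contDiff_infty_iff_deriv.1 hh).2, fun x => (hh.differentiable (by simp) x).hasDerivAt⟩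
  have hper : ∀ {h : ℝ → ℂ}, (∀ x, h (x + 2 * π) = h x) → ∀ x, deriv h (x + 2 * π) = deriv h x :=
    fun hp x => by
      rw [← deriv_comp_add_const]
      simp only [hp]
  induction k generalizing h with
  | zero =>
    obtain ⟨h1, h2⟩ := hder hh
    obtain ⟨h3, h4⟩ := hder h1
    simpa [wt] using (hasSum_fc h2 h4 h3.continuous hp (by simpa using hper hp 0)).1
  | succ k ih =>
    obtain ⟨h1, h2⟩ := hder hh
    refine ((ih hh hp).add (ih h1 (hper hp))).congr fun n => ?_
    rw [fc_deriv h2 h1.continuous (by simpa using hp 0), norm_mul, norm_mul, Complex.norm_I,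
      Complex.norm_intCast, wt_add]
    simp only [wt]
    ring

theorem tsum_norm_fc_le {h' : ℝ → ℂ} (hd : ∀ x, HasDerivAt h (h' x) x) (hc : Continuous h')
    (hp : h (2 * π) = h 0) (hs : Summable fun n => ‖fc h n‖) :
    ∑' n, ‖fc h n‖ ≤ ‖fc h 0‖ + (1 / 2) * ((2 * π)⁻¹ * ∫ x in (0:ℝ)..(2 * π), ‖h' x‖ ^ 2)
      + (1 / 2) * ∑' n : ℤ, (((n : ℝ)) ^ 2)⁻¹ := by
  have h1 := ((hasSum_ite_eq (0 : ℤ) ‖fc h 0‖).add ((parseval hc).mul_left (1 / 2))).add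
    (summable_inv_sq_int.hasSum.mul_left (1 / 2))
  rw [← h1.tsum_eq]
  refine hs.tsum_le_tsum (fun n => ?_) h1.summable
  rcases eq_or_ne n 0 with rfl | hn
  · simp only [if_true]
    simp
  · have h2 : 0 < |(n : ℝ)| := abs_pos.2 (by exact_mod_cast hn)
    rw [if_neg hn, fc_deriv hd hc hp, norm_mul, norm_mul, Complex.norm_I, Complex.norm_intCast,
      ← sq_abs (n : ℝ)]
    have h3 : ‖fc h n‖ = (|(n : ℝ)| * ‖fc h n‖) * |(n : ℝ)|⁻¹ := by field_simp
    have h4 := two_mul_le_add_sq (|(n : ℝ)| * ‖fc h n‖) |(n : ℝ)|⁻¹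
    rw [inv_pow] at h4
    linarith

end FourierDecay

theorem abs_le_of_mean_zero {p p' : ℝ → ℝ} {I T : ℝ} (hT : 0 < T) (hd : ∀ x, HasDerivAt p (p' x) x)
    (hc : Continuous p') (hm : ∫ x in (0:ℝ)..T, p x = 0) (hI : ∫ x in (0:ℝ)..T, |p' x| ≤ I)
    {x : ℝ} (hx : x ∈ Icc 0 T) : |p x| ≤ I := by
  have cp : Continuous p := continuous_iff_continuousAt.2 fun x => (hd x).continuousAt
  have key : ∀ y ∈ uIoc (0:ℝ) T, ‖p x - p y‖ ≤ I := fun y hy => by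
    rw [uIoc_of_le hT.le] at hy
    rw [← intervalIntegral.integral_eq_sub_of_hasDerivAt (fun x _ => hd x)
      (hc.intervalIntegrable _ _)]
    refine (intervalIntegral.norm_integral_le_abs_integral_norm).trans (le_trans ?_ hI)
    rw [← abs_of_nonneg (intervalIntegral.integral_nonneg hT.le fun x _ => abs_nonneg (p' x))]
    refine intervalIntegral.abs_integral_mono_interval ?_ (ae_of_all _ fun x => abs_nonneg _)
      (hc.abs.intervalIntegrable _ _)
    rw [uIoc_of_le hT.le]
    rintro z ⟨h1, h2⟩
    rw [inf_lt_iff] at h1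
    rw [le_sup_iff] at h2
    refine ⟨?_, ?_⟩
    · rcases h1 with h1 | h1 <;> linarith [hx.1, hy.1]
    · rcases h2 with h2 | h2 <;> linarith [hx.2, hy.2]
  have h2 := intervalIntegral.norm_integral_le_of_norm_le_const key
  rw [intervalIntegral.integral_sub (by simp) (cp.intervalIntegrable _ _), hm,
    intervalIntegral.integral_const, sub_zero, sub_zero, smul_eq_mul, norm_mul,
    Real.norm_eq_abs, Real.norm_eq_abs, abs_of_pos hT, mul_comm] at h2
  exact le_of_mul_le_mul_right h2 hT

theorem exists_gauge_bound (Q S K : ℝ) : ∃ B : ℝ, ∀ p q r : ℝ → ℝ, Continuous r → Continuous q →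
    (∀ x, HasDerivAt p ((1 / 2) * (r x + p x ^ 2 - q x ^ 2)) x) →
    (∀ x, 0 ≤ q x) → (∀ x, q x ≤ Q) → p (2 * π) = p 0 → ∫ x in (0:ℝ)..(2 * π), p x = 0 →
    ∫ x in (0:ℝ)..(2 * π), r x ^ 2 ≤ S → -K ≤ ∫ x in (0:ℝ)..(2 * π), r x →
    ∫ x in (0:ℝ)..(2 * π), (((1 / 2) * (r x + p x ^ 2 - q x ^ 2)) ^ 2 + (p x * q x) ^ 2) ≤ B := by
  let A := 2 * π * Q ^ 2 + K
  let I := (1 / 2) * (2 * π + S + A + 2 * π * Q ^ 2)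
  refine ⟨(3 / 4) * (S + I ^ 2 * A + 2 * π * Q ^ 4) + Q ^ 2 * A,
    fun p q r cr cq hd hq0 hq hp hm hS hK => ?_⟩
  have cp : Continuous p := continuous_iff_continuousAt.2 fun x => (hd x).continuousAt
  have hπ := two_pi_pos
  have hQ : ∀ x, q x ^ 2 ≤ Q ^ 2 := fun x => pow_le_pow_left₀ (hq0 x) (hq x) 2
  have i1 : ∀ {f : ℝ → ℝ}, Continuous f → IntervalIntegrable f volume 0 (2 * π) :=
    fun hf => hf.intervalIntegrable _ _
  have hc : ∀ c : ℝ, ∫ _ in (0:ℝ)..(2 * π), c = 2 * π * c := fun c => by simp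
  have hA : ∫ x in (0:ℝ)..(2 * π), p x ^ 2 ≤ A := by
    have h0 := integral_deriv_eq_zero_of_periodic (T := 2 * π) hd (by fun_prop) hp
    have h1 : ∫ x in (0:ℝ)..(2 * π), q x ^ 2 ≤ 2 * π * Q ^ 2 := by
      rw [← hc]
      exact intervalIntegral.integral_mono_on hπ.le (i1 (by fun_prop)) (i1 (by fun_prop))
        fun x _ => hQ x
    rw [intervalIntegral.integral_const_mul, intervalIntegral.integral_sub (i1 (by fun_prop))
      (i1 (by fun_prop)), intervalIntegral.integral_add (i1 (by fun_prop)) (i1 (by fun_prop))] at h0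
    simp only [A]
    linarith
  have hI : ∫ x in (0:ℝ)..(2 * π), |(1 / 2) * (r x + p x ^ 2 - q x ^ 2)| ≤ I := by
    calc _ ≤ ∫ x in (0:ℝ)..(2 * π), (1 / 2) * (1 + r x ^ 2 + p x ^ 2 + Q ^ 2) := by
          refine intervalIntegral.integral_mono_on hπ.le (i1 (by fun_prop)) (i1 (by fun_prop))
            fun x _ => ?_
          have := hQ x
          refine abs_le.2 ⟨?_, ?_⟩ <;>
            nlinarith [sq_nonneg (r x - 1), sq_nonneg (r x + 1), sq_nonneg (p x), sq_nonneg (q x),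
              sq_nonneg (r x)]
      _ ≤ I := by
          rw [intervalIntegral.integral_const_mul, intervalIntegral.integral_add
            (i1 (by fun_prop)) (i1 (by fun_prop)), intervalIntegral.integral_add
            (i1 (by fun_prop)) (i1 (by fun_prop)), intervalIntegral.integral_add
            (i1 (by fun_prop)) (i1 (by fun_prop)), hc, hc]
          simp only [I]
          linarith
  have hP : ∀ x ∈ Icc 0 (2 * π), p x ^ 2 ≤ I ^ 2 := fun x hx => by
    have := abs_le_of_mean_zero hπ hd (by fun_prop) hm hI hx
    rw [← sq_abs]
    exact pow_le_pow_left₀ (abs_nonneg _) this 2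
  calc _ ≤ ∫ x in (0:ℝ)..(2 * π),
        ((3 / 4) * (r x ^ 2 + I ^ 2 * p x ^ 2 + Q ^ 4) + Q ^ 2 * p x ^ 2) := by
        refine intervalIntegral.integral_mono_on hπ.le (i1 (by fun_prop)) (i1 (by fun_prop))
          fun x hx => ?_
        have e1 : p x ^ 2 * p x ^ 2 ≤ I ^ 2 * p x ^ 2 :=
          mul_le_mul_of_nonneg_right (hP x hx) (sq_nonneg _)
        have e2 : q x ^ 2 * q x ^ 2 ≤ Q ^ 2 * Q ^ 2 :=
          mul_le_mul (hQ x) (hQ x) (sq_nonneg _) (sq_nonneg _)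
        have e3 : q x ^ 2 * p x ^ 2 ≤ Q ^ 2 * p x ^ 2 :=
          mul_le_mul_of_nonneg_right (hQ x) (sq_nonneg _)
        nlinarith [sq_nonneg (r x - p x ^ 2), sq_nonneg (r x + q x ^ 2),
          sq_nonneg (p x ^ 2 + q x ^ 2)]
    _ ≤ _ := by
        rw [intervalIntegral.integral_add (i1 (by fun_prop)) (i1 (by fun_prop)),
          intervalIntegral.integral_const_mul, intervalIntegral.integral_const_mul,
          intervalIntegral.integral_add (i1 (by fun_prop)) (i1 (by fun_prop)),
          intervalIntegral.integral_add (i1 (by fun_prop)) (i1 (by fun_prop)),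
          intervalIntegral.integral_const_mul, hc]
        have : I ^ 2 * ∫ x in (0:ℝ)..(2 * π), p x ^ 2 ≤ I ^ 2 * A :=
          mul_le_mul_of_nonneg_left hA (sq_nonneg _)
        have : Q ^ 2 * ∫ x in (0:ℝ)..(2 * π), p x ^ 2 ≤ Q ^ 2 * A :=
          mul_le_mul_of_nonneg_left hA (sq_nonneg _)
        linarith

/-- Controlled profiles have gauge data with uniformly summable Fourier coefficients. -/
theorem exists_gauge_data (K : ℝ) : ∃ M : ℝ, ∀ v : ℝ → ℝ, Profile v → Controlled K v →
    ∀ Θ : ℝ → ℝ, ContDiff ℝ ∞ Θ → (∀ θ, Θ (arcLen v θ) = θ) →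
    (∀ s, HasDerivAt Θ (v (Θ s) ^ 2) s) → (∀ s, Θ (s + 2 * π) = Θ s + 2 * π) →
    ∃ c : ℤ → ℂ, (∀ k, Summable fun n => wt k n * ‖c n‖) ∧ ∑' n, ‖c n‖ ≤ M ∧ c 0 = Complex.I ∧
      ∀ s, ((2 * v (Θ s) * deriv v (Θ s) : ℝ) : ℂ) + (v (Θ s) ^ 2 : ℝ) * Complex.I
        = ∑' n, c n * expI n s := by
  obtain ⟨B, hB⟩ := exists_gauge_bound (K ^ 2) (2 * K + 4 * π * (K ^ 2 + 1)) (2 * π * K)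
  refine ⟨1 + (1 / 2) * ((2 * π)⁻¹ * B) + (1 / 2) * ∑' n : ℤ, (((n : ℝ)) ^ 2)⁻¹,
    fun v hv hK Θ sΘ hl dΘ pΘ => ?_⟩
  have hπ := two_pi_pos
  have c0 := hv.smooth.continuous
  have cΘ := sΘ.continuous
  have c3 := hv.smooth_curv.continuous
  let p : ℝ → ℝ := fun s => 2 * v (Θ s) * deriv v (Θ s)
  let q : ℝ → ℝ := fun s => v (Θ s) ^ 2
  let r : ℝ → ℝ := fun s => curv v (Θ s)
  have dv : ∀ s, HasDerivAt (fun s => v (Θ s)) (deriv v (Θ s) * v (Θ s) ^ 2) s := fun s =>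
    ((hv.smooth.differentiable (by simp) _).hasDerivAt).comp s (dΘ s)
  have dv' : ∀ s, HasDerivAt (fun s => deriv v (Θ s)) (deriv (deriv v) (Θ s) * v (Θ s) ^ 2) s :=
    fun s => ((hv.smooth_deriv.differentiable (by simp) _).hasDerivAt).comp s (dΘ s)
  have sp : ContDiff ℝ ∞ p := (contDiff_const.mul (hv.smooth.comp sΘ)).mul (hv.smooth_deriv.comp sΘ)
  have sq' : ContDiff ℝ ∞ q := (hv.smooth.comp sΘ).pow 2
  have dp : ∀ s, HasDerivAt p ((1 / 2) * (r s + p s ^ 2 - q s ^ 2)) s := fun s =>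
    (((dv s).const_mul 2).mul (dv' s)).congr_deriv (by simp only [r, p, q, curv]; ring)
  have dq : ∀ s, HasDerivAt q (p s * q s) s := fun s =>
    ((dv s).pow 2).congr_deriv (by simp only [p, q]; ring)
  have pp : ∀ s, p (s + 2 * π) = p s := fun s => by
    simp only [p, pΘ, hv.per, periodic_deriv hv.per]
  have pq : ∀ s, q (s + 2 * π) = q s := fun s => by simp only [q, pΘ, hv.per]
  have mp : ∫ s in (0:ℝ)..(2 * π), p s = 0 := by
    refine integral_deriv_eq_zero_of_periodic (f := fun s => 2 * Real.log (v (Θ s)))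
      (fun s => ?_) sp.continuous ?_
    · refine (((dv s).log (hv.ne _)).const_mul 2).congr_deriv ?_
      have := hv.ne (Θ s)
      simp only [p]
      field_simp
    · have := pΘ 0
      rw [zero_add] at this
      simp only [this, hv.per]
  have mq : ∫ s in (0:ℝ)..(2 * π), q s = 2 * π := by
    have h1 := hv.integral_comp_param (h := fun θ => v θ ^ 2) cΘ hl (by fun_prop)
    refine h1.trans ?_
    rw [intervalIntegral.integral_congr (g := fun _ => 1) fun θ _ =>
      mul_inv_cancel₀ (pow_ne_zero 2 (hv.ne θ))]
    simp
  have mr : ∫ s in (0:ℝ)..(2 * π), r s = 2 * π * avgCurv v := by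
    have h1 := hv.integral_comp_param cΘ hl c3
    refine h1.trans ?_
    rw [avgCurv, mul_inv_cancel_left₀ hπ.ne']
  have mr2 : ∫ s in (0:ℝ)..(2 * π), r s ^ 2 ≤ 2 * K + 4 * π * (K ^ 2 + 1) := by
    have h1 := hv.integral_comp_param (h := fun θ => (curv v θ - avgCurv v) ^ 2) cΘ hl (by fun_prop)
    have h2 : ∫ s in (0:ℝ)..(2 * π), r s ^ 2 ≤
        ∫ s in (0:ℝ)..(2 * π), (2 * (r s - avgCurv v) ^ 2 + 2 * avgCurv v ^ 2) := by
      refine intervalIntegral.integral_mono_on hπ.le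
        (Continuous.intervalIntegrable (by fun_prop) _ _)
        (Continuous.intervalIntegrable (by fun_prop) _ _) fun s _ => ?_
      nlinarith [sq_nonneg (r s - 2 * avgCurv v)]
    rw [intervalIntegral.integral_add (Continuous.intervalIntegrable (by fun_prop) _ _)
      (by simp), intervalIntegral.integral_const_mul, h1, intervalIntegral.integral_const] at h2
    have h3 := hK.osc
    have h4 : avgCurv v ^ 2 ≤ K ^ 2 + 1 := by
      have := hv.avgCurv_le_one
      have := hK.avg
      rcases le_total 0 (avgCurv v) with h | h <;> nlinarith [sq_nonneg K]
    have h5 : ∫ θ in (0:ℝ)..(2 * π), (curv v θ - avgCurv v) ^ 2 * ((v θ) ^ 2)⁻¹ ≤ K := h3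
    have h6 := mul_le_mul_of_nonneg_left h4 hπ.le
    rw [sub_zero, smul_eq_mul] at h2
    linarith
  let h : ℝ → ℂ := fun s => (p s : ℂ) + q s * Complex.I
  let h' : ℝ → ℂ := fun s => (((1 / 2) * (r s + p s ^ 2 - q s ^ 2) : ℝ) : ℂ) +
    ((p s * q s : ℝ) : ℂ) * Complex.I
  have sh : ContDiff ℝ ∞ h := (Complex.ofRealCLM.contDiff.comp sp).add
    ((Complex.ofRealCLM.contDiff.comp sq').mul contDiff_const)
  have dh : ∀ s, HasDerivAt h (h' s) s := fun s =>
    (dp s).ofReal_comp.add ((dq s).ofReal_comp.mul_const _)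
  have ch' : Continuous h' := by
    have := sp.continuous
    have := sq'.continuous
    fun_prop
  have ph : ∀ s, h (s + 2 * π) = h s := fun s => by simp only [h, pp, pq]
  have h0 : fc h 0 = Complex.I := by
    have e1 : ∫ s in (0:ℝ)..(2 * π), h s = 2 * π * Complex.I := by
      rw [intervalIntegral.integral_add, intervalIntegral.integral_mul_const,
        intervalIntegral.integral_ofReal, intervalIntegral.integral_ofReal, mp, mq]
      · simp
      · exact (Complex.continuous_ofReal.comp sp.continuous).intervalIntegrable _ _
      · exact ((Complex.continuous_ofReal.comp sq'.continuous).mul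
          continuous_const).intervalIntegrable _ _
    have : (π : ℂ) ≠ 0 := Complex.ofReal_ne_zero.2 pi_ne_zero
    simp only [fc, neg_zero, expI_zero, one_mul]
    rw [e1]
    field_simp
  have hd2 : ContDiff ℝ ∞ (deriv h) := (contDiff_infty_iff_deriv.1 sh).2
  have hs := hasSum_fc (h := h) (h' := deriv h) (h'' := deriv (deriv h))
    (fun s => (sh.differentiable (by simp) s).hasDerivAt)
    (fun s => (hd2.differentiable (by simp) s).hasDerivAt)
    (hd2.continuous_deriv (by simp)) ph (by
      have : ∀ s, deriv h (s + 2 * π) = deriv h s := fun s => by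
        rw [← deriv_comp_add_const]
        simp only [ph]
      simpa using this 0)
  refine ⟨fc h, fun k => summable_wt_fc k sh ph, ?_, h0, fun s => (hs.2 s).tsum_eq.symm⟩
  refine (tsum_norm_fc_le dh ch' (by simpa using ph 0) hs.1).trans ?_
  have hn : ∀ s, ‖h' s‖ ^ 2 =
      ((1 / 2) * (r s + p s ^ 2 - q s ^ 2)) ^ 2 + (p s * q s) ^ 2 := fun s => by
    rw [← Complex.normSq_eq_norm_sq, Complex.normSq_add_mul_I]
  have hb := hB p q r (by fun_prop) sq'.continuous dp (fun s => sq_nonneg _)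
    (fun s => pow_le_pow_left₀ (hv.pos _).le (hK.le _) 2) (by simpa using pp 0) mp mr2 (by
      rw [mr]
      have := mul_le_mul_of_nonneg_left hK.avg hπ.le
      linarith)
  simp only [hn, h0, Complex.norm_I]
  gcongr

namespace GaugeFlow

variable {τ : ℝ} {p q g : ℝ → ℝ → ℝ}

/-- The defect of the compatibility relation `q_s = p q`. -/
noncomputable def defect (p q : ℝ → ℝ → ℝ) (s t : ℝ) : ℝ := dx q s t - p s t * q s t

theorem smooth_defect (h : GaugeFlow τ p q g) : Smooth2 (defect p q) :=
  Smooth2.of_contDiff (h.smooth_q.dx.contDiff.sub (h.smooth_p.contDiff.mul h.smooth_q.contDiff))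

theorem dx_defect (h : GaugeFlow τ p q g) (s t : ℝ) :
    dx (defect p q) s t = dx (dx q) s t - (dx p s t * q s t + p s t * dx q s t) :=
  ((h.smooth_q.dx.hasDerivAt_x s t).sub
    ((h.smooth_p.hasDerivAt_x s t).mul (h.smooth_q.hasDerivAt_x s t))).deriv

theorem dx_dx_defect (h : GaugeFlow τ p q g) (s t : ℝ) :
    dx (dx (defect p q)) s t = dx (dx (dx q)) s t - (dx (dx p) s t * q s t + dx p s t * dx q s t
      + (dx p s t * dx q s t + p s t * dx (dx q) s t)) := by
  rw [show dx (defect p q) = fun s t => dx (dx q) s t - (dx p s t * q s t + p s t * dx q s t) from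
    funext₂ h.dx_defect]
  exact ((h.smooth_q.dx.dx.hasDerivAt_x s t).sub
    (((h.smooth_p.dx.hasDerivAt_x s t).mul (h.smooth_q.hasDerivAt_x s t)).add
    ((h.smooth_p.hasDerivAt_x s t).mul (h.smooth_q.dx.hasDerivAt_x s t)))).deriv

theorem dx_drift (h : GaugeFlow τ p q g) (s t : ℝ) :
    dx (dx g) s t = q s t * dx q s t - p s t * dx p s t := by
  rw [show dx g = _ from funext₂ h.drift]
  have := ((((h.smooth_q.hasDerivAt_x s t).pow 2).sub ((h.smooth_p.hasDerivAt_x s t).pow 2)).sub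
    (hasDerivAt_const s ((2 * π)⁻¹ * ∫ y in (0:ℝ)..(2 * π), (q y t ^ 2 - p y t ^ 2)))).const_mul
    (1 / 2 : ℝ)
  refine this.deriv.trans ?_
  norm_num
  ring

theorem dt_defect (h : GaugeFlow τ p q g) (s : ℝ) {t : ℝ} (h0 : 0 ≤ t) (ht : t ≤ τ) :
    dt (defect p q) s t = dx (dx (defect p q)) s t + g s t * dx (defect p q) s t
      + 2 * (dx g s t + dx p s t) * defect p q s t := by
  have e1 : dt (defect p q) s t = dt (dx q) s t - (dt p s t * q s t + p s t * dt q s t) :=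
    ((h.smooth_q.dx.hasDerivAt_t s t).sub
      ((h.smooth_p.hasDerivAt_t s t).mul (h.smooth_q.hasDerivAt_t s t))).deriv
  have e2 : dx (dt q) s t = dx (dx (dx q)) s t + (dx (dx g) s t * q s t + dx g s t * dx q s t)
      + (dx g s t * dx q s t + g s t * dx (dx q) s t) := by
    rw [dx, show (fun y => dt q y t) = _ from funext fun y => h.flow_q y t h0 ht]
    exact (((h.smooth_q.dx.dx.hasDerivAt_x s t).add
      ((h.smooth_g.dx.hasDerivAt_x s t).mul (h.smooth_q.hasDerivAt_x s t))).add
      ((h.smooth_g.hasDerivAt_x s t).mul (h.smooth_q.dx.hasDerivAt_x s t))).deriv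
  rw [e1, h.smooth_q.dt_dx, e2, h.flow_p s t h0 ht, h.flow_q s t h0 ht, h.dx_dx_defect,
    h.dx_defect, h.dx_drift, defect]
  ring

theorem defect_eq_zero (h : GaugeFlow τ p q g) (hi : ∀ s, dx q s 0 = p s 0 * q s 0) (s : ℝ)
    {t : ℝ} (h0 : 0 ≤ t) (ht : t ≤ τ) : dx q s t = p s t * q s t := by
  have cg := h.smooth_g.dx.continuous
  have cp := h.smooth_p.dx.continuous
  have sD := h.smooth_defect
  obtain ⟨C, -, hC⟩ := exists_bound_of_continuous₂
    (f := fun s t => 3 * dx g s t + 4 * dx p s t) (by fun_prop) 0 (2 * π) 0 t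
  have perD : ∀ s t, defect p q (s + 2 * π) t = defect p q s t := fun s t => by
    simp only [defect, dx_periodic h.per_q, h.per_p, h.per_q]
  have sE : Smooth2 fun s t => defect p q s t ^ 2 := Smooth2.of_contDiff (sD.contDiff.pow 2)
  have hE : ∀ r ∈ Icc 0 t, (∫ s in (0:ℝ)..(2 * π), dt (fun s t => defect p q s t ^ 2) s r)
      ≤ C * ∫ s in (0:ℝ)..(2 * π), defect p q s r ^ 2 := by
    intro r hr
    have c0 := sD.cont_x r
    have c1 := sD.dx.cont_x r
    have c2 := sD.dx.dx.cont_x r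
    have c3 := h.smooth_g.cont_x r
    have c4 := h.smooth_g.dx.cont_x r
    have c5 := h.smooth_p.dx.cont_x r
    have per0 := perD 0 r
    have per1 := dx_periodic perD 0 r
    have per2 := h.per_g 0 r
    rw [zero_add] at per0 per1 per2
    have i1 : ∫ s in (0:ℝ)..(2 * π), defect p q s r * dx (dx (defect p q)) s r
        = - ∫ s in (0:ℝ)..(2 * π), dx (defect p q) s r * dx (defect p q) s r :=
      integral_mul_deriv_periodic (fun x => sD.hasDerivAt_x x r)
        (fun x => sD.dx.hasDerivAt_x x r) c1 c2 per0 per1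
    have i2 : 0 ≤ ∫ s in (0:ℝ)..(2 * π), dx (defect p q) s r * dx (defect p q) s r :=
      intervalIntegral.integral_nonneg two_pi_pos.le fun x _ => mul_self_nonneg _
    have i3 : ∫ s in (0:ℝ)..(2 * π), (dx g s r * defect p q s r ^ 2
        + g s r * (2 * defect p q s r * dx (defect p q) s r)) = 0 := by
      refine integral_deriv_eq_zero_of_periodic (f := fun s => g s r * defect p q s r ^ 2)
        (fun x => ?_) (by fun_prop) (by simp only [per0, per2])
      refine ((h.smooth_g.hasDerivAt_x x r).mul ((sD.hasDerivAt_x x r).pow 2)).congr_deriv ?_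
      simp
    have hdt : ∀ s, dt (fun s t => defect p q s t ^ 2) s r
        = 2 * (defect p q s r * dx (dx (defect p q)) s r) + (dx g s r * defect p q s r ^ 2
        + g s r * (2 * defect p q s r * dx (defect p q) s r))
        + (3 * dx g s r + 4 * dx p s r) * defect p q s r ^ 2 := by
      intro s
      refine ((sD.hasDerivAt_t s r).pow 2).deriv.trans ?_
      rw [h.dt_defect s hr.1 (hr.2.trans ht)]
      norm_num
      ring
    have i4 : ∫ s in (0:ℝ)..(2 * π), (3 * dx g s r + 4 * dx p s r) * defect p q s r ^ 2
        ≤ C * ∫ s in (0:ℝ)..(2 * π), defect p q s r ^ 2 := by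
      rw [← intervalIntegral.integral_const_mul]
      refine intervalIntegral.integral_mono_on two_pi_pos.le
        (Continuous.intervalIntegrable (by fun_prop) _ _)
        (Continuous.intervalIntegrable (by fun_prop) _ _) fun x hx => ?_
      exact mul_le_mul_of_nonneg_right ((le_abs_self _).trans (hC x hx r hr)) (sq_nonneg _)
    simp only [hdt]
    rw [intervalIntegral.integral_add (Continuous.intervalIntegrable (by fun_prop) _ _)
      (Continuous.intervalIntegrable (by fun_prop) _ _), intervalIntegral.integral_add
      (Continuous.intervalIntegrable (by fun_prop) _ _)
      (Continuous.intervalIntegrable (by fun_prop) _ _), intervalIntegral.integral_const_mul,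
      i1, i3]
    linarith
  have key := le_exp_mul_of_hasDerivAt_le h0 (fun r _ => sE.hasDerivAt_integral 0 (2 * π) r) hE
  have hz : ∫ s in (0:ℝ)..(2 * π), defect p q s 0 ^ 2 = 0 := by simp [defect, hi]
  rw [hz, zero_mul] at key
  have := eq_zero_of_integral_nonpos (sE.cont_x t) (fun x => sq_nonneg _)
    (fun x => by simp only [perD]) key s
  exact sub_eq_zero.1 (pow_eq_zero_iff two_ne_zero |>.1 this)

theorem pos_of_compat (h : GaugeFlow τ p q g) {t : ℝ} (ht : ∀ s, dx q s t = p s t * q s t)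
    (s : ℝ) : 0 < q s t := by
  have cp := h.smooth_p.cont_x t
  have hP : ∀ x, HasDerivAt (fun x => ∫ y in (0:ℝ)..x, p y t) (p x t) x := fun x =>
    intervalIntegral.integral_hasDerivAt_right (cp.intervalIntegrable _ _)
      cp.aestronglyMeasurable.stronglyMeasurableAtFilter cp.continuousAt
  have hc : ∀ x, q x t = q 0 t * exp (∫ y in (0:ℝ)..x, p y t) := by
    intro x
    have hd : ∀ x, HasDerivAt (fun x => q x t * exp (-∫ y in (0:ℝ)..x, p y t)) 0 x := by
      intro x
      refine ((h.smooth_q.hasDerivAt_x x t).mul (hP x).neg.exp).congr_deriv ?_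
      rw [ht]
      simp only [Pi.neg_apply]
      ring
    have := is_const_of_deriv_eq_zero (fun x => (hd x).differentiableAt) (fun x => (hd x).deriv) x 0
    simp only [intervalIntegral.integral_same, neg_zero, exp_zero, mul_one] at this
    rw [← this, mul_assoc, ← exp_add, neg_add_cancel, exp_zero, mul_one]
  have hq0 : 0 < q 0 t := by
    by_contra hn
    have h1 : ∫ s in (0:ℝ)..(2 * π), q s t ≤ 0 := by
      have : ∫ s in (0:ℝ)..(2 * π), q s t ≤ ∫ s in (0:ℝ)..(2 * π), (0:ℝ) := by
        refine intervalIntegral.integral_mono_on two_pi_pos.le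
          ((h.smooth_q.cont_x t).intervalIntegrable _ _)
          (continuous_const.intervalIntegrable _ _) fun x _ => ?_
        rw [hc x]
        exact mul_nonpos_of_nonpos_of_nonneg (not_lt.1 hn) (exp_pos _).le
      simpa using this
    rw [h.mean_q] at h1
    linarith [two_pi_pos]
  rw [hc s]
  positivity

theorem exists_pos_before (h : GaugeFlow τ p q g) (hτ : 0 ≤ τ)
    (hi : ∀ s, dx q s 0 = p s 0 * q s 0) :
    ∃ δ, 0 < δ ∧ ∀ s t, -δ ≤ t → t ≤ τ → 0 < q s t := by
  have hpos : ∀ s, ∀ t, 0 ≤ t → t ≤ τ → 0 < q s t := fun s t h0 h1 =>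
    h.pos_of_compat (fun s => h.defect_eq_zero hi s h0 h1) s
  have hev : ∀ᶠ t in 𝓝 (0:ℝ), ∀ s ∈ Icc (0:ℝ) (2 * π), 0 < q s t := by
    refine isCompact_Icc.eventually_forall_of_forall_eventually fun s _ => ?_
    have := (h.smooth_q.continuous.comp (continuous_swap)).continuousAt (x := ((0:ℝ), s))
    exact (Filter.Tendsto.eventually_const_lt (hpos s 0 le_rfl hτ) this :)
  obtain ⟨ε, hε, hball⟩ := Metric.eventually_nhds_iff.1 hev
  refine ⟨ε / 2, half_pos hε, fun s t h1 h2 => ?_⟩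
  obtain ⟨y, hy, hxy⟩ := Function.Periodic.exists_mem_Ico₀ (f := fun s => q s t)
    (fun s => h.per_q s t) two_pi_pos s
  rw [hxy]
  rcases le_or_gt 0 t with h0 | h0
  · exact hpos y t h0 h2
  · refine hball ?_ y ⟨hy.1, hy.2.le⟩
    rw [Real.dist_eq, sub_zero, abs_of_neg h0]
    linarith

theorem reparam (h : GaugeFlow τ p q g) {κ : ℝ → ℝ} (hκ : ContDiff ℝ ∞ κ) {τ' : ℝ} (hτ : τ' ≤ τ)
    (he : ∀ t, 0 ≤ t → t ≤ τ' → κ =ᶠ[𝓝 t] id) :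
    GaugeFlow τ' (fun s t => p s (κ t)) (fun s t => q s (κ t)) (fun s t => g s (κ t)) := by
  have sm : ∀ {f : ℝ → ℝ → ℝ}, Smooth2 f → Smooth2 fun s t => f s (κ t) := fun hf =>
    hf.comp₂ contDiff_fst (hκ.comp contDiff_snd)
  have hdt : ∀ (f : ℝ → ℝ → ℝ) s t, 0 ≤ t → t ≤ τ' → dt (fun s t => f s (κ t)) s t = dt f s t :=
    fun f s t h0 h1 => Filter.EventuallyEq.deriv_eq
      ((he t h0 h1).mono fun r hr => by simp only [hr, id])
  refine ⟨sm h.smooth_p, sm h.smooth_q, sm h.smooth_g, fun s t => h.per_p s _,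
    fun s t => h.per_q s _, fun s t => h.per_g s _, fun t => h.mean_p _, fun t => h.mean_q _,
    fun s t => h.drift s _, fun s t h0 h1 => ?_, fun s t h0 h1 => ?_⟩
  · rw [hdt p s t h0 h1, h.flow_p s t h0 (h1.trans hτ)]
    simp only [dx, (he t h0 h1).eq_of_nhds, id]
  · rw [hdt q s t h0 h1, h.flow_q s t h0 (h1.trans hτ)]
    simp only [dx, (he t h0 h1).eq_of_nhds, id]

/-- A gauge solution which is compatible initially may be modified away from `[0, τ / 2]` so that
`q` is positive everywhere. -/
theorem exists_pos (h : GaugeFlow τ p q g) (hτ : 0 < τ) (hi : ∀ s, dx q s 0 = p s 0 * q s 0) :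
    ∃ p' q' g', GaugeFlow (τ / 2) p' q' g' ∧ (∀ s, p' s 0 = p s 0) ∧ (∀ s, q' s 0 = q s 0) ∧
      (∀ s t, 0 < q' s t) ∧
      ∀ s t, 0 ≤ t → t ≤ τ / 2 → dx q' s t = p' s t * q' s t := by
  obtain ⟨δ, hδ, hpos⟩ := h.exists_pos_before hτ.le hi
  let χ : ContDiffBump (τ / 4 : ℝ) :=
    ⟨τ / 4 + min δ τ / 4, τ / 4 + min δ τ / 2, by positivity,
      by have : 0 < min δ τ := lt_min hδ hτ
         linarith⟩
  have hm : 0 < min δ τ := lt_min hδ hτ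
  have hm1 : min δ τ ≤ δ := min_le_left _ _
  have hm2 : min δ τ ≤ τ := min_le_right _ _
  have hκ : ContDiff ℝ ∞ fun t => t * χ t := contDiff_id.mul χ.contDiff
  have he : ∀ t, 0 ≤ t → t ≤ τ / 2 → (fun t => t * χ t) =ᶠ[𝓝 t] id := by
    intro t h0 h1
    have hmem : t ∈ Metric.ball (τ / 4) χ.rIn := by
      rw [Metric.mem_ball, Real.dist_eq, abs_lt]
      constructor <;> simp only [χ] <;> linarith
    filter_upwards [Metric.isOpen_ball.mem_nhds hmem] with r hr
    rw [χ.one_of_mem_closedBall (Metric.ball_subset_closedBall hr), mul_one, id]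
  have hr : ∀ t, -δ ≤ t * χ t ∧ t * χ t ≤ τ := by
    intro t
    by_cases ht : t ∈ Metric.ball (τ / 4) χ.rOut
    · rw [Metric.mem_ball, Real.dist_eq, abs_lt] at ht
      simp only [χ] at ht
      have h0 := χ.nonneg (x := t)
      have h1 := χ.le_one (x := t)
      rcases le_or_gt 0 t with h2 | h2
      · have := mul_nonneg h2 h0
        have := mul_le_mul_of_nonneg_left h1 h2
        constructor <;> linarith
      · have := mul_nonpos_of_nonpos_of_nonneg h2.le h0
        have := mul_le_mul_of_nonpos_left h1 h2.le
        constructor <;> linarith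
    · rw [χ.zero_of_le_dist (not_lt.1 ht), mul_zero]
      constructor <;> linarith
  refine ⟨_, _, _, h.reparam hκ (by linarith) he, fun s => by simp, fun s => by simp,
    fun s t => hpos s _ (hr t).1 (hr t).2, fun s t h0 h1 => ?_⟩
  have e := (he t h0 h1).eq_of_nhds
  simp only [id] at e
  have := h.defect_eq_zero hi s h0 (show t ≤ τ by linarith)
  simpa only [dx, e] using this

end GaugeFlow

theorem hasDerivAt_primitive {f : ℝ → ℝ} (hf : Continuous f) (a x : ℝ) :
    HasDerivAt (fun x => ∫ y in a..x, f y) (f x) x :=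
  intervalIntegral.integral_hasDerivAt_right (hf.intervalIntegrable _ _)
    hf.aestronglyMeasurable.stronglyMeasurableAtFilter hf.continuousAt

theorem Smooth2.continuous_primitive {f : ℝ → ℝ → ℝ} (hf : Smooth2 f) :
    Continuous fun p : ℝ × ℝ => ∫ y in (0:ℝ)..p.1, f y p.2 := by
  have : Continuous (Function.uncurry fun (p : ℝ × ℝ) (y : ℝ) => f y p.2) :=
    hf.continuous.comp (f := fun z : (ℝ × ℝ) × ℝ => (z.2, z.1.2)) (by fun_prop)
  exact intervalIntegral.continuous_parametric_intervalIntegral_of_continuous this continuous_fst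

theorem Smooth2.hasStrictFDerivAt_primitive {f : ℝ → ℝ → ℝ} (hf : Smooth2 f) (p : ℝ × ℝ) :
    HasStrictFDerivAt (fun p : ℝ × ℝ => ∫ y in (0:ℝ)..p.1, f y p.2)
      ((ContinuousLinearMap.toSpanSingleton ℝ (f p.1 p.2)).coprod
        (ContinuousLinearMap.toSpanSingleton ℝ (∫ y in (0:ℝ)..p.1, YamabeFlow.dt f y p.2))) p := by
  refine hasStrictFDerivAt_uncurry_coprod (f := fun s t => ∫ y in (0:ℝ)..s, f y t)
    (f₁ := fun s t => ContinuousLinearMap.toSpanSingleton ℝ (f s t))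
    (f₂ := fun s t => ContinuousLinearMap.toSpanSingleton ℝ (∫ y in (0:ℝ)..s, YamabeFlow.dt f y t))
    (Eventually.of_forall fun v => (hasDerivAt_primitive (hf.cont_x v.2) 0 v.1).hasFDerivAt)
    (Eventually.of_forall fun v => (hf.hasDerivAt_integral 0 v.1 v.2).hasFDerivAt) ?_ ?_
  · exact ((ContinuousLinearMap.toSpanSingletonCLE (𝕜 := ℝ) (E := ℝ)).continuous.comp
      hf.continuous).continuousAt
  · exact ((ContinuousLinearMap.toSpanSingletonCLE (𝕜 := ℝ) (E := ℝ)).continuous.comp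
      hf.dt.continuous_primitive).continuousAt

theorem Smooth2.primitive {f : ℝ → ℝ → ℝ} (hf : Smooth2 f) :
    Smooth2 fun s t => ∫ y in (0:ℝ)..s, f y t := by
  rw [Smooth2, contDiff_infty]
  intro n
  induction n generalizing f with
  | zero => exact contDiff_zero.2 hf.continuous_primitive
  | succ n ih =>
    push_cast
    rw [contDiff_succ_iff_hasFDerivAt]
    refine ⟨_, ?_, fun p => (hf.hasStrictFDerivAt_primitive p).hasFDerivAt⟩
    have h1 : ContDiff ℝ n fun p : ℝ × ℝ => f p.1 p.2 := hf.contDiff.of_le (by exact_mod_cast le_top)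
    have h2 := ih hf.dt
    have e : ∀ a b : ℝ, (ContinuousLinearMap.toSpanSingleton ℝ a).coprod
        (ContinuousLinearMap.toSpanSingleton ℝ b) = a • ContinuousLinearMap.fst ℝ ℝ ℝ
          + b • ContinuousLinearMap.snd ℝ ℝ ℝ := by
      intro a b
      ext <;> simp
    simp only [e]
    exact (h1.smul contDiff_const).add (h2.smul contDiff_const)

/-- A jointly smooth family of increasing bijections of the line has a jointly smooth inverse. -/
theorem exists_smooth_inverse {f : ℝ → ℝ → ℝ} (hf : Smooth2 f) (hpos : ∀ s t, 0 < dx f s t)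
    (hs : ∀ t, Function.Surjective fun s => f s t) :
    ∃ S : ℝ → ℝ → ℝ, Smooth2 S ∧ (∀ x t, f (S x t) t = x) ∧ ∀ s t, S (f s t) t = s := by
  have hmono : ∀ t, StrictMono fun s => f s t := fun t => strictMono_of_deriv_pos fun s => hpos s t
  choose S hS using hs
  have hl : ∀ s t, S t (f s t) = s := fun s t => (hmono t).injective (hS t _)
  let e : ℝ × ℝ ≃ ℝ × ℝ :=
    { toFun := fun p => (f p.1 p.2, p.2)
      invFun := fun p => (S p.2 p.1, p.2)
      left_inv := fun p => by simp only [hl]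
      right_inv := fun p => Prod.ext (hS p.2 p.1) rfl }
  have he : ContDiff ℝ ∞ e := hf.contDiff.prodMk contDiff_snd
  let F' : ℝ × ℝ → (ℝ × ℝ) ≃L[ℝ] (ℝ × ℝ) := fun p => ContinuousLinearEquiv.equivOfInverse
    (((dx f p.1 p.2) • ContinuousLinearMap.fst ℝ ℝ ℝ
      + (dt f p.1 p.2) • ContinuousLinearMap.snd ℝ ℝ ℝ).prod (ContinuousLinearMap.snd ℝ ℝ ℝ))
    (((dx f p.1 p.2)⁻¹ • (ContinuousLinearMap.fst ℝ ℝ ℝ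
      - (dt f p.1 p.2) • ContinuousLinearMap.snd ℝ ℝ ℝ)).prod (ContinuousLinearMap.snd ℝ ℝ ℝ))
    (fun z => by
      have := (hpos p.1 p.2).ne'
      ext
      · simp; field_simp
      · simp)
    (fun z => by
      have := (hpos p.1 p.2).ne'
      ext
      · simp; field_simp; ring
      · simp)
  have hfd : ∀ p, fderiv ℝ (fun p : ℝ × ℝ => f p.1 p.2) p = (dx f p.1 p.2) •
      ContinuousLinearMap.fst ℝ ℝ ℝ + (dt f p.1 p.2) • ContinuousLinearMap.snd ℝ ℝ ℝ := by
    intro p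
    rw [hf.dx_eq, hf.dt_eq]
    ext <;> simp
  have hst : ∀ p, HasStrictFDerivAt e ((F' p : (ℝ × ℝ) ≃L[ℝ] (ℝ × ℝ)) : ℝ × ℝ →L[ℝ] ℝ × ℝ) p := by
    intro p
    have h1 := (hf.contDiff.contDiffAt (x := p)).hasStrictFDerivAt (by simp)
    rw [hfd] at h1
    exact h1.prodMk hasStrictFDerivAt_snd
  have ho : IsOpenMap e := isOpenMap_of_hasStrictFDerivAt_equiv hst
  have hsymm := (e.toHomeomorphOfContinuousOpen he.continuous ho).contDiff_symm (𝕜 := ℝ)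
    (fun p => (hst p).hasFDerivAt) he
  exact ⟨fun x t => S t x, Smooth2.of_contDiff (contDiff_fst.comp hsymm), fun x t => hS t x, hl⟩

theorem surjective_of_add_two_pi {f : ℝ → ℝ} (hf : Continuous f)
    (h : ∀ x, f (x + 2 * π) = f x + 2 * π) : Function.Surjective f := by
  obtain ⟨C, hC⟩ := (isCompact_Icc (a := (0:ℝ)) (b := 2 * π)).exists_bound_of_continuousOn
    (f := fun x => f x - x) (by fun_prop)
  have hb : ∀ x, |f x - x| ≤ C := by
    intro x
    obtain ⟨y, hy, hxy⟩ := Function.Periodic.exists_mem_Ico₀ (f := fun x => f x - x)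
      (fun x => by simp only [h]; ring) two_pi_pos x
    rw [hxy]
    exact hC y ⟨hy.1, hy.2.le⟩
  refine hf.surjective ?_ ?_
  · refine tendsto_atTop_mono (f := fun x => x + -C) (fun x => ?_)
      (tendsto_atTop_add_const_right _ _ tendsto_id)
    have := (abs_le.1 (hb x)).1
    linarith
  · refine tendsto_atBot_mono (g := f) (f := fun x => x + C) (fun x => ?_)
      (tendsto_atBot_add_const_right _ _ tendsto_id)
    have := (abs_le.1 (hb x)).2
    linarith

theorem Smooth2.hasDerivAt_comp_t {f : ℝ → ℝ → ℝ} (hf : Smooth2 f) {a : ℝ → ℝ} {a' t : ℝ}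
    (ha : HasDerivAt a a' t) : HasDerivAt (fun r => f (a r) r)
      (a' * YamabeFlow.dx f (a t) t + YamabeFlow.dt f (a t) t) t := by
  have h1 : HasDerivAt (fun r => (a r, r)) (a', (1:ℝ)) t := ha.prodMk (hasDerivAt_id t)
  refine (HasFDerivAt.comp_hasDerivAt (f := fun r => (a r, r)) t
    (hf.hasFDerivAt (a t, t)) h1).congr_deriv ?_
  rw [show ((a', (1:ℝ)) : ℝ × ℝ) = a' • ((1:ℝ), (0:ℝ)) + ((0:ℝ), (1:ℝ)) by simp,
    map_add, map_smul, ← hf.dx_eq, ← hf.dt_eq, smul_eq_mul]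

namespace GaugeFlow

variable {τ : ℝ} {p q g : ℝ → ℝ → ℝ}

/-- Back from arc-length gauge to the coordinate `θ`. -/
theorem exists_coordinate (h : GaugeFlow τ p q g) (hq : ∀ s t, 0 < q s t)
    (hc : ∀ s t, 0 ≤ t → t ≤ τ → dx q s t = p s t * q s t) (a : ℝ) :
    ∃ S : ℝ → ℝ → ℝ, Smooth2 S ∧ (∀ θ t, S (θ + 2 * π) t = S θ t + 2 * π) ∧
      (∀ θ t, dx S θ t = (q (S θ t) t)⁻¹) ∧
      (∀ θ t, 0 ≤ t → t ≤ τ → dt S θ t = -(p (S θ t) t + g (S θ t) t)) ∧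
      ∀ s, S (a + ∫ y in (0:ℝ)..s, q y 0) 0 = s := by
  have sb : Smooth2 fun _ t => a + ∫ r in (0:ℝ)..t, (p 0 r + g 0 r) * q 0 r := by
    have h1 : Smooth2 fun r (_ : ℝ) => (p 0 r + g 0 r) * q 0 r := Smooth2.of_contDiff
      ((((h.smooth_p.slice_t 0).add (h.smooth_g.slice_t 0)).mul (h.smooth_q.slice_t 0)).comp
        contDiff_fst)
    exact Smooth2.of_contDiff (contDiff_const.add ((h1.primitive.slice_x 0).comp contDiff_snd))
  set b : ℝ → ℝ := fun t => a + ∫ r in (0:ℝ)..t, (p 0 r + g 0 r) * q 0 r with hb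
  have hbd : ∀ t, HasDerivAt b ((p 0 t + g 0 t) * q 0 t) t := fun t => by
    have h1 := (h.smooth_p.slice_t 0).continuous
    have h2 := (h.smooth_q.slice_t 0).continuous
    have h3 := (h.smooth_g.slice_t 0).continuous
    exact (hasDerivAt_primitive (f := fun r => (p 0 r + g 0 r) * q 0 r) (by fun_prop) 0 t).const_add
      a
  set f : ℝ → ℝ → ℝ := fun s t => b t + ∫ y in (0:ℝ)..s, q y t with hf
  have sf : Smooth2 f := Smooth2.of_contDiff (sb.contDiff.add h.smooth_q.primitive.contDiff)
  have hfx : ∀ s t, dx f s t = q s t := fun s t =>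
    ((hasDerivAt_primitive (h.smooth_q.cont_x t) 0 s).const_add (b t)).deriv
  have hft : ∀ s t, 0 ≤ t → t ≤ τ → dt f s t = (p s t + g s t) * q s t := by
    intro s t h0 h1
    refine ((hbd t).add (h.smooth_q.hasDerivAt_integral 0 s t)).deriv.trans ?_
    have hd : ∀ y, HasDerivAt (fun y => (p y t + g y t) * q y t) (dt q y t) y := by
      intro y
      have e1 := (h.smooth_q.dx.hasDerivAt_x y t).add
        ((h.smooth_g.hasDerivAt_x y t).mul (h.smooth_q.hasDerivAt_x y t))
      rw [h.flow_q y t h0 h1, add_assoc]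
      refine e1.congr_of_eventuallyEq (Eventually.of_forall fun y => ?_)
      simp only [Pi.add_apply, Pi.mul_apply, hc y t h0 h1]
      ring
    rw [intervalIntegral.integral_eq_sub_of_hasDerivAt (fun y _ => hd y)
      ((h.smooth_q.dt.cont_x t).intervalIntegrable _ _)]
    ring
  have hfp : ∀ s t, f (s + 2 * π) t = f s t + 2 * π := by
    intro s t
    have h1 := integral_periodic_shift (f := fun s => q s t) (fun s => h.per_q s t) s
    rw [h.mean_q] at h1
    simp only [hf]
    rw [← intervalIntegral.integral_add_adjacent_intervals (b := s)
      ((h.smooth_q.cont_x t).intervalIntegrable _ _) ((h.smooth_q.cont_x t).intervalIntegrable _ _),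
      h1, ← add_assoc]
  obtain ⟨S, hS, hr, hl⟩ := exists_smooth_inverse sf (fun s t => by rw [hfx]; exact hq s t)
    (fun t => surjective_of_add_two_pi (sf.cont_x t) fun s => hfp s t)
  have hSx : ∀ θ t, dx S θ t = (q (S θ t) t)⁻¹ := by
    intro θ t
    have h1 := (sf.hasDerivAt_x (S θ t) t).comp θ (hS.hasDerivAt_x θ t)
    have h2 := h1.unique ((hasDerivAt_id θ).congr_of_eventuallyEq
      (Eventually.of_forall fun x => hr x t))
    rw [hfx] at h2
    exact eq_inv_of_mul_eq_one_right h2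
  refine ⟨S, hS, fun θ t => ?_, hSx, fun θ t h0 h1 => ?_, fun s => ?_⟩
  · have := hl (S θ t + 2 * π) t
    rwa [hfp, hr] at this
  · have e1 := sf.hasDerivAt_comp_t (hS.hasDerivAt_t θ t)
    have e2 := e1.unique ((hasDerivAt_const t θ).congr_of_eventuallyEq
      (Eventually.of_forall fun r => hr θ r))
    rw [hfx, hft _ _ h0 h1, ← add_mul] at e2
    have := (mul_eq_zero.1 e2).resolve_right (hq _ _).ne'
    linarith
  · have := hl s 0
    simpa [hf, hb] using this

theorem exists_flowOn (h : GaugeFlow τ p q g) (hq : ∀ s t, 0 < q s t)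
    (hc : ∀ s t, 0 ≤ t → t ≤ τ → dx q s t = p s t * q s t) (a : ℝ) :
    ∃ u : ℝ → ℝ → ℝ, FlowOn τ u ∧ ∀ s, u (a + ∫ y in (0:ℝ)..s, q y 0) 0 = √(q s 0) := by
  obtain ⟨S, hS, hSp, hSx, hSt, hS0⟩ := h.exists_coordinate hq hc a
  have sQ : Smooth2 fun θ t => q (S θ t) t := h.smooth_q.comp₂ hS.contDiff contDiff_snd
  set u : ℝ → ℝ → ℝ := fun θ t => √(q (S θ t) t) with hu
  have su : Smooth2 u := Smooth2.of_contDiff (sQ.contDiff.sqrt fun z => (hq _ _).ne')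
  have upos : ∀ θ t, 0 < u θ t := fun θ t => Real.sqrt_pos.2 (hq _ _)
  have usq : ∀ θ t, u θ t ^ 2 = q (S θ t) t := fun θ t => Real.sq_sqrt (hq _ _).le
  have compx : ∀ {f : ℝ → ℝ → ℝ}, Smooth2 f → ∀ θ t, HasDerivAt (fun θ => f (S θ t) t)
      (dx f (S θ t) t * (u θ t ^ 2)⁻¹) θ := by
    intro f hf θ t
    have := (hf.hasDerivAt_x (S θ t) t).comp θ (hS.hasDerivAt_x θ t)
    rwa [hSx, ← usq] at this
  have ux : ∀ θ t, 0 ≤ t → t ≤ τ → dx u θ t = p (S θ t) t * (2 * u θ t)⁻¹ := by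
    intro θ t h0 h1
    have e1 := ((su.hasDerivAt_x θ t).pow 2).unique ((compx h.smooth_q θ t).congr_of_eventuallyEq
      (Eventually.of_forall fun x => usq x t))
    rw [hc _ _ h0 h1, ← usq] at e1
    have := (upos θ t).ne'
    field_simp at e1 ⊢
    norm_num at e1
    linarith
  have uxx : ∀ θ t, 0 ≤ t → t ≤ τ → dx (dx u) θ t = dx p (S θ t) t * (2 * u θ t ^ 3)⁻¹
      - p (S θ t) t ^ 2 * (4 * u θ t ^ 3)⁻¹ := by
    intro θ t h0 h1
    have hne := (upos θ t).ne'
    rw [dx, show (fun y => dx u y t) = _ from funext fun y => ux y t h0 h1]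
    refine ((compx h.smooth_p θ t).mul (((su.hasDerivAt_x θ t).const_mul 2).inv
      (mul_ne_zero two_ne_zero hne))).deriv.trans ?_
    rw [ux θ t h0 h1]
    simp only [Pi.inv_apply]
    field_simp
    ring
  have hR : ∀ θ t, 0 ≤ t → t ≤ τ → scalCurv 4 u θ t
      = 2 * dx p (S θ t) t + (q (S θ t) t ^ 2 - p (S θ t) t ^ 2) := by
    intro θ t h0 h1
    have hne := (upos θ t).ne'
    rw [scalCurv_eq, uxx θ t h0 h1, ← usq]
    field_simp
    ring
  have hlen : ∀ t, ∫ θ in (0:ℝ)..(2 * π), (u θ t ^ 2)⁻¹ = 2 * π := by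
    intro t
    simp only [usq, ← hSx]
    rw [intervalIntegral.integral_eq_sub_of_hasDerivAt (fun θ _ => hS.hasDerivAt_x θ t)
      ((hS.dx.cont_x t).intervalIntegrable _ _)]
    have := hSp 0 t
    rw [zero_add] at this
    rw [this]
    ring
  have havg : ∀ t, 0 ≤ t → t ≤ τ → scalCurvAvg 4 u t
      = (2 * π)⁻¹ * ∫ y in (0:ℝ)..(2 * π), (q y t ^ 2 - p y t ^ 2) := by
    intro t h0 h1
    have c1 := h.smooth_p.cont_x t
    have c2 := h.smooth_q.cont_x t
    have c3 := h.smooth_p.dx.cont_x t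
    have e1 : ∫ θ in (0:ℝ)..(2 * π), scalCurv 4 u θ t * (u θ t ^ 2)⁻¹
        = ∫ s in (0:ℝ)..(2 * π), (2 * dx p s t + (q s t ^ 2 - p s t ^ 2)) := by
      simp only [fun θ => hR θ t h0 h1, usq, ← hSx]
      have := intervalIntegral.integral_comp_mul_deriv (a := 0) (b := 2 * π)
        (g := fun s => 2 * dx p s t + (q s t ^ 2 - p s t ^ 2))
        (fun θ _ => hS.hasDerivAt_x θ t) (hS.dx.cont_x t).continuousOn (by fun_prop)
      refine this.trans ?_
      have e := hSp 0 t
      rw [zero_add] at e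
      rw [e]
      exact integral_periodic_shift (fun s => by
        simp only [dx_periodic h.per_p, h.per_p, h.per_q]) _
    have e2 : ∫ s in (0:ℝ)..(2 * π), dx p s t = 0 :=
      integral_deriv_eq_zero_of_periodic (fun x => h.smooth_p.hasDerivAt_x x t) c3
        (by simpa using h.per_p 0 t)
    rw [scalCurvAvg, hlen, e1, intervalIntegral.integral_add
      (Continuous.intervalIntegrable (by fun_prop) _ _)
      (Continuous.intervalIntegrable (by fun_prop) _ _), intervalIntegral.integral_const_mul, e2]
    ring
  refine ⟨u, ⟨su, fun θ t => ?_, upos, hlen 0, fun θ t h0 h1 => ?_⟩, fun s => ?_⟩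
  · simp only [hu, hSp, h.per_q]
  · have hne := (upos θ t).ne'
    have e1 := h.smooth_q.hasDerivAt_comp_t (hS.hasDerivAt_t θ t)
    rw [hSt θ t h0 h1.le, h.flow_q _ _ h0 h1.le, h.drift] at e1
    have e3 : dx (dx q) (S θ t) t
        = dx p (S θ t) t * q (S θ t) t + p (S θ t) t * dx q (S θ t) t := by
      rw [dx, show (fun y => dx q y t) = _ from funext fun y => hc y t h0 h1.le]
      exact ((h.smooth_p.hasDerivAt_x _ t).mul (h.smooth_q.hasDerivAt_x _ t)).deriv
    have e2 := ((su.hasDerivAt_t θ t).pow 2).unique (e1.congr_of_eventuallyEq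
      (Eventually.of_forall fun r => usq θ r))
    rw [hR θ t h0 h1.le, havg t h0 h1.le]
    set m := (2 * π)⁻¹ * ∫ y in (0:ℝ)..(2 * π), (q y t ^ 2 - p y t ^ 2)
    have e4 : u θ t * (2 * dt u θ t) = u θ t * (2 * ((1 / 4)
        * (2 * dx p (S θ t) t + (q (S θ t) t ^ 2 - p (S θ t) t ^ 2) - m) * u θ t)) := by
      rw [e3] at e2
      norm_num at e2
      rw [← usq] at e2 ⊢
      linear_combination e2
    linarith [mul_left_cancel₀ hne e4]
  · simp only [hu, hS0]

end GaugeFlow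

/-- Local existence with a time of existence depending only on the control of the initial data. -/
theorem exists_flowOn_of_controlled (K : ℝ) : ∃ τ, 0 < τ ∧ ∀ v, Profile v → Controlled K v →
    ∃ u, FlowOn τ u ∧ ∀ θ, u θ 0 = v θ := by
  obtain ⟨M, hM⟩ := exists_gauge_data K
  obtain ⟨τ, hτ, H⟩ := exists_gaugeFlow M
  refine ⟨τ / 2, half_pos hτ, fun v hv hK => ?_⟩
  obtain ⟨Θ, hΘ, hl, hr, hd, hp⟩ := hv.exists_param
  obtain ⟨c, hc, hcM, hc0, hci⟩ := hM v hv hK Θ hΘ hl hd hp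
  obtain ⟨p, q, g, hG, h0⟩ := H c hc hcM hc0
  have hpq : ∀ s, p s 0 = 2 * v (Θ s) * deriv v (Θ s) ∧ q s 0 = v (Θ s) ^ 2 := by
    intro s
    have e := (h0 s).trans (hci s).symm
    have e1 := congrArg Complex.re e
    have e2 := congrArg Complex.im e
    simp only [Complex.add_re, Complex.add_im, Complex.mul_re, Complex.mul_im, Complex.ofReal_re,
      Complex.ofReal_im, Complex.I_re, Complex.I_im, mul_zero, mul_one, sub_zero, add_zero, zero_add] at e1 e2
    exact ⟨e1, e2⟩
  have hv' : ∀ x, HasDerivAt v (deriv v x) x := fun x =>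
    (hv.smooth.differentiable (by simp) x).hasDerivAt
  have hi : ∀ s, dx q s 0 = p s 0 * q s 0 := by
    intro s
    rw [dx, show (fun y => q y 0) = _ from funext fun y => (hpq y).2, (hpq s).1, (hpq s).2]
    refine (((hv' (Θ s)).comp s (hd s)).pow 2).deriv.trans ?_
    norm_num
    ring
  obtain ⟨p', q', g', hG', hp0, hq0, hpos, hc'⟩ := hG.exists_pos hτ hi
  obtain ⟨u, hu, hu0⟩ := hG'.exists_flowOn hpos hc' (Θ 0)
  refine ⟨u, hu, fun θ => ?_⟩
  have e : Θ 0 + ∫ y in (0:ℝ)..(arcLen v θ), q' y 0 = θ := by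
    simp only [hq0, fun y => (hpq y).2]
    rw [intervalIntegral.integral_eq_sub_of_hasDerivAt (fun y _ => hd y)
      (((hv.smooth.continuous.comp hΘ.continuous).pow 2).intervalIntegrable _ _), hl]
    ring
  have := hu0 (arcLen v θ)
  rw [e, hq0, (hpq _).2, hl, Real.sqrt_sq (hv.pos θ).le] at this
  exact this

namespace FlowOn

variable {T τ a : ℝ} {u w : ℝ → ℝ → ℝ}

theorem of_locally (hn : ∫ θ in (0:ℝ)..(2 * π), ((u θ 0) ^ 2)⁻¹ = 2 * π)
    (h : ∀ t, ∃ w : ℝ → ℝ → ℝ, Smooth2 w ∧ (∀ θ t, w (θ + 2 * π) t = w θ t) ∧ (∀ θ t, 0 < w θ t) ∧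
      (0 ≤ t → t < T → ∀ θ,
        dt w θ t = (1 / 4) * (scalCurv 4 w θ t - scalCurvAvg 4 w t) * w θ t) ∧
      ∀ᶠ r in 𝓝 t, ∀ θ, u θ r = w θ r) : FlowOn T u := by
  refine ⟨?_, fun θ t => ?_, fun θ t => ?_, hn, fun θ t h0 hT => ?_⟩
  · refine contDiff_iff_contDiffAt.2 fun p => ?_
    obtain ⟨w, hw, -, -, -, he⟩ := h p.2
    refine (hw.contDiff.contDiffAt (x := p)).congr_of_eventuallyEq ?_
    filter_upwards [continuous_snd.continuousAt.eventually he] with z hz using hz z.1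
  · obtain ⟨w, -, hp, -, -, he⟩ := h t
    rw [he.self_of_nhds, he.self_of_nhds, hp]
  · obtain ⟨w, -, -, hp, -, he⟩ := h t
    rw [he.self_of_nhds]
    exact hp θ t
  · obtain ⟨w, -, -, -, hf, he⟩ := h t
    have e1 : dt u θ t = dt w θ t := Filter.EventuallyEq.deriv_eq (he.mono fun r hr => hr θ)
    have e2 := he.self_of_nhds
    rw [e1, hf h0 hT θ]
    simp only [scalCurv, scalCurvAvg, e2]

theorem shift (h : FlowOn T u) (h0 : 0 ≤ a) (ha : a < T) :
    FlowOn (T - a) fun θ t => u θ (t + a) := by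
  refine ⟨h.smooth.comp₂ contDiff_fst (contDiff_snd.add contDiff_const), fun θ t => h.per θ _,
    fun θ t => h.pos θ _, by simpa using h.length_eq h0 ha, fun θ t h1 h2 => ?_⟩
  have e : dt (fun θ t => u θ (t + a)) θ t = dt u θ (t + a) := deriv_comp_add_const _ _ _
  rw [e, h.flow θ _ (by linarith) (by linarith)]
  rfl

/-- Restarting the flow at time `a` prolongs the solution. -/
theorem exists_extension (hu : FlowOn T u) (hw : FlowOn τ w) (h0 : 0 ≤ a) (ha : a < T)
    (hT : T ≤ a + τ) (hi : ∀ θ, w θ 0 = u θ a) :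
    ∃ u', FlowOn (a + τ) u' ∧ ∀ θ, u' θ 0 = u θ 0 := by
  have agree : ∀ θ t, a ≤ t → t < T → u θ t = w θ (t - a) := by
    intro θ t h1 h2
    have := (hu.shift h0 ha).eq_of_initial_eq (hw.mono (show T - a ≤ τ by linarith))
      (fun θ => by simp only [zero_add, hi]) θ (t := t - a) (by linarith) (by linarith)
    simpa using this
  set b := (a + T) / 2 with hb
  set u' : ℝ → ℝ → ℝ := fun θ t => if t < b then u θ t else w θ (t - a) with hu'
  have hz : ∀ θ, u' θ 0 = u θ 0 := fun θ => if_pos (by linarith)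
  refine ⟨u', of_locally (by simpa only [hz] using hu.norm) fun t => ?_, hz⟩
  rcases lt_or_ge t b with ht | ht
  · refine ⟨u, hu.smooth, hu.per, hu.pos, fun h1 _ θ => hu.flow θ t h1 (by linarith), ?_⟩
    filter_upwards [Iio_mem_nhds ht] with r hr θ using if_pos hr
  · refine ⟨fun θ t => w θ (t - a), hw.smooth.comp₂ contDiff_fst (contDiff_snd.sub contDiff_const),
      fun θ t => hw.per θ _, fun θ t => hw.pos θ _, fun _ h2 θ => ?_, ?_⟩
    · have e : dt (fun θ t => w θ (t - a)) θ t = dt w θ (t - a) := deriv_comp_sub_const _ _ _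
      rw [e, hw.flow θ _ (by linarith) (by linarith)]
      rfl
    · filter_upwards [Ioi_mem_nhds (show a < t by linarith)] with r hr θ
      by_cases hrb : r < b
      · simp only [hu', if_pos hrb]
        exact agree θ r (le_of_lt hr) (by linarith)
      · simp only [hu', if_neg hrb]

end FlowOn

theorem Profile.controlled {v : ℝ → ℝ} (hv : Profile v) : ∃ K, Controlled K v := by
  obtain ⟨B, hB⟩ := (isCompact_Icc (a := (0:ℝ)) (b := 2 * π)).exists_bound_of_continuousOn
    hv.smooth.continuous.continuousOn
  refine ⟨max B (max (oscCurv v) (-avgCurv v)), fun θ => ?_, ?_, ?_⟩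
  · obtain ⟨x, hx, hxe⟩ := Function.Periodic.exists_mem_Ico₀ (f := v) hv.per two_pi_pos θ
    rw [hxe]
    exact ((le_abs_self _).trans (hB x ⟨hx.1, hx.2.le⟩)).trans (le_max_left _ _)
  · exact (le_max_left _ _).trans (le_max_right _ _)
  · exact neg_le.1 ((le_max_right _ _).trans (le_max_right _ _))

theorem exists_flowOn {v : ℝ → ℝ} (hv : Profile v) {T : ℝ} (hT : 0 < T) :
    ∃ u, FlowOn T u ∧ ∀ θ, u θ 0 = v θ := by
  obtain ⟨K₀, hK₀⟩ := hv.controlled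
  obtain ⟨τ₀, hτ₀, H₀⟩ := exists_flowOn_of_controlled K₀
  obtain ⟨K, hK⟩ := exists_controlled hv T
  obtain ⟨τ, hτ, H⟩ := exists_flowOn_of_controlled K
  have key : ∀ n : ℕ, ∃ u, FlowOn (min T (τ₀ + n * (τ / 2))) u ∧ ∀ θ, u θ 0 = v θ := by
    intro n
    induction n with
    | zero =>
      obtain ⟨u, hu, hi⟩ := H₀ v hv hK₀
      exact ⟨u, hu.mono (by simp), hi⟩
    | succ n ih =>
      obtain ⟨u, hu, hi⟩ := ih
      set S := min T (τ₀ + n * (τ / 2)) with hS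
      have hSpos : 0 < S := lt_min hT (by positivity)
      have ha0 : 0 ≤ max 0 (S - τ / 2) := le_max_left _ _
      have ha1 : max 0 (S - τ / 2) < S := max_lt hSpos (by linarith)
      have ha2 : S - τ / 2 ≤ max 0 (S - τ / 2) := le_max_right _ _
      obtain ⟨w, hw, hwi⟩ := H _ (hu.profile ha0 ha1)
        (hK S (min_le_left _ _) u hu hi _ ha0 ha1)
      obtain ⟨u', hu', hi'⟩ := hu.exists_extension hw ha0 ha1 (by linarith) hwi
      refine ⟨u', hu'.mono ?_, fun θ => (hi' θ).trans (hi θ)⟩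
      have : min T (τ₀ + ((n + 1 : ℕ) : ℝ) * (τ / 2)) ≤ S + τ / 2 := by
        rw [hS, ← min_add_add_right]
        refine min_le_min (by linarith) ?_
        push_cast
        linarith
      linarith
  obtain ⟨n, hn⟩ := exists_nat_ge (T / (τ / 2))
  obtain ⟨u, hu, hi⟩ := key n
  refine ⟨u, hu.mono (le_min le_rfl ?_), hi⟩
  have := (div_le_iff₀ (half_pos hτ)).1 hn
  linarith

theorem exists_global_flow {v : ℝ → ℝ} (hv : Profile v) :
    ∃ u, (∀ T, FlowOn T u) ∧ ∀ θ, u θ 0 = v θ := by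
  have H : ∀ n : ℕ, ∃ u, FlowOn ((n : ℝ) + 2) u ∧ ∀ θ, u θ 0 = v θ := fun n =>
    exists_flowOn hv (by positivity)
  choose U hU hi using H
  have agree : ∀ (m n : ℕ) (t : ℝ), 0 ≤ t → t < m + 2 → t < n + 2 → ∀ θ, U m θ t = U n θ t := by
    intro m n t h0 h1 h2 θ
    exact ((hU m).mono (min_le_left _ ((n:ℝ) + 2))).eq_of_initial_eq
      ((hU n).mono (min_le_right ((m:ℝ) + 2) _)) (fun θ => by rw [hi, hi]) θ h0 (lt_min h1 h2)
  set u : ℝ → ℝ → ℝ := fun θ t => U ⌊t⌋₊ θ t with hu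
  have hz : ∀ θ, u θ 0 = v θ := fun θ => by simp only [hu, hi]
  refine ⟨u, fun T => FlowOn.of_locally (by simpa only [hz] using hv.norm) fun t => ?_, hz⟩
  rcases lt_or_ge t 1 with ht | ht
  · refine ⟨U 0, (hU 0).smooth, (hU 0).per, (hU 0).pos,
      fun h0 _ θ => (hU 0).flow θ t h0 (by push_cast; linarith), ?_⟩
    filter_upwards [Iio_mem_nhds ht] with r hr θ
    simp only [hu, Nat.floor_eq_zero.2 (show r < 1 from hr)]
  · have hlt := Nat.lt_floor_add_one t
    refine ⟨U ⌊t⌋₊, (hU _).smooth, (hU _).per, (hU _).pos,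
      fun h0 _ θ => (hU _).flow θ t h0 (by linarith), ?_⟩
    filter_upwards [Ioo_mem_nhds (show 0 < t by linarith) (show t < t + 1 by linarith)] with r hr θ
    exact agree _ _ r hr.1.le (by linarith [Nat.lt_floor_add_one r]) (by linarith [hr.2]) θ

theorem flowOn_of_isNormalizedFlow {u₀ : ℝ → ℝ} {u : ℝ → ℝ → ℝ} (h : IsNormalizedFlow 4 u₀ u)
    (hn : ∫ θ in (0:ℝ)..(2 * π), ((u₀ θ) ^ 2)⁻¹ = 2 * π) (T : ℝ) : FlowOn T u := by
  obtain ⟨h1, h2, h3, h4, h5⟩ := h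
  exact ⟨h1, h2, h3, by simpa only [h4] using hn, fun θ t h0 _ => h5 θ t h0⟩

end YamabeFlow

/-- Global existence, uniqueness and exponential convergence for the
one-dimensional normalized Yamabe flow (α = 4). -/
theorem yamabe_flow_global_existence_convergence
    (u₀ : ℝ → ℝ)
    (h0 : ContDiff ℝ (⊤ : ℕ∞) u₀)
    (h0per : ∀ θ, u₀ (θ + 2 * π) = u₀ θ)
    (h0pos : ∀ θ, 0 < u₀ θ)
    (h0norm : ∫ θ in (0:ℝ)..(2 * π), ((u₀ θ) ^ 2)⁻¹ = 2 * π) :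
    ∃ u : ℝ → ℝ → ℝ,
      IsNormalizedFlow 4 u₀ u
      ∧ (∀ u' : ℝ → ℝ → ℝ, IsNormalizedFlow 4 u₀ u' →
          ∀ θ t, 0 ≤ t → u' θ t = u θ t)
      ∧ ∃ (uinf : ℝ → ℝ) (C a : ℝ), 0 < C ∧ 0 < a
          ∧ ContDiff ℝ (⊤ : ℕ∞) uinf
          ∧ (∀ θ, uinf (θ + 2 * π) = uinf θ)
          ∧ (∀ θ, 0 < uinf θ)
          ∧ (∀ t, 0 ≤ t → (⨆ θ : ℝ, |u θ t - uinf θ|) ≤ C * Real.exp (-a * t))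
          ∧ ∃ c : ℝ, ∀ θ, (uinf θ) ^ 3 * (4 * deriv (deriv uinf) θ + uinf θ) = c := by
  obtain ⟨u, hu, hi⟩ := YamabeFlow.exists_global_flow (v := u₀) ⟨h0, h0per, h0pos, h0norm⟩
  obtain ⟨U, C, a, hC, ha, hU, hUp, hUpos, hconv, hcurv⟩ := YamabeFlow.exists_limit hu
  refine ⟨u, ⟨(hu 0).smooth, (hu 0).per, (hu 0).pos, hi,
    fun θ t ht => (hu (t + 1)).flow θ t ht (by linarith)⟩, fun u' hu' θ t ht => ?_,
    U, C, a, hC, ha, hU, hUp, hUpos, fun t ht => ciSup_le fun θ => hconv t ht θ, hcurv⟩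
  exact (YamabeFlow.flowOn_of_isNormalizedFlow hu' h0norm (t + 1)).eq_of_initial_eq (hu (t + 1))
    (fun θ => by rw [hu'.2.2.2.1, hi]) θ ht (by linarith)
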